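/- There are no non-split self-extensions of irreducible kGL_n(q)-modules in the unipotent principal Harish-Chandra series: if Y is a simple kG-module for which there exists a surjective kG-module homomorphism from the permutation module k[G/B] onto Y (i.e., Y lies in the head of k[G/B]), then Ext^1_{kG}(Y, Y) = 0. -/

import Mathlib

open CategoryTheory

noncomputable section

/-- The Borel subgroup of upper-triangular invertible matrices in `GL n F`. -/
def upperTriangularSubgroup (n : ℕ) (F : Type) [Field F] :
    Subgroup (GL (Fin n) F) where
  carrier := {g | Matrix.BlockTriangular (g : Matrix (Fin n) (Fin n) F) id}
  mul_mem' := by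
    intro a b ha hb
    simpa [Units.val_mul] using ha.mul hb
  one_mem' := by
    simpa using Matrix.blockTriangular_one
  inv_mem' := by
    intro g hg
    letI := g.invertible
    simpa [Matrix.coe_units_inv] using Matrix.blockTriangular_inv_of_blockTriangular hg

/-- The permutation module `k[G/B]`, as a module over the group algebra
`MonoidAlgebra k G`. -/
abbrev permutationModule (k : Type) [Field k] {G : Type} [Group G] (B : Subgroup G) :=
  (Representation.ofMulAction k G (G ⧸ B)).asModule

namespace UnipotentSeries

open Matrix

set_option linter.unusedSectionVars false

section Triangular

variable {ι F : Type} [Fintype ι] [DecidableEq ι] [Field F]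

/-- The invertible matrices that are upper triangular for the order on indices given by `σ`. -/
def borel (F : Type) [Field F] (σ : ι → ℕ) : Subgroup (GL ι F) where
  carrier := {g | BlockTriangular (g : Matrix ι ι F) σ}
  mul_mem' := by
    intro a b ha hb
    simpa [Units.val_mul] using ha.mul hb
  one_mem' := by
    simpa using Matrix.blockTriangular_one
  inv_mem' := by
    intro g hg
    let _ := g.invertible
    simpa [Matrix.coe_units_inv] using Matrix.blockTriangular_inv_of_blockTriangular hg

theorem mem_borel {σ : ι → ℕ} {g : GL ι F} :
    g ∈ borel F σ ↔ ∀ i j, σ j < σ i → (g : Matrix ι ι F) i j = 0 := Iff.rfl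

theorem mul_apply_of_le {σ : ι → ℕ} {a b : Matrix ι ι F}
    (ha : ∀ i j, σ j ≤ σ i → a i j = (1 : Matrix ι ι F) i j)
    (hb : ∀ i j, σ j < σ i → b i j = 0) {i j : ι} (hij : σ j ≤ σ i) :
    (a * b) i j = b i j := by
  rw [Matrix.mul_apply, Finset.sum_eq_single i]
  · simp [ha i i le_rfl]
  · intro k _ hk
    rcases le_or_gt (σ k) (σ i) with h | h
    · rw [ha i k h, Matrix.one_apply_ne (Ne.symm hk), zero_mul]
    · rw [hb k j (lt_of_le_of_lt hij h), mul_zero]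
  · simp

/-- The unipotent upper triangular matrices for the order on indices given by `σ`. -/
def unip (F : Type) [Field F] (σ : ι → ℕ) : Subgroup (GL ι F) where
  carrier := {g | ∀ i j, σ j ≤ σ i → (g : Matrix ι ι F) i j = (1 : Matrix ι ι F) i j}
  mul_mem' := by
    intro a b ha hb i j hij
    rw [Units.val_mul, mul_apply_of_le ha _ hij, hb i j hij]
    intro i j h
    rw [hb i j h.le, Matrix.one_apply_ne]
    rintro rfl
    exact lt_irrefl _ h
  one_mem' := by
    intro i j _
    simp
  inv_mem' := by
    intro g hg i j hij
    have h1 : g ∈ borel F σ := by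
      intro i j h
      rw [hg i j h.le, Matrix.one_apply_ne]
      rintro rfl
      exact lt_irrefl _ h
    have h2 := mul_apply_of_le (b := ((g⁻¹ : GL ι F) : Matrix ι ι F)) hg
      (fun i j h => inv_mem h1 h) hij
    rw [← h2, ← Units.val_mul, mul_inv_cancel, Units.val_one]

theorem mem_unip {σ : ι → ℕ} {g : GL ι F} :
    g ∈ unip F σ ↔ ∀ i j, σ j ≤ σ i → (g : Matrix ι ι F) i j = (1 : Matrix ι ι F) i j := Iff.rfl

theorem unip_le_borel (σ : ι → ℕ) : unip F σ ≤ borel F σ := by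
  intro g hg i j h
  rw [hg i j h.le, Matrix.one_apply_ne]
  rintro rfl
  exact lt_irrefl _ h

/-- The permutation matrix of `π`, as an invertible matrix. -/
def permGL (F : Type) [Field F] (π : Equiv.Perm ι) : GL ι F where
  val := Matrix.of fun i j => if i = π j then 1 else 0
  inv := Matrix.of fun i j => if π i = j then 1 else 0
  val_inv := by
    ext i j
    rw [Matrix.mul_apply, Finset.sum_eq_single (π.symm i)]
    · simp [Matrix.one_apply]
    · intro k _ hk
      have : i ≠ π k := by rintro rfl; simp at hk
      simp [this]
    · simp
  inv_val := by
    ext i j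
    rw [Matrix.mul_apply, Finset.sum_eq_single (π i)]
    · simp [Matrix.one_apply]
    · intro k _ hk
      simp [Ne.symm hk]
    · simp

theorem permGL_apply (π : Equiv.Perm ι) (i j : ι) :
    (permGL F π : Matrix ι ι F) i j = if i = π j then 1 else 0 := rfl

theorem permGL_mul_apply (π : Equiv.Perm ι) (a : Matrix ι ι F) (i j : ι) :
    ((permGL F π : Matrix ι ι F) * a) i j = a (π.symm i) j := by
  rw [Matrix.mul_apply, Finset.sum_eq_single (π.symm i)]
  · simp [permGL_apply]
  · intro k _ hk
    have : i ≠ π k := by rintro rfl; simp at hk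
    simp [permGL_apply, this]
  · simp

theorem mul_permGL_apply (π : Equiv.Perm ι) (a : Matrix ι ι F) (i j : ι) :
    (a * (permGL F π : Matrix ι ι F)) i j = a i (π j) := by
  rw [Matrix.mul_apply, Finset.sum_eq_single (π j)]
  · simp [permGL_apply]
  · intro k _ hk
    simp [permGL_apply, hk]
  · simp

theorem permGL_mul (π τ : Equiv.Perm ι) : permGL F (π * τ) = permGL F π * permGL F τ := by
  ext i j
  rw [Units.val_mul, mul_permGL_apply, permGL_apply, permGL_apply, Equiv.Perm.mul_apply]

theorem permGL_one : permGL F (1 : Equiv.Perm ι) = 1 := by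
  ext i j
  rw [permGL_apply, Units.val_one, Matrix.one_apply]
  rfl

theorem permGL_inv (π : Equiv.Perm ι) : permGL F π⁻¹ = (permGL F π)⁻¹ := by
  rw [eq_inv_iff_mul_eq_one, ← permGL_mul, inv_mul_cancel, permGL_one]

theorem permGL_conj_apply (π : Equiv.Perm ι) (g : GL ι F) (i j : ι) :
    ((permGL F π * g * (permGL F π)⁻¹ : GL ι F) : Matrix ι ι F) i j =
      (g : Matrix ι ι F) (π.symm i) (π.symm j) := by
  rw [← permGL_inv, Units.val_mul, Units.val_mul, mul_permGL_apply, permGL_mul_apply]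
  rfl

theorem permGL_conj_mem_borel {σ : ι → ℕ} (π : Equiv.Perm ι) {g : GL ι F} :
    permGL F π * g * (permGL F π)⁻¹ ∈ borel F σ ↔ g ∈ borel F (σ ∘ π) := by
  constructor
  · intro h i j hij
    have := mem_borel.mp h (π i) (π j) hij
    rwa [permGL_conj_apply, Equiv.symm_apply_apply, Equiv.symm_apply_apply] at this
  · intro h i j hij
    rw [permGL_conj_apply]
    apply h
    simpa using hij

/-- The invertible matrix `1 + c ⊗ d`, where `d ⬝ᵥ c = 0`. -/
def transv (c d : ι → F) (h : d ⬝ᵥ c = 0) : GL ι F where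
  val := 1 + vecMulVec c d
  inv := 1 - vecMulVec c d
  val_inv := by
    have : vecMulVec c d * vecMulVec c d = 0 := by
      rw [vecMulVec_mul_vecMulVec, h]; simp
    noncomm_ring [this]
  inv_val := by
    have : vecMulVec c d * vecMulVec c d = 0 := by
      rw [vecMulVec_mul_vecMulVec, h]; simp
    noncomm_ring [this]

theorem transv_val (c d : ι → F) (h : d ⬝ᵥ c = 0) :
    (transv c d h : Matrix ι ι F) = 1 + vecMulVec c d := rfl

theorem transv_mul_apply (c d : ι → F) (h : d ⬝ᵥ c = 0) (a : Matrix ι ι F) (i j : ι) :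
    ((transv c d h : Matrix ι ι F) * a) i j = a i j + c i * (d ᵥ* a) j := by
  rw [transv_val, add_mul, one_mul, vecMulVec_mul, Matrix.add_apply, vecMulVec_apply]

theorem mul_transv_apply (c d : ι → F) (h : d ⬝ᵥ c = 0) (a : Matrix ι ι F) (i j : ι) :
    (a * (transv c d h : Matrix ι ι F)) i j = a i j + (a *ᵥ c) i * d j := by
  rw [transv_val, mul_add, mul_one, mul_vecMulVec, Matrix.add_apply, vecMulVec_apply]

/-- An invertible diagonal matrix. -/
def diagGL (d : ι → Fˣ) : GL ι F where
  val := diagonal fun i => (d i : F)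
  inv := diagonal fun i => ((d i)⁻¹ : Fˣ)
  val_inv := by simp
  inv_val := by simp

theorem diagGL_val (d : ι → Fˣ) : (diagGL d : Matrix ι ι F) = diagonal fun i => (d i : F) := rfl

theorem diagGL_mem_borel (d : ι → Fˣ) (σ : ι → ℕ) : diagGL d ∈ borel F σ := by
  intro i j h
  rw [diagGL_val, diagonal_apply_ne]
  rintro rfl
  exact lt_irrefl _ h

theorem exists_column_ne_zero (g : GL ι F) (j : ι) : ∃ i, (g : Matrix ι ι F) i j ≠ 0 := by
  by_contra! h
  have h1 : ((g⁻¹ * g : GL ι F) : Matrix ι ι F) j j = 0 := by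
    rw [Units.val_mul, Matrix.mul_apply]
    exact Finset.sum_eq_zero fun i _ => by rw [h i, mul_zero]
  simp at h1

theorem exists_row_column_reduction {ρ σ : ι → ℕ} (hρ : Function.Injective ρ)
    (hσ : Function.Injective σ) (x : GL ι F)
    (t : ℕ) : ∃ u ∈ unip F ρ, ∃ b ∈ borel F σ, ∃ π : ι → ι, ∀ j, σ j < t →
      (∀ i, i ≠ π j → ((u * x * b : GL ι F) : Matrix ι ι F) i j = 0) ∧
      (∀ j', j' ≠ j → ((u * x * b : GL ι F) : Matrix ι ι F) (π j) j' = 0) := by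
  classical
  induction t with
  | zero => exact ⟨1, one_mem _, 1, one_mem _, id, fun j h => absurd h (Nat.not_lt_zero _)⟩
  | succ t ih =>
    obtain ⟨u, hu, b, hb, π, h⟩ := ih
    by_cases hj : ∃ j, σ j = t
    swap
    · refine ⟨u, hu, b, hb, π, fun j hjt => h j ?_⟩
      exact lt_of_le_of_ne (Nat.lt_succ_iff.mp hjt) fun hh => hj ⟨j, hh⟩
    obtain ⟨j, rfl⟩ := hj
    set y : GL ι F := u * x * b with hy
    set Y : Matrix ι ι F := (y : Matrix ι ι F) with hY
    obtain ⟨i, hi, hmax⟩ : ∃ i, Y i j ≠ 0 ∧ ∀ i', Y i' j ≠ 0 → ρ i' ≤ ρ i := by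
      obtain ⟨i0, hi0⟩ := exists_column_ne_zero y j
      obtain ⟨i, hi, hm⟩ := Finset.exists_max_image (Finset.univ.filter fun i => Y i j ≠ 0) ρ
        ⟨i0, by simpa using hi0⟩
      exact ⟨i, by simpa using hi, fun i' h' => hm i' (by simpa using h')⟩
    have hne : ∀ j1, σ j1 < σ j → i ≠ π j1 := by
      rintro j1 h1 rfl
      exact hi ((h j1 h1).2 j (by rintro rfl; exact lt_irrefl _ h1))
    have hzero : ∀ j1, σ j1 < σ j → Y i j1 = 0 := fun j1 h1 => (h j1 h1).1 i (hne j1 h1)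
    set c : ι → F := fun r => if r = i then 0 else -(Y r j / Y i j) with hc
    set d : ι → F := fun s => if s = j then 0 else -(Y i s / Y i j) with hd
    have hcd : Pi.single i 1 ⬝ᵥ c = 0 := by simp [hc]
    have hcd' : d ⬝ᵥ Pi.single j 1 = 0 := by simp [hd]
    have hci : ∀ r, Y r j = 0 → c r = 0 := fun r hr => by simp [hc, hr]
    have hdi : ∀ s, Y i s = 0 → d s = 0 := fun s hs => by simp [hd, hs]
    have entry : ∀ r s, ((transv c (Pi.single i 1) hcd * u * x *
        (b * transv (Pi.single j 1) d hcd') : GL ι F) : Matrix ι ι F) r s =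
        Y r s + c r * Y i s + (Y r j + c r * Y i j) * d s := by
      intro r s
      have : transv c (Pi.single i 1) hcd * u * x * (b * transv (Pi.single j 1) d hcd') =
          transv c (Pi.single i 1) hcd * y * transv (Pi.single j 1) d hcd' := by
        rw [hy]; group
      rw [this, Units.val_mul, mul_transv_apply, Units.val_mul, transv_mul_apply,
        mulVec_single_one, Matrix.col_apply, transv_mul_apply, single_one_vecMul]
      rfl
    have hcol : ∀ r, r ≠ i → Y r j + c r * Y i j = 0 := by
      intro r hr
      simp only [hc, if_neg hr]
      field_simp
      ring
    have hrow : ∀ s, s ≠ j → Y i s + Y i j * d s = 0 := by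
      intro s hs
      simp only [hd, if_neg hs]
      field_simp
      ring
    have hcii : c i = 0 := by simp [hc]
    have hdjj : d j = 0 := by simp [hd]
    refine ⟨_, mul_mem (?_ : transv c (Pi.single i 1) hcd ∈ unip F ρ) hu, _,
      mul_mem hb (?_ : transv (Pi.single j 1) d hcd' ∈ borel F σ), Function.update π j i, ?_⟩
    · intro r s hrs
      rw [transv_val, Matrix.add_apply, vecMulVec_apply, add_eq_left]
      by_cases hs : s = i
      · subst hs
        by_cases hr : Y r j = 0
        · rw [hci r hr, zero_mul]
        · have := hρ (le_antisymm (hmax r hr) hrs)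
          rw [this, hcii, zero_mul]
      · simp [Pi.single_eq_of_ne hs]
    · intro r s hrs
      rw [transv_val, Matrix.add_apply, vecMulVec_apply, Matrix.one_apply_ne, zero_add]
      · by_cases hr : r = j
        · subst hr
          rw [hdi s (hzero s hrs), mul_zero]
        · simp [Pi.single_eq_of_ne hr]
      · rintro rfl
        exact lt_irrefl _ hrs
    · intro j1 hj1
      simp only [entry]
      by_cases hjj : j1 = j
      · subst hjj
        rw [Function.update_self]
        refine ⟨fun r hr => ?_, fun s hs => ?_⟩
        · rw [hcol r hr, zero_mul, zero_add]
        · rw [hcii, zero_mul, zero_mul, add_zero, add_zero, hrow s hs]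
      · have hlt : σ j1 < σ j :=
          lt_of_le_of_ne (Nat.lt_succ_iff.mp hj1) fun hh => hjj (hσ hh)
        rw [Function.update_of_ne hjj]
        refine ⟨fun r hr => ?_, fun s hs => ?_⟩
        · rw [hzero j1 hlt, hdi j1 (hzero j1 hlt), (h j1 hlt).1 r hr]
          simp
        · have hz : Y (π j1) j = 0 := (h j1 hlt).2 j (Ne.symm hjj)
          rw [hci _ hz, hz, (h j1 hlt).2 s hs]
          simp

/-- Bruhat decomposition. -/
theorem exists_bruhat {ρ σ : ι → ℕ} (hρ : Function.Injective ρ) (hσ : Function.Injective σ)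
    (x : GL ι F) : ∃ u ∈ unip F ρ, ∃ π : Equiv.Perm ι, ∃ b ∈ borel F σ,
      x = u * permGL F π * b := by
  classical
  obtain ⟨u, hu, b, hb, π, h⟩ := exists_row_column_reduction hρ hσ x (Finset.univ.sup σ + 1)
  replace h := fun j => h j (Nat.lt_succ_of_le (Finset.le_sup (Finset.mem_univ j)))
  set y : GL ι F := u * x * b with hy
  have hne : ∀ j, (y : Matrix ι ι F) (π j) j ≠ 0 := by
    intro j
    obtain ⟨i, hi⟩ := exists_column_ne_zero y j
    by_cases hij : i = π j
    · exact hij ▸ hi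
    · exact absurd ((h j).1 i hij) hi
  have hinj : Function.Injective π := by
    intro j j' hjj
    by_contra hne'
    exact hne j' (hjj ▸ (h j).2 j' (Ne.symm hne'))
  let τ : Equiv.Perm ι := Equiv.ofBijective π (Finite.injective_iff_bijective.mp hinj)
  obtain ⟨d, hd⟩ : ∃ d : ι → Fˣ, ∀ j, (d j : F) = (y : Matrix ι ι F) (π j) j :=
    ⟨fun j => Units.mk0 _ (hne j), fun j => rfl⟩
  have hmon : y = permGL F τ * diagGL d := by
    ext i j
    rw [Units.val_mul (permGL F τ), diagGL_val, Matrix.mul_diagonal, permGL_apply]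
    by_cases hij : i = π j
    · subst hij
      simp [τ, hd]
    · rw [(h j).1 i hij, if_neg (by simpa [τ] using hij), zero_mul]
  refine ⟨u⁻¹, inv_mem hu, τ, diagGL d * b⁻¹,
    mul_mem (diagGL_mem_borel _ _) (inv_mem hb), ?_⟩
  have hx : x = u⁻¹ * y * b⁻¹ := by rw [hy]; group
  rw [hx, hmon]
  group

end Triangular

section Good

variable {ι κ F k : Type} [Fintype ι] [DecidableEq ι] [Fintype κ] [DecidableEq κ] [Field F] [Field k]

/-- Invariance under right translation by the stabilizer of some complete flag. -/
def IsFlagInvariant (φ : GL ι F → k) : Prop :=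
  ∃ (x : GL ι F) (σ : ι → ℕ), Function.Injective σ ∧
    ∀ g, ∀ b ∈ borel F σ, φ (g * (x * b * x⁻¹)) = φ g

variable (ι F k) in
/-- The span of all functions invariant under the stabilizer of some complete flag. -/
def flagSpan : Submodule k (GL ι F → k) :=
  Submodule.span k {φ | IsFlagInvariant φ}

/-- Class functions in the span of the flag invariant functions. -/
structure IsFlagClass (f : GL ι F → k) : Prop where
  comm : ∀ g h, f (g * h) = f (h * g)
  mem : f ∈ flagSpan ι F k

/-- Elements of `p`-power order. -/
def IsPElement {G : Type} [Group G] (p : ℕ) (g : G) : Prop := ∃ m : ℕ, g ^ p ^ m = 1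

/-- Class functions in the span of the flag invariant functions which vanish on `p`-elements. -/
structure IsGood (p : ℕ) (f : GL ι F → k) : Prop extends IsFlagClass f where
  vanish : ∀ g, IsPElement p g → f g = 0

theorem IsFlagInvariant.exists_unip {φ : GL ι F → k} (hφ : IsFlagInvariant φ) {ρ : ι → ℕ}
    (hρ : Function.Injective ρ) :
    ∃ u ∈ unip F ρ, ∃ σ : ι → ℕ, Function.Injective σ ∧
      ∀ g, ∀ b ∈ borel F σ, φ (g * (u * b * u⁻¹)) = φ g := by
  obtain ⟨x, σ, hσ, h⟩ := hφ
  obtain ⟨u, hu, π, b0, hb0, rfl⟩ := exists_bruhat hρ hσ x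
  refine ⟨u, hu, σ ∘ π.symm, hσ.comp π.symm.injective, fun g b hb => ?_⟩
  have hb' : (permGL F π)⁻¹ * b * permGL F π ∈ borel F σ := by
    have := (permGL_conj_mem_borel (F := F) (σ := σ) π⁻¹ (g := b)).2 hb
    rwa [permGL_inv, inv_inv] at this
  rw [← h g _ (mul_mem (mul_mem (inv_mem hb0) hb') hb0)]
  congr 2
  group

theorem IsFlagClass.conj {f : GL ι F → k} (hf : IsFlagClass f) (g h : GL ι F) :
    f (h * g * h⁻¹) = f g := by
  rw [hf.comm, inv_mul_cancel_left]

/-- Reindexing of invertible matrices. -/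
def reindexGL (F : Type) [Field F] (e : ι ≃ κ) : GL ι F ≃* GL κ F :=
  Units.mapEquiv (Matrix.reindexAlgEquiv F F e).toMulEquiv

theorem reindexGL_apply (e : ι ≃ κ) (g : GL ι F) (i j : κ) :
    (reindexGL F e g : Matrix κ κ F) i j = (g : Matrix ι ι F) (e.symm i) (e.symm j) := rfl

theorem reindexGL_mem_borel (e : ι ≃ κ) {g : GL ι F} {σ : κ → ℕ} :
    reindexGL F e g ∈ borel F σ ↔ g ∈ borel F (σ ∘ e) := by
  constructor
  · intro h i j hij
    have := mem_borel.mp h (e i) (e j) hij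
    rwa [reindexGL_apply, Equiv.symm_apply_apply, Equiv.symm_apply_apply] at this
  · intro h i j hij
    rw [reindexGL_apply]
    exact h (by simpa using hij)

theorem IsGood.reindex {p : ℕ} {f : GL κ F → k} (hf : IsGood p f) (e : ι ≃ κ) :
    IsGood p (fun g => f (reindexGL F e g)) where
  comm g h := by rw [map_mul, map_mul, hf.comm]
  vanish g hg := by
    obtain ⟨m, hm⟩ := hg
    exact hf.vanish _ ⟨m, by rw [← map_pow, hm, map_one]⟩
  mem := by
    let T : (GL κ F → k) →ₗ[k] (GL ι F → k) := LinearMap.funLeft k k (reindexGL F e)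
    suffices flagSpan κ F k ≤ (flagSpan ι F k).comap T from this hf.mem
    refine Submodule.span_le.2 ?_
    rintro φ ⟨x, σ, hσ, h⟩
    refine Submodule.subset_span ⟨(reindexGL F e).symm x, σ ∘ e, hσ.comp e.injective,
      fun g b hb => ?_⟩
    rw [← reindexGL_mem_borel] at hb
    change φ _ = φ _
    rw [← h (reindexGL F e g) _ hb]
    simp

end Good

section Blocks

variable {α β F k : Type} [Fintype α] [DecidableEq α] [Fintype β] [DecidableEq β]
  [Field F] [Field k]

/-- Invertible block upper triangular matrices. -/
def blk (a : GL α F) (N : Matrix α β F) (d : GL β F) : GL (α ⊕ β) F where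
  val := fromBlocks (a : Matrix α α F) N 0 (d : Matrix β β F)
  inv := fromBlocks ((a⁻¹ : GL α F) : Matrix α α F)
    (-(((a⁻¹ : GL α F) : Matrix α α F) * N * ((d⁻¹ : GL β F) : Matrix β β F))) 0
    ((d⁻¹ : GL β F) : Matrix β β F)
  val_inv := by
    rw [fromBlocks_multiply]
    simp [← Matrix.mul_assoc]
  inv_val := by
    rw [fromBlocks_multiply]
    simp [Matrix.mul_assoc]

theorem blk_val (a : GL α F) (N : Matrix α β F) (d : GL β F) :
    (blk a N d : Matrix (α ⊕ β) (α ⊕ β) F) = fromBlocks (a : Matrix α α F) N 0 d := rfl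

theorem blk_mul (a a' : GL α F) (N N' : Matrix α β F) (d d' : GL β F) :
    blk a N d * blk a' N' d' =
      blk (a * a') ((a : Matrix α α F) * N' + N * (d' : Matrix β β F)) (d * d') := by
  ext1
  simp [blk_val, fromBlocks_multiply]

theorem blk_one : blk (1 : GL α F) (0 : Matrix α β F) 1 = 1 := by
  ext1
  simp [blk_val]

theorem blk_inv (a : GL α F) (N : Matrix α β F) (d : GL β F) :
    (blk a N d)⁻¹ = blk a⁻¹ (-(((a⁻¹ : GL α F) : Matrix α α F) * N *
      ((d⁻¹ : GL β F) : Matrix β β F))) d⁻¹ := by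
  ext1
  rfl

theorem blk_injective {a a' : GL α F} {N N' : Matrix α β F} {d d' : GL β F}
    (h : blk a N d = blk a' N' d') : a = a' ∧ N = N' ∧ d = d' := by
  have := congrArg Units.val h
  rw [blk_val, blk_val, fromBlocks_inj] at this
  exact ⟨Units.ext this.1, this.2.1, Units.ext this.2.2.2⟩

theorem exists_eq_blk (g : GL (α ⊕ β) F)
    (h : ∀ i j, (g : Matrix (α ⊕ β) (α ⊕ β) F) (Sum.inr i) (Sum.inl j) = 0) :
    ∃ a N d, g = blk a N d := by
  have hg : (g : Matrix (α ⊕ β) (α ⊕ β) F) = fromBlocks (g : Matrix (α ⊕ β) (α ⊕ β) F).toBlocks₁₁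
      (g : Matrix (α ⊕ β) (α ⊕ β) F).toBlocks₁₂ 0 (g : Matrix (α ⊕ β) (α ⊕ β) F).toBlocks₂₂ := by
    conv_lhs => rw [← fromBlocks_toBlocks (g : Matrix (α ⊕ β) (α ⊕ β) F)]
    congr 1
    ext i j
    exact h i j
  have hdet : IsUnit (g : Matrix (α ⊕ β) (α ⊕ β) F).det :=
    (Matrix.isUnit_iff_isUnit_det _).1 g.isUnit
  rw [hg, det_fromBlocks_zero₂₁, IsUnit.mul_iff, ← Matrix.isUnit_iff_isUnit_det,
    ← Matrix.isUnit_iff_isUnit_det] at hdet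
  obtain ⟨⟨a, ha⟩, ⟨d, hd⟩⟩ := hdet
  refine ⟨a, (g : Matrix (α ⊕ β) (α ⊕ β) F).toBlocks₁₂, d, Units.ext ?_⟩
  rw [blk_val, ha, hd]
  exact hg

theorem sum_affine [Fintype F] [DecidableEq F] (h : Matrix α β F → k) (P : GL α F) (Q : GL β F)
    (R : Matrix α β F) :
    ∑ N : Matrix α β F, h ((P : Matrix α α F) * N * (Q : Matrix β β F) + R) = ∑ N, h N := by
  refine Function.Bijective.sum_comp (e := fun N : Matrix α β F =>
    (P : Matrix α α F) * N * (Q : Matrix β β F) + R) ?_ h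
  rw [← Finite.injective_iff_bijective]
  intro N N' hN
  have h1 := add_right_cancel hN
  have h2 := congrArg (fun M => ((P⁻¹ : GL α F) : Matrix α α F) * M *
    ((Q⁻¹ : GL β F) : Matrix β β F)) h1
  simpa [← Matrix.mul_assoc, Matrix.mul_assoc _ (Q : Matrix β β F)] using h2

theorem IsPElement.blk {p : ℕ} [CharP F p] {a : GL α F} {d : GL β F} (ha : IsPElement p a)
    (hd : IsPElement p d) (N : Matrix α β F) : IsPElement p (blk a N d) := by
  obtain ⟨m, hm⟩ := ha
  obtain ⟨m', hm'⟩ := hd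
  have h1 : ∀ t : ℕ, ∃ N', UnipotentSeries.blk a N d ^ t = UnipotentSeries.blk (a ^ t) N' (d ^ t) := by
    intro t
    induction t with
    | zero => exact ⟨0, by simp [blk_one]⟩
    | succ t ih =>
      obtain ⟨N', h⟩ := ih
      exact ⟨_, by rw [pow_succ, h, blk_mul, pow_succ, pow_succ]⟩
  have h2 : ∀ (N' : Matrix α β F) (t : ℕ),
      UnipotentSeries.blk 1 N' 1 ^ t = UnipotentSeries.blk 1 ((t : F) • N') 1 := by
    intro N' t
    induction t with
    | zero => simp [blk_one]
    | succ t ih =>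
      rw [pow_succ, ih, blk_mul]
      simp [add_smul, add_comm]
  obtain ⟨N', h⟩ := h1 (p ^ (m + m'))
  refine ⟨m + m' + 1, ?_⟩
  rw [pow_succ, pow_mul, h, pow_add, pow_mul a, hm, one_pow, mul_comm, pow_mul d, hm', one_pow,
    h2, CharP.cast_eq_zero, zero_smul, blk_one]

theorem exists_injective_sum (α β : Type) [Fintype α] [Fintype β] :
    ∃ ρ : α ⊕ β → ℕ, Function.Injective ρ ∧ ∀ a b, ρ (Sum.inl a) < ρ (Sum.inr b) := by
  refine ⟨fun x => (finSumFinEquiv (Equiv.sumCongr (Fintype.equivFin α) (Fintype.equivFin β) x)).val,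
    ?_, ?_⟩
  · exact Fin.val_injective.comp (finSumFinEquiv.injective.comp (Equiv.injective _))
  · intro a b
    simp
    omega

theorem exists_eq_blk_of_mem_borel {ρ : α ⊕ β → ℕ} (hρ : ∀ a b, ρ (Sum.inl a) < ρ (Sum.inr b))
    {g : GL (α ⊕ β) F} (hg : g ∈ borel F ρ) : ∃ a N d, g = blk a N d :=
  exists_eq_blk g fun _ _ => hg (hρ _ _)

theorem blk_mem_borel {ρ : α ⊕ β → ℕ} (hρ : ∀ a b, ρ (Sum.inl a) < ρ (Sum.inr b))
    {a : GL α F} {N : Matrix α β F} {d : GL β F} :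
    blk a N d ∈ borel F ρ ↔ a ∈ borel F (ρ ∘ Sum.inl) ∧ d ∈ borel F (ρ ∘ Sum.inr) := by
  constructor
  · intro h
    exact ⟨fun i j hij => mem_borel.1 h (Sum.inl i) (Sum.inl j) hij, fun i j hij => mem_borel.1 h (Sum.inr i) (Sum.inr j) hij⟩
  · rintro ⟨ha, hd⟩ (i | i) (j | j) hij
    · exact ha hij
    · exact absurd hij (lt_asymm (hρ _ _))
    · rfl
    · exact hd hij

theorem blk_left_mem_borel {σ : α ⊕ β → ℕ} {a : GL α F} (ha : a ∈ borel F (σ ∘ Sum.inl)) :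
    blk a (0 : Matrix α β F) 1 ∈ borel F σ := by
  rintro (i | i) (j | j) hij
  · exact ha hij
  · rfl
  · rfl
  · exact Matrix.one_apply_ne (by rintro rfl; exact lt_irrefl _ hij)

theorem blk_right_mem_borel {σ : α ⊕ β → ℕ} {d : GL β F} (hd : d ∈ borel F (σ ∘ Sum.inr)) :
    blk 1 (0 : Matrix α β F) d ∈ borel F σ := by
  rintro (i | i) (j | j) hij
  · exact Matrix.one_apply_ne (by rintro rfl; exact lt_irrefl _ hij)
  · rfl
  · rfl
  · exact hd hij

variable [Fintype F] [DecidableEq F]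

theorem IsFlagClass.restrict_left {f : GL (α ⊕ β) F → k} (hf : IsFlagClass f) (y : GL β F) :
    IsFlagClass fun l : GL α F => ∑ N, f (blk l N y) where
  comm l l' := by
    rw [← sum_affine _ l 1 0]
    refine Finset.sum_congr rfl fun N _ => ?_
    have h := hf.comm (blk l 0 1) (blk l' N y)
    simpa [blk_mul] using h
  mem := by
    let T : (GL (α ⊕ β) F → k) →ₗ[k] (GL α F → k) :=
      { toFun := fun f l => ∑ N, f (blk l N y)
        map_add' := fun f g => by ext; simp [Finset.sum_add_distrib]
        map_smul' := fun c f => by ext; simp [Finset.mul_sum] }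
    suffices flagSpan (α ⊕ β) F k ≤ (flagSpan α F k).comap T from this hf.mem
    refine Submodule.span_le.2 fun φ hφ => ?_
    obtain ⟨ρ, hρ, hρ'⟩ := exists_injective_sum α β
    obtain ⟨u, hu, σ, hσ, h⟩ := IsFlagInvariant.exists_unip hφ hρ
    obtain ⟨u₁, M, u₂, rfl⟩ := exists_eq_blk_of_mem_borel hρ' (unip_le_borel _ hu)
    refine Submodule.subset_span ⟨u₁, σ ∘ Sum.inl, hσ.comp Sum.inl_injective, fun l b hb => ?_⟩
    change ∑ N, φ _ = ∑ N, φ _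
    obtain ⟨R, hR⟩ : ∃ R, blk u₁ M u₂ * blk b 0 1 * (blk u₁ M u₂)⁻¹ = blk (u₁ * b * u₁⁻¹) R 1 :=
      ⟨_, by rw [blk_inv, blk_mul, blk_mul, mul_one, mul_inv_cancel]⟩
    rw [← sum_affine _ 1 1 ((l : Matrix α α F) * R)]
    refine Finset.sum_congr rfl fun N _ => ?_
    rw [← h (blk l N y) _ (blk_left_mem_borel hb), hR, blk_mul]
    simp [add_comm]

theorem IsFlagClass.restrict_right {f : GL (α ⊕ β) F → k} (hf : IsFlagClass f) (y : GL α F) :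
    IsFlagClass fun l : GL β F => ∑ N, f (blk y N l) where
  comm l l' := by
    rw [← sum_affine (fun N => f (blk y N (l' * l))) 1 l 0]
    refine Finset.sum_congr rfl fun N _ => ?_
    have h := hf.comm (blk 1 0 l) (blk y N l')
    simpa [blk_mul] using h
  mem := by
    let T : (GL (α ⊕ β) F → k) →ₗ[k] (GL β F → k) :=
      { toFun := fun f l => ∑ N, f (blk y N l)
        map_add' := fun f g => by ext; simp [Finset.sum_add_distrib]
        map_smul' := fun c f => by ext; simp [Finset.mul_sum] }
    suffices flagSpan (α ⊕ β) F k ≤ (flagSpan β F k).comap T from this hf.mem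
    refine Submodule.span_le.2 fun φ hφ => ?_
    obtain ⟨ρ, hρ, hρ'⟩ := exists_injective_sum α β
    obtain ⟨u, hu, σ, hσ, h⟩ := IsFlagInvariant.exists_unip hφ hρ
    obtain ⟨u₁, M, u₂, rfl⟩ := exists_eq_blk_of_mem_borel hρ' (unip_le_borel _ hu)
    refine Submodule.subset_span ⟨u₂, σ ∘ Sum.inr, hσ.comp Sum.inr_injective, fun l b hb => ?_⟩
    change ∑ N, φ _ = ∑ N, φ _
    obtain ⟨R, hR⟩ : ∃ R, blk u₁ M u₂ * blk 1 0 b * (blk u₁ M u₂)⁻¹ = blk 1 R (u₂ * b * u₂⁻¹) :=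
      ⟨_, by rw [blk_inv, blk_mul, blk_mul, mul_one, mul_inv_cancel]⟩
    rw [← sum_affine _ 1 (u₂ * b * u₂⁻¹) ((y : Matrix α α F) * R)]
    refine Finset.sum_congr rfl fun N _ => ?_
    rw [← h (blk y N l) _ (blk_right_mem_borel hb), hR, blk_mul]
    simp [add_comm]

theorem IsGood.restrict_left {p : ℕ} [CharP F p] {f : GL (α ⊕ β) F → k} (hf : IsGood p f)
    {y : GL β F} (hy : IsPElement p y) : IsGood p fun l : GL α F => ∑ N, f (blk l N y) where
  toIsFlagClass := hf.toIsFlagClass.restrict_left y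
  vanish _ hl := Finset.sum_eq_zero fun N _ => hf.vanish _ (hl.blk hy N)

theorem IsGood.restrict_right {p : ℕ} [CharP F p] {f : GL (α ⊕ β) F → k} (hf : IsGood p f)
    {y : GL α F} (hy : IsPElement p y) : IsGood p fun l : GL β F => ∑ N, f (blk y N l) where
  toIsFlagClass := hf.toIsFlagClass.restrict_right y
  vanish _ hl := Finset.sum_eq_zero fun N _ => hf.vanish _ (hy.blk hl N)

end Blocks

section Sums

variable {S T k : Type} [Group S] [Group T] [Fintype S] [Fintype T] [Field k]

instance subgroupFintype {G : Type} [Group G] [Finite G] (H : Subgroup G) : Fintype H :=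
  Fintype.ofFinite H

theorem sum_eq_zero_of_hom (j : T →* S) (h : S → k) (hT : (Fintype.card T : k) ≠ 0)
    (H : ∀ s, ∑ t, h (s * j t) = 0) : ∑ s, h s = 0 := by
  have h1 : ∀ t, ∑ s, h (s * j t) = ∑ s, h s := fun t =>
    Equiv.sum_comp (Equiv.mulRight (j t)) h
  have h2 : ∑ t : T, ∑ s, h (s * j t) = 0 := by
    rw [Finset.sum_comm]
    exact Finset.sum_eq_zero fun s _ => H s
  simp only [h1, Finset.sum_const, Finset.card_univ, nsmul_eq_mul] at h2
  exact (mul_eq_zero.1 h2).resolve_left hT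

theorem card_ne_zero_of_isPElement {p : ℕ} [Fact p.Prime] (hp : (p : k) ≠ 0)
    (h : ∀ t : T, IsPElement p t) : (Fintype.card T : k) ≠ 0 := by
  have h1 : IsPGroup p T := h
  obtain ⟨n, hn⟩ := IsPGroup.iff_card.1 h1
  rw [← Nat.card_eq_fintype_card, hn, Nat.cast_pow]
  exact pow_ne_zero _ hp

end Sums

section Transvections

variable {ι κ F k : Type} [Fintype ι] [DecidableEq ι] [Fintype κ] [DecidableEq κ]
  [Field F] [Field k]

theorem transv_mul (c c' d : ι → F) (h : d ⬝ᵥ c = 0) (h' : d ⬝ᵥ c' = 0) :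
    transv c d h * transv c' d h' = transv (c + c') d (by rw [dotProduct_add, h, h', add_zero]) := by
  ext i j
  rw [Units.val_mul, mul_transv_apply, transv_val, transv_val, add_mulVec, one_mulVec,
    vecMulVec_mulVec, h']
  simp [vecMulVec_apply]
  ring

/-- The transvections with a fixed hyperplane, the kernel of `l`. -/
def transvections (l : ι → F) : Subgroup (GL ι F) where
  carrier := {v | ∃ c h, v = transv c l h}
  mul_mem' := by
    rintro _ _ ⟨c, h, rfl⟩ ⟨c', h', rfl⟩
    exact ⟨_, _, transv_mul _ _ _ _ _⟩
  one_mem' := ⟨0, dotProduct_zero _, Units.ext (by simp [transv_val])⟩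
  inv_mem' := by
    rintro _ ⟨c, h, rfl⟩
    refine ⟨-c, by simp [h], ?_⟩
    rw [inv_eq_iff_mul_eq_one, transv_mul]
    exact Units.ext (by simp [transv_val])

theorem isPElement_transvections {p : ℕ} [CharP F p] {l : ι → F} (v : transvections l) :
    IsPElement p v := by
  obtain ⟨_, c, h, rfl⟩ := v
  refine ⟨1, Subtype.ext ?_⟩
  have h1 : ∀ t : ℕ, transv c l h ^ t = transv ((t : F) • c) l (by simp [h]) := by
    intro t
    induction t with
    | zero => exact Units.ext (by simp [transv_val])
    | succ t ih =>
      rw [pow_succ, ih, transv_mul]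
      exact Units.ext (by simp [transv_val, add_smul])
  rw [Subgroup.coe_pow, pow_one, h1]
  exact Units.ext (by simp [transv_val])

theorem conj_transv (g : GL ι F) (c l l' : ι → F) (h : l ⬝ᵥ c = 0)
    (hl : l' ᵥ* (g : Matrix ι ι F) = l) :
    g * transv c l h * g⁻¹ = transv ((g : Matrix ι ι F) *ᵥ c) l'
      (by rw [dotProduct_mulVec, hl, h]) := by
  rw [mul_inv_eq_iff_eq_mul]
  ext1
  rw [Units.val_mul, Units.val_mul, transv_val, transv_val, mul_add, add_mul, mul_vecMulVec,
    vecMulVec_mul, hl, one_mul, mul_one]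

variable [Fintype F] [DecidableEq F]

/-- The sum of `f` over a coset of the group of transvections along the kernel of `l`. -/
def transvSum (f : GL ι F → k) (l : ι → F) (g : GL ι F) : k := ∑ v : transvections l, f (g * v)

theorem transvSum_mul_right (f : GL ι F → k) {l : ι → F} (g : GL ι F) {v : GL ι F}
    (hv : v ∈ transvections l) : transvSum f l (g * v) = transvSum f l g := by
  unfold transvSum
  rw [← Equiv.sum_comp (Equiv.mulLeft (⟨v, hv⟩ : transvections l)) fun w => f (g * w)]
  simp [mul_assoc]

theorem transvSum_conj {f : GL ι F → k} (hf : IsFlagClass f) (l : ι → F) (x g : GL ι F) :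
    transvSum f l (x * g * x⁻¹) = transvSum f (l ᵥ* (x : Matrix ι ι F)) g := by
  unfold transvSum
  symm
  have hx : ∀ v : GL ι F, v ∈ transvections (l ᵥ* (x : Matrix ι ι F)) ↔
      (MulAut.conj x) v ∈ transvections l := by
    intro v
    constructor
    · rintro ⟨c, h, rfl⟩
      exact ⟨_, _, conj_transv x c _ l h rfl⟩
    · rintro ⟨c, h, hc⟩
      refine ⟨((x⁻¹ : GL ι F) : Matrix ι ι F) *ᵥ c, ?_, ?_⟩
      · rw [dotProduct_mulVec, vecMul_vecMul, ← Units.val_mul, mul_inv_cancel, Units.val_one,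
          vecMul_one, h]
      · rw [← conj_transv x⁻¹ c l (l ᵥ* (x : Matrix ι ι F)) h, ← hc]
        · simp [MulAut.conj_apply, mul_assoc]
        · rw [vecMul_vecMul, ← Units.val_mul, mul_inv_cancel, Units.val_one, vecMul_one]
  refine Fintype.sum_equiv ((MulAut.conj x).toEquiv.subtypeEquiv hx) _ _ fun v => ?_
  change f _ = f (x * g * x⁻¹ * (x * v * x⁻¹))
  rw [← hf.conj _ x]
  congr 1
  group

theorem transvSum_reindex (f : GL κ F → k) (e : ι ≃ κ) (l : κ → F) (g : GL ι F) :
    transvSum (fun g => f (reindexGL F e g)) (l ∘ e) g = transvSum f l (reindexGL F e g) := by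
  unfold transvSum
  have hx : ∀ v : GL ι F, v ∈ transvections (l ∘ e) ↔ (reindexGL F e) v ∈ transvections l := by
    intro v
    constructor
    · rintro ⟨c, h, rfl⟩
      refine ⟨c ∘ e.symm, ?_, ?_⟩
      · rw [← h, ← comp_equiv_symm_dotProduct]
        simp
      · ext i j
        rw [reindexGL_apply, transv_val, transv_val]
        simp [Matrix.one_apply, vecMulVec_apply]
    · rintro ⟨c, h, hc⟩
      refine ⟨c ∘ e, ?_, ?_⟩
      · rw [← h, comp_equiv_dotProduct_comp_equiv]
      · ext i j
        have : (reindexGL F e v : Matrix κ κ F) (e i) (e j) =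
            (transv c l h : Matrix κ κ F) (e i) (e j) := by rw [hc]
        rw [reindexGL_apply, transv_val] at this
        rw [transv_val]
        simpa [Matrix.one_apply, vecMulVec_apply] using this
  refine Fintype.sum_equiv ((reindexGL F e).toEquiv.subtypeEquiv hx) _ _ fun v => ?_
  change f _ = f (reindexGL F e g * reindexGL F e v)
  rw [map_mul]

theorem sum_transvections_conj (h : GL ι F → k) {l : ι → F} {x : GL ι F} {t : F} (ht : t ≠ 0)
    (hx : l ᵥ* (x : Matrix ι ι F) = t • l) :
    ∑ v : transvections l, h (x * v * x⁻¹) = ∑ v : transvections l, h v := by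
  have hmem : ∀ v ∈ transvections l, x * v * x⁻¹ ∈ transvections l := by
    rintro _ ⟨c, hc, rfl⟩
    have h1 : transv c l hc = transv (t⁻¹ • c) (t • l) (by simp [hc]) := by
      ext1
      rw [transv_val, transv_val, smul_vecMulVec, vecMulVec_smul, smul_smul, inv_mul_cancel₀ ht,
        one_smul]
    rw [h1]
    exact ⟨_, _, conj_transv x _ _ l _ hx⟩
  refine Function.Bijective.sum_comp
    (e := fun v : transvections l => (⟨x * v * x⁻¹, hmem v v.2⟩ : transvections l)) ?_ (fun v => h v)
  rw [← Finite.injective_iff_bijective]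
  intro v w hvw
  simpa using hvw

theorem transvSum_mul_dilation {f : GL ι F → k} (hf : f ∈ flagSpan ι F k) {o : ι} (g : GL ι F)
    {d : GL ι F} (hd : ∀ i j, j ≠ o → (d : Matrix ι ι F) i j = (1 : Matrix ι ι F) i j) :
    transvSum f (Pi.single o 1) (g * d) = transvSum f (Pi.single o 1) g := by
  let T (g : GL ι F) : (GL ι F → k) →ₗ[k] k :=
    { toFun := fun f => transvSum f (Pi.single o 1) g
      map_add' := fun f g => by simp [transvSum, Finset.sum_add_distrib]
      map_smul' := fun c f => by simp [transvSum, Finset.mul_sum] }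
  suffices flagSpan ι F k ≤ LinearMap.ker (T (g * d) - T g) from sub_eq_zero.1 (this hf)
  refine Submodule.span_le.2 fun φ hφ => ?_
  obtain ⟨ρ, hρ, hρo⟩ : ∃ ρ : ι → ℕ, Function.Injective ρ ∧ ∀ i, ρ i ≤ ρ o := by
    obtain ⟨i₀, -, h₀⟩ := Finset.exists_max_image Finset.univ (Fintype.equivFin ι)
      ⟨o, Finset.mem_univ o⟩
    refine ⟨fun i => (Fintype.equivFin ι (Equiv.swap o i₀ i)).val,
      Fin.val_injective.comp ((Equiv.injective _).comp (Equiv.injective _)), fun i => ?_⟩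
    simpa using h₀ _ (Finset.mem_univ _)
  obtain ⟨u, hu, σ, hσ, h⟩ := IsFlagInvariant.exists_unip hφ hρ
  have hrow : ∀ w ∈ unip F ρ, Pi.single o 1 ᵥ* (w : Matrix ι ι F) = Pi.single o 1 := by
    intro w hw
    ext j
    rw [single_one_vecMul, Matrix.row_apply, mem_unip.1 hw o j (hρo j), Matrix.one_apply,
      Pi.single_apply]
    simp [eq_comm]
  set l : ι → F := Pi.single o 1 with hl
  set t : F := (d : Matrix ι ι F) o o with ht
  have hld : l ᵥ* (d : Matrix ι ι F) = t • l := by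
    ext j
    rw [hl, single_one_vecMul, Matrix.row_apply]
    by_cases hj : j = o
    · subst hj; simp [ht]
    · simp [hd o j hj, hj, Ne.symm hj]
  have ht0 : t ≠ 0 := by
    intro h0
    have h1 : l ᵥ* ((d * d⁻¹ : GL ι F) : Matrix ι ι F) = 0 := by
      rw [Units.val_mul, ← vecMul_vecMul, hld, h0, zero_smul, zero_vecMul]
    simp [hl] at h1
  have hld' : l ᵥ* ((d⁻¹ : GL ι F) : Matrix ι ι F) = t⁻¹ • l := by
    have h1 : l ᵥ* ((d * d⁻¹ : GL ι F) : Matrix ι ι F) = l := by simp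
    rw [Units.val_mul, ← vecMul_vecMul, hld, smul_vecMul] at h1
    rw [eq_inv_smul_iff₀ ht0, h1]
  let s : GL ι F := diagGL (Function.update 1 o (Units.mk0 t ht0))
  have hs : (s : Matrix ι ι F) = 1 + vecMulVec ((t - 1) • l) l := by
    ext i j
    rw [diagGL_val, Matrix.diagonal_apply, Matrix.add_apply, vecMulVec_apply, Matrix.one_apply]
    by_cases hij : i = j
    · subst hij
      by_cases hi : i = o
      · subst hi; simp [hl]
      · simp [hl, hi]
    · by_cases hi : i = o
      · subst hi; simp [hl, hij, Ne.symm hij]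
      · simp [hl, hi, hij]
  obtain ⟨x, hx⟩ : ∃ x : GL ι F, x = u * s * u⁻¹ := ⟨_, rfl⟩
  have hxv : (x : Matrix ι ι F) = 1 + vecMulVec ((t - 1) • ((u : Matrix ι ι F) *ᵥ l)) l := by
    rw [hx, Units.val_mul, Units.val_mul, hs, mul_add, mul_one, add_mul, ← Units.val_mul,
      mul_inv_cancel, Units.val_one, mul_vecMulVec, vecMulVec_mul, hrow _ (inv_mem hu), mulVec_smul]
  have huo : ((u : Matrix ι ι F) *ᵥ l) o = 1 := by
    rw [hl, mulVec_single_one, Matrix.col_apply, mem_unip.1 hu o o le_rfl, Matrix.one_apply_eq]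
  have hlx : l ᵥ* (x : Matrix ι ι F) = t • l := by
    rw [hxv, vecMul_add, vecMul_one, vecMul_vecMulVec, hl, single_one_dotProduct, ← hl,
      Pi.smul_apply, huo]
    module
  set c : ι → F := ((d⁻¹ : GL ι F) : Matrix ι ι F) *ᵥ ((x : Matrix ι ι F) *ᵥ l) - l with hc
  have hlc : l ⬝ᵥ c = 0 := by
    rw [hc, dotProduct_sub, dotProduct_mulVec, hld', dotProduct_mulVec, smul_vecMul, hlx, smul_smul,
      inv_mul_cancel₀ ht0, one_smul, sub_self]
  have hdx : d * transv c l hlc = x := by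
    ext i j
    rw [Units.val_mul, mul_transv_apply, hc, mulVec_sub, mulVec_mulVec, ← Units.val_mul,
      mul_inv_cancel, Units.val_one, one_mulVec, hl, mulVec_single_one, mulVec_single_one]
    by_cases hj : j = o
    · subst hj; simp
    · rw [hd i j hj, hxv, Matrix.add_apply, vecMulVec_apply, hl]
      simp [hj]
  change transvSum φ l (g * d) - transvSum φ l g = 0
  rw [sub_eq_zero, ← transvSum_mul_right φ (g * d) ⟨c, hlc, rfl⟩, mul_assoc, hdx]
  unfold transvSum
  rw [← sum_transvections_conj (fun v => φ (g * v)) ht0 hlx]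
  refine Finset.sum_congr rfl fun v _ => ?_
  rw [← h (g * (x * v * x⁻¹)) s (diagGL_mem_borel _ _), ← hx]
  congr 1
  group

end Transvections

section Cyclic

variable {ι κ F k : Type} [Fintype ι] [DecidableEq ι] [Fintype κ] [DecidableEq κ]
  [Field F] [Field k]

/-- The functional `l` is a cyclic vector for the transpose of `g`. -/
def IsCyclic (l : ι → F) (g : GL ι F) : Prop :=
  ∀ x : ι → F, (∀ j : ℕ, l ⬝ᵥ ((g ^ j : GL ι F) : Matrix ι ι F) *ᵥ x = 0) → x = 0

theorem pow_succ_mulVec (g : GL ι F) (j : ℕ) (x : ι → F) :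
    ((g ^ (j + 1) : GL ι F) : Matrix ι ι F) *ᵥ x =
      (g : Matrix ι ι F) *ᵥ (((g ^ j : GL ι F) : Matrix ι ι F) *ᵥ x) := by
  rw [mulVec_mulVec, pow_succ', Units.val_mul]

theorem pow_succ_mulVec' (g : GL ι F) (j : ℕ) (x : ι → F) :
    ((g ^ (j + 1) : GL ι F) : Matrix ι ι F) *ᵥ x =
      ((g ^ j : GL ι F) : Matrix ι ι F) *ᵥ ((g : Matrix ι ι F) *ᵥ x) := by
  rw [mulVec_mulVec, pow_succ, Units.val_mul]

theorem pow_add_mulVec (g : GL ι F) (i j : ℕ) (x : ι → F) :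
    ((g ^ (i + j) : GL ι F) : Matrix ι ι F) *ᵥ x =
      ((g ^ i : GL ι F) : Matrix ι ι F) *ᵥ (((g ^ j : GL ι F) : Matrix ι ι F) *ᵥ x) := by
  rw [mulVec_mulVec, pow_add, Units.val_mul]

theorem IsCyclic.eq_zero_of_lt {l : ι → F} {g : GL ι F} (hg : IsCyclic l g) {x : ι → F}
    (hx : ∀ j < Fintype.card ι, l ⬝ᵥ ((g ^ j : GL ι F) : Matrix ι ι F) *ᵥ x = 0) : x = 0 := by
  refine hg x fun j => ?_
  rw [Units.val_pow_eq_pow_val, Matrix.pow_eq_aeval_mod_charpoly]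
  set P : Polynomial F := Polynomial.X ^ j %ₘ (g : Matrix ι ι F).charpoly with hP
  have hdeg : P.degree < Fintype.card ι := by
    rw [← Matrix.charpoly_degree_eq_dim (g : Matrix ι ι F)]
    exact Polynomial.degree_modByMonic_lt _ (Matrix.charpoly_monic _)
  by_cases h0 : P = 0
  · simp [h0]
  rw [Polynomial.aeval_eq_sum_range' ((Polynomial.natDegree_lt_iff_degree_lt h0).2 hdeg),
    sum_mulVec, dotProduct_sum]
  refine Finset.sum_eq_zero fun i hi => ?_
  have := hx i (Finset.mem_range.1 hi)
  rw [Units.val_pow_eq_pow_val] at this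
  rw [smul_mulVec, dotProduct_smul, this, smul_zero]

theorem IsCyclic.exists_basis {l : ι → F} {g : GL ι F} (hg : IsCyclic l g) {n : ℕ}
    (hn : Fintype.card ι = n + 1) :
    ∃ b : Module.Basis (Fin (n + 1)) F (ι → F),
      (∀ j, l ⬝ᵥ b j = if j = Fin.last n then 1 else 0) ∧
      ∀ j : Fin n, b j.succ = (g : Matrix ι ι F) *ᵥ b j.castSucc := by
  let T : (ι → F) →ₗ[F] (Fin (n + 1) → F) :=
    { toFun := fun x j => l ⬝ᵥ ((g ^ (j : ℕ) : GL ι F) : Matrix ι ι F) *ᵥ x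
      map_add' := fun x y => by ext; simp [mulVec_add, dotProduct_add]
      map_smul' := fun c x => by ext; simp [mulVec_smul, dotProduct_smul] }
  have hT : Function.Injective T := by
    rw [← LinearMap.ker_eq_bot, LinearMap.ker_eq_bot']
    intro x hx
    refine hg.eq_zero_of_lt fun j hj => ?_
    exact congrFun hx ⟨j, hn ▸ hj⟩
  have hT' : Function.Surjective T :=
    (LinearMap.injective_iff_surjective_of_finrank_eq_finrank (by simp [hn])).1 hT
  obtain ⟨e, he⟩ := hT' (Pi.single (Fin.last n) 1)
  have he' : ∀ j ≤ n, l ⬝ᵥ ((g ^ j : GL ι F) : Matrix ι ι F) *ᵥ e = if j = n then 1 else 0 := by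
    intro j hj
    have := congrFun he ⟨j, Nat.lt_succ_of_le hj⟩
    simpa [T, Pi.single_apply, Fin.ext_iff] using this
  let v : Fin (n + 1) → ι → F := fun j => ((g ^ (j : ℕ) : GL ι F) : Matrix ι ι F) *ᵥ e
  have hv : LinearIndependent F v := by
    rw [Fintype.linearIndependent_iff]
    intro a ha
    have key : ∀ m ≤ n, ∀ j : Fin (n + 1), (j : ℕ) + m = n → a j = 0 := by
      intro m
      induction m using Nat.strong_induction_on with
      | _ m ih =>
        intro hm j hj
        have h1 : l ⬝ᵥ ((g ^ m : GL ι F) : Matrix ι ι F) *ᵥ (∑ i, a i • v i) = 0 := by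
          rw [ha, mulVec_zero, dotProduct_zero]
        rw [mulVec_sum, dotProduct_sum, Finset.sum_eq_single j] at h1
        · rw [mulVec_smul, dotProduct_smul, ← pow_add_mulVec, he' _ (by omega),
            if_pos (by omega)] at h1
          simpa using h1
        · intro i _ hij
          rw [mulVec_smul, dotProduct_smul]
          rcases lt_or_gt_of_ne (Fin.val_ne_of_ne hij) with h | h
          · rw [← pow_add_mulVec, he' _ (by omega), if_neg (by omega), smul_zero]
          · rw [ih (n - i) (by omega) (by omega) i (by omega), zero_smul]
        · simp
    exact fun i => key (n - i) (by omega) i (by omega)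
  refine ⟨basisOfLinearIndependentOfCardEqFinrank hv (by simp [hn]), fun j => ?_, fun j => ?_⟩
  · rw [coe_basisOfLinearIndependentOfCardEqFinrank, he' _ (by omega)]
    simp [Fin.ext_iff]
  · rw [coe_basisOfLinearIndependentOfCardEqFinrank]
    exact pow_succ_mulVec g j e

variable [Fintype F] [DecidableEq F]

theorem transvSum_eq_of_isCyclic {f : GL ι F → k} (hf : IsFlagClass f) {o : ι} {g₁ g₂ : GL ι F}
    (h₁ : IsCyclic (Pi.single o (1 : F)) g₁) (h₂ : IsCyclic (Pi.single o (1 : F)) g₂) :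
    transvSum f (Pi.single o 1) g₁ = transvSum f (Pi.single o 1) g₂ := by
  obtain ⟨n, hn⟩ : ∃ n, Fintype.card ι = n + 1 :=
    ⟨Fintype.card ι - 1, by have := Fintype.card_pos_iff.2 ⟨o⟩; omega⟩
  set l : ι → F := Pi.single o 1 with hl
  obtain ⟨b₁, hb₁, hg₁⟩ := h₁.exists_basis hn
  obtain ⟨b₂, hb₂, hg₂⟩ := h₂.exists_basis hn
  let Q : (ι → F) ≃ₗ[F] (ι → F) := b₁.equiv b₂ (Equiv.refl _)
  have hQ : ∀ j, Q (b₁ j) = b₂ j := fun j => by simp [Q]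
  obtain ⟨q, hq⟩ : ∃ q : GL ι F, ∀ x, (q : Matrix ι ι F) *ᵥ x = Q x := by
    refine ⟨⟨LinearMap.toMatrix' Q, LinearMap.toMatrix' Q.symm, ?_, ?_⟩, fun x => ?_⟩
    · rw [← LinearMap.toMatrix'_comp]; simp
    · rw [← LinearMap.toMatrix'_comp]; simp
    · exact LinearMap.toMatrix'_mulVec _ _
  have hlQ : ∀ x, l ⬝ᵥ Q x = l ⬝ᵥ x := by
    intro x
    rw [← b₁.sum_repr x, map_sum, dotProduct_sum, dotProduct_sum]
    refine Finset.sum_congr rfl fun j _ => ?_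
    rw [map_smul, hQ, dotProduct_smul, dotProduct_smul, hb₁, hb₂]
  have hlq : l ᵥ* (q : Matrix ι ι F) = l := by
    ext j
    have := hlQ (Pi.single j 1)
    rw [← hq, dotProduct_mulVec] at this
    simpa using this
  have hker : ∀ x, l ⬝ᵥ x = 0 → (q : Matrix ι ι F) *ᵥ ((g₁ : Matrix ι ι F) *ᵥ x) =
      (g₂ : Matrix ι ι F) *ᵥ ((q : Matrix ι ι F) *ᵥ x) := by
    intro x hx
    rw [← b₁.sum_repr x, Fin.sum_univ_castSucc]
    have hlast : b₁.repr x (Fin.last n) = 0 := by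
      rw [← b₁.sum_repr x, dotProduct_sum, Finset.sum_eq_single (Fin.last n)] at hx
      · simpa [hb₁] using hx
      · intro j _ hj
        simp [hb₁, hj]
      · simp
    rw [hlast, zero_smul, add_zero]
    simp only [mulVec_sum, mulVec_smul]
    refine Finset.sum_congr rfl fun j _ => ?_
    rw [← hg₁, hq, hq, hQ, hQ, hg₂]
  have hd : ∀ i j, j ≠ o → ((g₂⁻¹ * (q * g₁ * q⁻¹) : GL ι F) : Matrix ι ι F) i j =
      (1 : Matrix ι ι F) i j := by
    intro i j hj
    have h0 : l ⬝ᵥ ((q⁻¹ : GL ι F) : Matrix ι ι F) *ᵥ Pi.single j 1 = 0 := by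
      have : l ᵥ* ((q⁻¹ : GL ι F) : Matrix ι ι F) = l := by
        conv_lhs => rw [← hlq, vecMul_vecMul, ← Units.val_mul, mul_inv_cancel, Units.val_one,
          vecMul_one]
      rw [dotProduct_mulVec, this, hl]
      simp [hj]
    have h1 := hker _ h0
    have h2 : ((g₂⁻¹ * (q * g₁ * q⁻¹) : GL ι F) : Matrix ι ι F) *ᵥ Pi.single j 1 =
        Pi.single j 1 := by
      simp only [Units.val_mul, ← mulVec_mulVec]
      rw [h1]
      simp only [mulVec_mulVec, ← Units.val_mul]
      rw [show g₂⁻¹ * (g₂ * (q * q⁻¹)) = 1 by group, Units.val_one, one_mulVec]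
    have h3 := congrFun h2 i
    rw [mulVec_single_one, Matrix.col_apply] at h3
    rw [h3, Matrix.one_apply, Pi.single_apply]
  have h4 := transvSum_mul_dilation hf.mem g₂ hd
  rw [mul_inv_cancel_left, transvSum_conj hf, hlq] at h4
  exact h4

end Cyclic

section BlockReduction

variable {α β F k : Type} [Fintype α] [DecidableEq α] [Fintype β] [DecidableEq β]
  [Field F] [Field k]

theorem transv_elim_zero (c : α → F) (l : β → F) :
    transv (Sum.elim c 0) (Sum.elim 0 l) (by simp [dotProduct]) =
      blk 1 (vecMulVec c l) (1 : GL β F) := by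
  ext i j
  rw [transv_val, blk_val]
  rcases i with i | i <;> rcases j with j | j <;>
    simp [vecMulVec_apply, Matrix.one_apply]

theorem transv_elim (c : α → F) (c' : β → F) (l : β → F)
    (h : Sum.elim (0 : α → F) l ⬝ᵥ Sum.elim c c' = 0) (h' : l ⬝ᵥ c' = 0) :
    transv (Sum.elim c c') (Sum.elim 0 l) h = blk 1 (vecMulVec c l) (transv c' l h') := by
  ext i j
  rw [transv_val, blk_val]
  rcases i with i | i <;> rcases j with j | j <;>
    simp [vecMulVec_apply, Matrix.one_apply, transv_val]

theorem IsCyclic.span_eq_top {l : β → F} {g : GL β F} (hg : IsCyclic l g) :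
    Submodule.span F (Set.range fun j : ℕ => l ᵥ* ((g ^ j : GL β F) : Matrix β β F)) = ⊤ := by
  by_contra hlt
  obtain ⟨φ, hφ, hle⟩ := Submodule.exists_le_ker_of_lt_top _ (lt_top_iff_ne_top.2 hlt)
  apply hφ
  have hx : ∀ w, φ w = w ⬝ᵥ fun i => φ (Pi.single i 1) := by
    intro w
    conv_lhs => rw [pi_eq_sum_univ' w]
    simp [dotProduct]
  have := hg (fun i => φ (Pi.single i 1)) fun j => by
    rw [dotProduct_mulVec, ← hx]
    exact hle (Submodule.subset_span ⟨j, rfl⟩)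
  ext i
  simpa using congrFun this i

variable [Fintype F] [DecidableEq F]

theorem transvSum_blk_add {f : GL (α ⊕ β) F → k} (hf : IsFlagClass f) (y : GL α F) {l : β → F}
    {g : GL β F} (hg : IsCyclic l g) (N D : Matrix α β F) :
    transvSum f (Sum.elim 0 l) (blk y (N + D) g) = transvSum f (Sum.elim 0 l) (blk y N g) := by
  let P : AddSubgroup (Matrix α β F) :=
    { carrier := {D | ∀ N, transvSum f (Sum.elim 0 l) (blk y (N + D) g) =
        transvSum f (Sum.elim 0 l) (blk y N g)}
      zero_mem' := fun N => by rw [add_zero]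
      add_mem' := fun {D D'} h h' N => by rw [← add_assoc, h', h]
      neg_mem' := fun {D} h N => by rw [← h, neg_add_cancel_right] }
  have h0 : ∀ c : α → F, vecMulVec c l ∈ P := by
    intro c N
    have h1 : transv (Sum.elim (((y⁻¹ : GL α F) : Matrix α α F) *ᵥ c) 0) (Sum.elim 0 l)
        (by simp [dotProduct]) ∈ transvections (Sum.elim (0 : α → F) l) := ⟨_, _, rfl⟩
    have h2 := transvSum_mul_right f (blk y N g) h1
    rwa [transv_elim_zero, blk_mul, mul_one, mul_one, mul_vecMulVec, mulVec_mulVec,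
      ← Units.val_mul, mul_inv_cancel, Units.val_one, one_mulVec, Units.val_one,
      Matrix.mul_one, add_comm] at h2
  have hconj : ∀ M : Matrix α β F, M * (g : Matrix β β F) - (y : Matrix α α F) * M ∈ P := by
    intro M N
    have h1 := transvSum_conj hf (Sum.elim (0 : α → F) l) (blk 1 M (1 : GL β F)) (blk y N g)
    have h2 : Sum.elim (0 : α → F) l ᵥ* (blk 1 M (1 : GL β F) : Matrix (α ⊕ β) (α ⊕ β) F) =
        Sum.elim (0 : α → F) l := by
      rw [blk_val, vecMul_fromBlocks]
      simp
    rw [h2, blk_inv, blk_mul, blk_mul] at h1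
    rw [← h1]
    congr 2
    · simp
    · simp
      abel
    · simp
  have hpow : ∀ (j : ℕ) (c : α → F), vecMulVec c (l ᵥ* ((g ^ j : GL β F) : Matrix β β F)) ∈ P := by
    intro j
    induction j with
    | zero => simpa using h0
    | succ j ih =>
      intro c
      have h1 := P.add_mem (hconj (vecMulVec c (l ᵥ* ((g ^ j : GL β F) : Matrix β β F))))
        (ih ((y : Matrix α α F) *ᵥ c))
      rwa [mul_vecMulVec, sub_add_cancel, vecMulVec_mul, vecMul_vecMul, ← Units.val_mul,
        ← pow_succ] at h1
  have hall : ∀ (w : β → F) (c : α → F), vecMulVec c w ∈ P := by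
    let Q : Submodule F (β → F) :=
      { carrier := {w | ∀ c : α → F, vecMulVec c w ∈ P}
        zero_mem' := fun c => by
          have : vecMulVec c (0 : β → F) = 0 := by
            ext i j
            simp [vecMulVec_apply]
          exact this ▸ P.zero_mem
        add_mem' := fun {w w'} h h' c => by
          rw [vecMulVec_add]
          exact P.add_mem (h c) (h' c)
        smul_mem' := fun a w h c => by
          have : vecMulVec c (a • w) = vecMulVec (a • c) w := by
            ext i j
            simp [vecMulVec_apply]
            ring
          rw [this]
          exact h _ }
    have hQ : Q = ⊤ := by
      rw [eq_top_iff, ← hg.span_eq_top, Submodule.span_le]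
      rintro _ ⟨j, rfl⟩
      exact hpow j
    intro w
    exact (hQ ▸ Submodule.mem_top : w ∈ Q)
  have hD : D = ∑ i, vecMulVec (Pi.single i 1) (D i) := by
    ext i j
    simp [Matrix.sum_apply, vecMulVec_apply, Pi.single_apply]
  have : D ∈ P := by
    rw [hD]
    exact P.sum_mem fun i _ => hall _ _
  exact this N

theorem natCast_pow_card_ne_zero {p : ℕ} [Fact p.Prime] [CharP F p] (hp : (p : k) ≠ 0) :
    (Fintype.card F : k) ≠ 0 := by
  obtain ⟨m, -, hm⟩ := FiniteField.card F p
  rw [hm, Nat.cast_pow]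
  exact pow_ne_zero _ hp

theorem transvSum_blk_eq_zero {p : ℕ} [Fact p.Prime] [CharP F p] (hp : (p : k) ≠ 0)
    {f : GL (α ⊕ β) F → k} (hf : IsGood p f) {y : GL α F} (hy : IsPElement p y) {l : β → F}
    {g : GL β F} (hg : IsCyclic l g)
    (ih : ∀ f' : GL β F → k, IsGood p f' → transvSum f' l g = 0) (N : Matrix α β F) :
    transvSum f (Sum.elim 0 l) (blk y N g) = 0 := by
  have hconst : ∀ N', transvSum f (Sum.elim 0 l) (blk y N' g) =
      transvSum f (Sum.elim 0 l) (blk y N g) := fun N' => by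
    have := transvSum_blk_add hf.toIsFlagClass y hg N (N' - N)
    rwa [add_sub_cancel] at this
  have hsum : ∑ N', transvSum f (Sum.elim 0 l) (blk y N' g) = 0 := by
    unfold transvSum
    rw [Finset.sum_comm]
    have hmem : ∀ t : transvections l, blk (1 : GL α F) 0 (t : GL β F) ∈
        transvections (Sum.elim (0 : α → F) l) := by
      rintro ⟨_, c, h, rfl⟩
      refine ⟨Sum.elim 0 c, by simpa using h, ?_⟩
      rw [transv_elim _ _ _ _ h]
      simp
    let j : transvections l →* transvections (Sum.elim (0 : α → F) l) :=
      { toFun := fun t => ⟨blk 1 0 t, hmem t⟩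
        map_one' := Subtype.ext blk_one
        map_mul' := fun t t' => Subtype.ext (by simp [blk_mul]) }
    refine sum_eq_zero_of_hom j (fun v => ∑ N', f (blk y N' g * v))
      (card_ne_zero_of_isPElement hp isPElement_transvections) ?_
    rintro ⟨_, c, h, rfl⟩
    obtain ⟨c₁, c₂, rfl⟩ : ∃ c₁ c₂, c = Sum.elim c₁ c₂ :=
      ⟨c ∘ Sum.inl, c ∘ Sum.inr, (Sum.elim_comp_inl_inr c).symm⟩
    have h' : l ⬝ᵥ c₂ = 0 := by simpa using h
    have h1 : ∀ t : transvections l, ∑ N', f (blk y N' g * (transv (Sum.elim c₁ c₂)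
        (Sum.elim 0 l) h * blk 1 0 (t : GL β F))) =
        ∑ N', f (blk y N' (g * transv c₂ l h' * (t : GL β F))) := by
      intro t
      rw [transv_elim _ _ _ _ h', blk_mul]
      rw [← sum_affine (fun N' => f (blk y N' (g * transv c₂ l h' * (t : GL β F)))) 1
        (transv c₂ l h' * (t : GL β F)) ((y : Matrix α α F) *
        (((1 : GL α F) : Matrix α α F) * (0 : Matrix α β F) + vecMulVec c₁ l * ((t : GL β F) : Matrix β β F)))]
      refine Finset.sum_congr rfl fun N' _ => ?_
      rw [blk_mul]
      simp only [mul_one, mul_assoc, Units.val_one, Matrix.one_mul]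
      rw [add_comm]
    change ∑ t : transvections l, ∑ N', f (blk y N' g * (transv (Sum.elim c₁ c₂)
        (Sum.elim 0 l) h * blk 1 0 (t : GL β F))) = 0
    simp only [h1]
    have h2 := ih _ (hf.restrict_right hy)
    rw [← transvSum_mul_right _ g ⟨c₂, h', rfl⟩] at h2
    exact h2
  simp only [hconst, Finset.sum_const, Finset.card_univ, nsmul_eq_mul] at hsum
  refine (mul_eq_zero.1 hsum).resolve_left ?_
  rw [show Fintype.card (Matrix α β F) = Fintype.card F ^ (Fintype.card α * Fintype.card β) by
    rw [← Nat.card_eq_fintype_card, ← Nat.card_eq_fintype_card (α := F)]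
    change Nat.card (α → β → F) = _
    rw [Nat.card_fun, Nat.card_fun, ← pow_mul, mul_comm]
    simp only [Nat.card_eq_fintype_card], Nat.cast_pow]
  exact pow_ne_zero _ (natCast_pow_card_ne_zero hp)

end BlockReduction

section Transport

variable {ι κ F k : Type} [Fintype ι] [DecidableEq ι] [Fintype κ] [DecidableEq κ]
  [Field F] [Field k]

theorem ext_dotProduct {l l' : ι → F} (h : ∀ x, l ⬝ᵥ x = l' ⬝ᵥ x) : l = l' := by
  ext i
  simpa using h (Pi.single i 1)

theorem IsPElement.map {G H : Type} [Group G] [Group H] {p : ℕ} (c : G →* H) {g : G}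
    (hg : IsPElement p g) : IsPElement p (c g) := by
  obtain ⟨m, hm⟩ := hg
  exact ⟨m, by rw [← map_pow, hm, map_one]⟩

theorem exists_mulVec_eq (Q : (ι → F) ≃ₗ[F] (ι → F)) :
    ∃ q : GL ι F, ∀ x, (q : Matrix ι ι F) *ᵥ x = Q x := by
  refine ⟨⟨LinearMap.toMatrix' Q, LinearMap.toMatrix' Q.symm, ?_, ?_⟩, fun x => ?_⟩
  · rw [← LinearMap.toMatrix'_comp]; simp
  · rw [← LinearMap.toMatrix'_comp]; simp
  · exact LinearMap.toMatrix'_mulVec _ _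

theorem pow_mulVec_of_mulVec {Φ : (ι → F) ≃ₗ[F] (κ → F)} {g : GL ι F} {g' : GL κ F}
    (h : ∀ x, (g' : Matrix κ κ F) *ᵥ Φ x = Φ ((g : Matrix ι ι F) *ᵥ x)) (j : ℕ) (x : ι → F) :
    ((g' ^ j : GL κ F) : Matrix κ κ F) *ᵥ Φ x = Φ (((g ^ j : GL ι F) : Matrix ι ι F) *ᵥ x) := by
  induction j with
  | zero => simp
  | succ j ih => rw [pow_succ_mulVec, ih, h, pow_succ_mulVec]

variable [Fintype F] [DecidableEq F]

theorem exists_transport (Φ : (ι → F) ≃ₗ[F] (κ → F)) :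
    ∃ c : GL ι F ≃* GL κ F,
      (∀ (g : GL ι F) (x : ι → F),
        (c g : Matrix κ κ F) *ᵥ Φ x = Φ ((g : Matrix ι ι F) *ᵥ x)) ∧
      ∀ (p : ℕ) (f : GL ι F → k), IsGood p f → ∃ f' : GL κ F → k, IsGood p f' ∧
        ∀ (l : ι → F) (l' : κ → F), (∀ x, l' ⬝ᵥ Φ x = l ⬝ᵥ x) →
          ∀ g, transvSum f' l' (c g) = transvSum f l g := by
  have hcard : Fintype.card ι = Fintype.card κ := by
    simpa using Φ.finrank_eq
  let e : ι ≃ κ := Fintype.equivOfCardEq hcard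
  obtain ⟨x, hx⟩ := exists_mulVec_eq (Φ.trans (LinearEquiv.funCongrLeft F F e))
  have hx' : ∀ v i, ((x : Matrix ι ι F) *ᵥ v) i = Φ v (e i) := fun v i => by rw [hx]; rfl
  have hre : ∀ g : GL ι F, reindexGL F e.symm (reindexGL F e g) = g := fun g =>
    Units.ext (Matrix.ext fun i j => by simp [reindexGL_apply])
  refine ⟨(MulAut.conj x).trans (reindexGL F e), fun g v => ?_, fun p f hf => ?_⟩
  · ext i
    have h1 : Φ v = (fun j => ((x : Matrix ι ι F) *ᵥ v) (e.symm j)) := by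
      ext j
      rw [hx', Equiv.apply_symm_apply]
    have h2 : Φ ((g : Matrix ι ι F) *ᵥ v) i = (((x * g * x⁻¹ : GL ι F) : Matrix ι ι F) *ᵥ
        ((x : Matrix ι ι F) *ᵥ v)) (e.symm i) := by
      rw [mulVec_mulVec, ← Units.val_mul, inv_mul_cancel_right, Units.val_mul, ← mulVec_mulVec,
        hx', Equiv.apply_symm_apply]
    rw [h2, h1]
    exact (Equiv.sum_comp e.symm fun j => ((x * g * x⁻¹ : GL ι F) : Matrix ι ι F) (e.symm i) j *
      ((x : Matrix ι ι F) *ᵥ v) j)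
  · refine ⟨_, hf.reindex e.symm, fun l l' hl g => ?_⟩
    have h1 := transvSum_reindex f e.symm (l' ∘ e) (reindexGL F e (x * g * x⁻¹))
    have h2 : (l' ∘ e) ∘ e.symm = l' := by
      ext
      simp
    rw [h2, hre, transvSum_conj hf.toIsFlagClass] at h1
    have h3 : (l' ∘ e) ᵥ* (x : Matrix ι ι F) = l := by
      refine ext_dotProduct fun v => ?_
      rw [← dotProduct_mulVec, ← hl v]
      simp only [dotProduct, hx']
      exact Equiv.sum_comp e fun j => l' j * Φ v j
    rw [h3] at h1
    exact h1

theorem isCyclic_of_mulVec {Φ : (ι → F) ≃ₗ[F] (κ → F)} {g : GL ι F} {g' : GL κ F}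
    (h : ∀ x, (g' : Matrix κ κ F) *ᵥ Φ x = Φ ((g : Matrix ι ι F) *ᵥ x)) {l : ι → F} {l' : κ → F}
    (hl : ∀ x, l' ⬝ᵥ Φ x = l ⬝ᵥ x) (hg : IsCyclic l g) : IsCyclic l' g' := by
  intro y hy
  obtain ⟨x, rfl⟩ := Φ.surjective y
  rw [hg x fun j => ?_, map_zero]
  rw [← hl, ← pow_mulVec_of_mulVec h, hy]

theorem blk_pow_mulVec {α β : Type} [Fintype α] [DecidableEq α] [Fintype β] [DecidableEq β]
    (a : GL α F) (N : Matrix α β F) (d : GL β F) (j : ℕ) (x : α ⊕ β → F) :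
    (((blk a N d ^ j : GL (α ⊕ β) F) : Matrix (α ⊕ β) (α ⊕ β) F) *ᵥ x) ∘ Sum.inr =
      ((d ^ j : GL β F) : Matrix β β F) *ᵥ (x ∘ Sum.inr) := by
  induction j with
  | zero => simp
  | succ j ih =>
    rw [pow_succ_mulVec, pow_succ_mulVec, ← ih, blk_val, fromBlocks_mulVec]
    ext i
    simp

theorem IsPElement.of_blk {α β : Type} [Fintype α] [DecidableEq α] [Fintype β] [DecidableEq β]
    {p : ℕ} {a : GL α F} {N : Matrix α β F} {d : GL β F} (h : IsPElement p (UnipotentSeries.blk a N d)) :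
    IsPElement p a := by
  obtain ⟨m, hm⟩ := h
  have h1 : ∀ t : ℕ, ∃ N', UnipotentSeries.blk a N d ^ t = UnipotentSeries.blk (a ^ t) N' (d ^ t) := by
    intro t
    induction t with
    | zero => exact ⟨0, blk_one.symm⟩
    | succ t ih =>
      obtain ⟨N', h⟩ := ih
      exact ⟨_, by rw [pow_succ, h, blk_mul, ← pow_succ, ← pow_succ]⟩
  obtain ⟨N', h2⟩ := h1 (p ^ m)
  exact ⟨m, (blk_injective (h2.symm.trans (hm.trans blk_one.symm))).1⟩

theorem transvSum_eq_zero_of_not_isCyclic {p : ℕ} [Fact p.Prime] [CharP F p] (hp : (p : k) ≠ 0)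
    {f : GL ι F → k} (hf : IsGood p f) {l : ι → F} (hl : l ≠ 0) {g : GL ι F}
    (hg : IsPElement p g) (hc : ¬ IsCyclic l g)
    (ih : ∀ m < Fintype.card ι, ∀ f' : GL (Fin m) F → k, IsGood p f' → ∀ l' ≠ 0, ∀ g',
      IsCyclic l' g' → transvSum f' l' g' = 0) : transvSum f l g = 0 := by
  let W : Submodule F (ι → F) :=
    { carrier := {x | ∀ j : ℕ, l ⬝ᵥ ((g ^ j : GL ι F) : Matrix ι ι F) *ᵥ x = 0}
      zero_mem' := fun j => by simp
      add_mem' := fun {x y} hx hy j => by rw [mulVec_add, dotProduct_add, hx, hy, add_zero]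
      smul_mem' := fun a x hx j => by rw [mulVec_smul, dotProduct_smul, hx, smul_zero] }
  have hW : ∀ x, x ∈ W ↔ ∀ j : ℕ, l ⬝ᵥ ((g ^ j : GL ι F) : Matrix ι ι F) *ᵥ x = 0 :=
    fun x => Iff.rfl
  have hWg : ∀ x ∈ W, (g : Matrix ι ι F) *ᵥ x ∈ W := by
    intro x hx j
    rw [← pow_succ_mulVec']
    exact hx (j + 1)
  have hW0 : W ≠ ⊥ := by
    intro h
    exact hc fun x hx => (Submodule.mem_bot F).1 (h ▸ ((hW x).2 hx))
  obtain ⟨V, hV⟩ := Submodule.exists_isCompl W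
  set a := Module.finrank F W
  set m := Module.finrank F V
  have ha : 0 < a := Module.finrank_pos_iff.2 ((Submodule.nontrivial_iff_ne_bot).2 hW0)
  have ham : a + m = Fintype.card ι := by
    rw [Submodule.finrank_add_eq_of_isCompl hV, Module.finrank_fintype_fun_eq_card]
  let b : Module.Basis (Fin a ⊕ Fin m) F (ι → F) :=
    ((Module.finBasis F W).prod (Module.finBasis F V)).map (Submodule.prodEquivOfIsCompl W V hV)
  have hbl : ∀ i, b (Sum.inl i) ∈ W := fun i => by simp [b]
  have hbr : ∀ i, b (Sum.inr i) ∈ V := fun i => by simp [b]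
  have hrepr : ∀ x ∈ W, ∀ i, b.repr x (Sum.inr i) = 0 := by
    intro x hx i
    obtain ⟨w, rfl⟩ : ∃ w : W, (w : ι → F) = x := ⟨⟨x, hx⟩, rfl⟩
    have : (Submodule.prodEquivOfIsCompl W V hV).symm w = (w, 0) := by
      rw [Submodule.prodEquivOfIsCompl_symm_apply_left]
    simp [b, this]
  let Φ := b.equivFun
  obtain ⟨c, hcg, hcf⟩ := exists_transport (k := k) Φ
  obtain ⟨f', hf', hff'⟩ := hcf p f hf
  let l₂ : Fin m → F := fun i => l ⬝ᵥ b (Sum.inr i)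
  have hl' : ∀ x, Sum.elim (0 : Fin a → F) l₂ ⬝ᵥ Φ x = l ⬝ᵥ x := by
    intro x
    conv_rhs => rw [← b.sum_equivFun x]
    rw [dotProduct_sum]
    refine Finset.sum_congr rfl fun i _ => ?_
    rw [dotProduct_smul, smul_eq_mul, mul_comm]
    congr 1
    rcases i with i | i
    · simpa using ((hW _).1 (hbl i) 0).symm
    · rfl
  have hlow : ∀ i j, ((c g : GL (Fin a ⊕ Fin m) F) : Matrix (Fin a ⊕ Fin m) (Fin a ⊕ Fin m) F)
      (Sum.inr i) (Sum.inl j) = 0 := by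
    intro i j
    have h1 := congrFun (hcg g (b (Sum.inl j))) (Sum.inr i)
    have h2 : Φ (b (Sum.inl j)) = Pi.single (Sum.inl j) 1 := by
      ext s
      simp [Φ, Pi.single_apply, eq_comm]
    rw [h2, mulVec_single_one, Matrix.col_apply] at h1
    rw [h1]
    exact hrepr _ (hWg _ (hbl j)) i
  obtain ⟨y, N, g₂, hblk⟩ := exists_eq_blk _ hlow
  have hpc : IsPElement p (blk y N g₂) := hblk ▸ hg.map c.toMonoidHom
  have hl₂ : l₂ ≠ 0 := by
    intro h
    apply hl
    refine ext_dotProduct fun x => ?_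
    rw [← hl' x, h]
    simp [dotProduct]
  have hg₂ : IsCyclic l₂ g₂ := by
    intro x hx
    let X := Φ.symm (Sum.elim (0 : Fin a → F) x)
    have hX : Φ X = Sum.elim (0 : Fin a → F) x := Φ.apply_symm_apply _
    have hXV : X ∈ V := by
      have : X = ∑ i, x i • b (Sum.inr i) := by
        rw [← b.sum_equivFun X]
        change ∑ i, Φ X i • b i = _
        rw [hX]
        simp
      rw [this]
      exact Submodule.sum_mem _ fun i _ => Submodule.smul_mem _ _ (hbr i)
    have hXW : X ∈ W := by
      refine (hW X).2 fun j => ?_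
      rw [← hl', ← pow_mulVec_of_mulVec (hcg g), hblk, hX]
      have h1 := blk_pow_mulVec y N g₂ j (Sum.elim (0 : Fin a → F) x)
      rw [Sum.elim_comp_inr] at h1
      rw [← hx j, ← h1]
      simp [dotProduct]
    have hX0 : X = 0 := by
      have := (Submodule.mem_inf (p := W) (q := V)).2 ⟨hXW, hXV⟩
      rwa [hV.inf_eq_bot, Submodule.mem_bot] at this
    rw [hX0, map_zero] at hX
    ext i
    exact (congrFun hX (Sum.inr i)).symm
  rw [← hff' l _ hl' g, hblk]
  exact transvSum_blk_eq_zero hp hf' hpc.of_blk hg₂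
    (fun f'' hf'' => ih m (by omega) f'' hf'' l₂ hl₂ g₂ hg₂) N

end Transport

section Unipotent

variable {ι F : Type} [Fintype ι] [DecidableEq ι] [Field F]

theorem isPElement_of_mem_unip {p : ℕ} [Fact p.Prime] [CharP F p] {σ : ι → ℕ} {u : GL ι F}
    (hu : u ∈ unip F σ) : IsPElement p u := by
  rcases isEmpty_or_nonempty ι with h | h
  · exact ⟨0, Units.ext (Matrix.ext fun i => h.elim i)⟩
  set N : Matrix ι ι F := (u : Matrix ι ι F) - 1 with hN
  have h0 : ∀ i j, N i j ≠ 0 → σ i < σ j := by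
    intro i j hij
    by_contra hlt
    exact hij (by rw [hN, Matrix.sub_apply, hu i j (not_lt.1 hlt), sub_self])
  have h1 : ∀ (m : ℕ) (i j), (N ^ m) i j ≠ 0 → σ i + m ≤ σ j := by
    intro m
    induction m with
    | zero =>
      intro i j hij
      by_cases h : i = j
      · simp [h]
      · simp [h] at hij
    | succ m ih =>
      intro i j hij
      rw [pow_succ, Matrix.mul_apply] at hij
      obtain ⟨s, -, hs⟩ := Finset.exists_ne_zero_of_sum_ne_zero hij
      have h2 := ih i s (left_ne_zero_of_mul hs)
      have h3 := h0 s j (right_ne_zero_of_mul hs)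
      omega
  refine ⟨∑ i, σ i + 1, Units.ext ?_⟩
  have h2 : N ^ p ^ (∑ i, σ i + 1) = 0 := by
    ext i j
    by_contra hij
    have h3 := h1 _ i j hij
    have h4 : σ j ≤ ∑ i, σ i := Finset.single_le_sum (f := σ) (fun _ _ => Nat.zero_le _)
      (Finset.mem_univ j)
    have h5 := Nat.lt_pow_self (n := ∑ i, σ i + 1) (Fact.out : p.Prime).one_lt
    omega
  have h3 : (u : Matrix ι ι F) = 1 + N := by rw [hN, add_sub_cancel]
  rw [Units.val_pow_eq_pow_val, h3, add_pow_char_pow_of_commute p _ (Commute.one_left N), h2]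
  simp

theorem perm_eq_one_of_lt_succ {n : ℕ} {π : Equiv.Perm (Fin (n + 1))}
    (h : ∀ i : Fin n, π i.castSucc < π i.succ) : π = 1 := by
  have h1 : StrictMono π := Fin.strictMono_iff_lt_succ.2 h
  have h2 : h1.orderIsoOfSurjective π π.surjective = OrderIso.refl _ := Subsingleton.elim _ _
  ext i
  have := DFunLike.congr_fun h2 i
  simpa using congrArg Fin.val this

end Unipotent

section Lower

variable {n : ℕ} {F k : Type} [Field F] [Field k]

/-- The order reversing injection of `Fin (n + 1)` into `ℕ`. -/
def rev (n : ℕ) : Fin (n + 1) → ℕ := fun i => n - i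

theorem rev_injective : Function.Injective (rev n) := by
  intro i j h
  unfold rev at h
  ext
  omega

variable (n F) in
/-- The group of lower unitriangular matrices. -/
abbrev lower : Subgroup (GL (Fin (n + 1)) F) := unip F (rev n)

theorem mem_lower {y : GL (Fin (n + 1)) F} : y ∈ lower n F ↔
    ∀ i j, i ≤ j → (y : Matrix (Fin (n + 1)) (Fin (n + 1)) F) i j =
      (1 : Matrix (Fin (n + 1)) (Fin (n + 1)) F) i j := by
  rw [mem_unip]
  have : ∀ i j : Fin (n + 1), rev n j ≤ rev n i ↔ i ≤ j := by
    intro i j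
    unfold rev
    rw [Fin.le_def]
    omega
  simp only [this]

theorem lower_mul_subdiag {y y' : GL (Fin (n + 1)) F} (hy : y ∈ lower n F) (hy' : y' ∈ lower n F)
    (i : Fin n) : ((y * y' : GL (Fin (n + 1)) F) : Matrix (Fin (n + 1)) (Fin (n + 1)) F)
      i.succ i.castSucc =
      (y : Matrix (Fin (n + 1)) (Fin (n + 1)) F) i.succ i.castSucc +
      (y' : Matrix (Fin (n + 1)) (Fin (n + 1)) F) i.succ i.castSucc := by
  rw [mem_lower] at hy hy'
  rw [Units.val_mul, Matrix.mul_apply, Finset.sum_eq_add_of_mem i.castSucc i.succ (Finset.mem_univ _)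
    (Finset.mem_univ _) (by simp [Fin.ext_iff])]
  · rw [hy' _ _ le_rfl, hy _ _ le_rfl, Matrix.one_apply_eq, Matrix.one_apply_eq, mul_one, one_mul]
  · rintro j - ⟨h1, h2⟩
    rcases lt_or_gt_of_ne h1 with h | h
    · rw [hy' _ _ h.le, Matrix.one_apply_ne h1, mul_zero]
    · have h3 : i.succ < j := by
        simp only [Ne, Fin.ext_iff, Fin.lt_def, Fin.val_succ, Fin.val_castSucc] at h h2 ⊢
        omega
      rw [hy _ _ h3.le, Matrix.one_apply_ne h2.symm, zero_mul]

/-- The character of the lower unitriangular group defined by an additive character of the field. -/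
def lowerChar (ψ : AddChar F k) : lower n F →* k where
  toFun y := ψ (∑ i : Fin n, ((y : GL (Fin (n + 1)) F) : Matrix (Fin (n + 1)) (Fin (n + 1)) F)
    i.succ i.castSucc)
  map_one' := by
    rw [← AddChar.map_zero_eq_one ψ]
    congr 1
    refine Finset.sum_eq_zero fun i _ => ?_
    simp [Fin.ext_iff]
  map_mul' y y' := by
    rw [← AddChar.map_add_eq_mul, ← Finset.sum_add_distrib]
    congr 1
    exact Finset.sum_congr rfl fun i _ => lower_mul_subdiag y.2 y'.2 i

/-- The elementary matrix at the `i`-th place below the diagonal. -/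
def rootElt (i : Fin n) (s : F) : GL (Fin (n + 1)) F :=
  transv (Pi.single i.succ s) (Pi.single i.castSucc 1) (by simp [Fin.ext_iff])

theorem rootElt_apply (i : Fin n) (s : F) (a b : Fin (n + 1)) :
    (rootElt i s : Matrix (Fin (n + 1)) (Fin (n + 1)) F) a b =
      (1 : Matrix (Fin (n + 1)) (Fin (n + 1)) F) a b +
        if a = i.succ ∧ b = i.castSucc then s else 0 := by
  rw [rootElt, transv_val, Matrix.add_apply, vecMulVec_apply]
  congr 1
  by_cases h1 : a = i.succ <;> by_cases h2 : b = i.castSucc <;> simp [h1, h2]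

theorem rootElt_mem_lower (i : Fin n) (s : F) : rootElt i s ∈ lower n F := by
  rw [mem_lower]
  intro a b hab
  rw [rootElt_apply, if_neg, add_zero]
  rintro ⟨rfl, rfl⟩
  simp [Fin.le_def] at hab

theorem rootElt_mem_borel {i : Fin n} {s : F} {σ : Fin (n + 1) → ℕ}
    (h : σ i.succ < σ i.castSucc) : rootElt i s ∈ borel F σ := by
  rw [mem_borel]
  intro a b hab
  rw [rootElt_apply, if_neg, add_zero, Matrix.one_apply_ne]
  · rintro rfl
    exact lt_irrefl _ hab
  · rintro ⟨rfl, rfl⟩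
    omega

theorem lowerChar_rootElt (ψ : AddChar F k) (i : Fin n) (s : F) :
    lowerChar ψ ⟨rootElt i s, rootElt_mem_lower i s⟩ = ψ s := by
  change ψ _ = ψ s
  congr 1
  rw [Finset.sum_eq_single i]
  · rw [rootElt_apply]
    simp [Fin.ext_iff]
  · intro j _ hj
    rw [rootElt_apply, if_neg, add_zero, Matrix.one_apply_ne]
    · simp [Fin.ext_iff]
    · rintro ⟨h, -⟩
      exact hj (Fin.succ_injective _ h)
  · simp

end Lower

section Whittaker

theorem char_sum_eq_zero {U k : Type} [Group U] [Fintype U] [Field k] (χ : U →* k) {x : U}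
    (hx : χ x ≠ 1) {h : U → k} (hh : ∀ y, h (y * x) = h y) : ∑ y, χ y * h y = 0 := by
  have h1 : ∑ y, χ y * h y = χ x * ∑ y, χ y * h y := by
    conv_lhs => rw [← Equiv.sum_comp (Equiv.mulRight x)]
    rw [Finset.mul_sum]
    refine Finset.sum_congr rfl fun y _ => ?_
    rw [Equiv.coe_mulRight, map_mul, hh]
    ring
  have h2 : (χ x - 1) * ∑ y, χ y * h y = 0 := by
    rw [sub_mul, one_mul, ← h1, sub_self]
  exact (mul_eq_zero.1 h2).resolve_left (sub_ne_zero.2 hx)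

theorem map_mul_map_inv {U k : Type} [Group U] [Field k] (χ : U →* k) (x : U) :
    χ x * χ x⁻¹ = 1 := by
  rw [← map_mul, mul_inv_cancel, map_one]

variable {n : ℕ} {F k : Type} [Field F] [Fintype F] [DecidableEq F] [Field k]

/-- The average of `φ` over left translates by the lower unitriangular group, twisted by `ψ`. -/
def leftSum (ψ : AddChar F k) (φ : GL (Fin (n + 1)) F → k) (g : GL (Fin (n + 1)) F) : k :=
  ∑ y : lower n F, lowerChar ψ y * φ (y * g)

/-- The two-sided average of `φ` over translates by the lower unitriangular group. -/
def biSum (ψ : AddChar F k) (φ : GL (Fin (n + 1)) F → k) (g : GL (Fin (n + 1)) F) : k :=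
  ∑ y : lower n F, lowerChar ψ y * leftSum ψ φ (g * y)

theorem leftSum_mul (ψ : AddChar F k) (φ : GL (Fin (n + 1)) F → k) (u : lower n F)
    (g : GL (Fin (n + 1)) F) : leftSum ψ φ (u * g) = lowerChar ψ u⁻¹ * leftSum ψ φ g := by
  unfold leftSum
  rw [Finset.mul_sum, ← Equiv.sum_comp (Equiv.mulRight u⁻¹)]
  refine Finset.sum_congr rfl fun y _ => ?_
  rw [Equiv.coe_mulRight, map_mul, Subgroup.coe_mul, mul_assoc (y : GL (Fin (n + 1)) F),
    Subgroup.coe_inv, inv_mul_cancel_left]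
  ring

variable {ψ : AddChar F k}

theorem exists_leftSum_eq {a : F} (hψ : ψ a ≠ 1) (g : GL (Fin (n + 1)) F) :
    ∃ d : k, ∀ φ : GL (Fin (n + 1)) F → k,
      (∀ g, ∀ b ∈ borel F (Fin.val : Fin (n + 1) → ℕ), φ (g * b) = φ g) →
      leftSum ψ φ g = d * leftSum ψ φ 1 := by
  obtain ⟨u, hu, π, b, hb, rfl⟩ := exists_bruhat (rev_injective (n := n)) Fin.val_injective g
  have h1 : ∀ φ : GL (Fin (n + 1)) F → k,
      (∀ g, ∀ b ∈ borel F (Fin.val : Fin (n + 1) → ℕ), φ (g * b) = φ g) → ∀ g,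
      ∀ b ∈ borel F (Fin.val : Fin (n + 1) → ℕ), leftSum ψ φ (g * b) = leftSum ψ φ g := by
    intro φ hφ g b hb
    refine Finset.sum_congr rfl fun y _ => ?_
    rw [← mul_assoc, hφ _ b hb]
  by_cases hπ : ∀ i : Fin n, π⁻¹ i.castSucc < π⁻¹ i.succ
  · have : π = 1 := inv_eq_one.1 (perm_eq_one_of_lt_succ hπ)
    subst this
    refine ⟨lowerChar ψ (⟨u, hu⟩ : lower n F)⁻¹, fun φ hφ => ?_⟩
    rw [permGL_one, h1 φ hφ _ b hb, ← leftSum_mul]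
  · push Not at hπ
    obtain ⟨i, hi⟩ := hπ
    have hi' : π⁻¹ i.succ < π⁻¹ i.castSucc :=
      lt_of_le_of_ne hi fun h => by simpa [Fin.ext_iff] using π⁻¹.injective h
    refine ⟨0, fun φ hφ => ?_⟩
    rw [h1 φ hφ _ b hb, zero_mul]
    have h2 := leftSum_mul ψ φ ⟨u, hu⟩ (permGL F π)
    have h3 : leftSum ψ φ (permGL F π) = 0 := by
      have hr : (permGL F π)⁻¹ * rootElt i a * permGL F π ∈
          borel F (Fin.val : Fin (n + 1) → ℕ) := by
        have := (permGL_conj_mem_borel (F := F) (σ := (Fin.val : Fin (n + 1) → ℕ)) π⁻¹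
          (g := rootElt i a)).2 (rootElt_mem_borel hi')
        rwa [permGL_inv, inv_inv] at this
      refine char_sum_eq_zero (lowerChar ψ) (x := ⟨rootElt i a, rootElt_mem_lower i a⟩)
        (by rwa [lowerChar_rootElt]) (h := fun y : lower n F => φ (y * permGL F π)) fun y => ?_
      rw [← hφ (y * permGL F π) _ hr]
      congr 1
      simp only [Subgroup.coe_mul]
      group
    rw [h3, mul_zero] at h2
    exact h2

theorem exists_biSum_eq {p : ℕ} [Fact p.Prime] [CharP F p] (hp : (p : k) ≠ 0) {a : F}
    (hψ : ψ a ≠ 1) (g : GL (Fin (n + 1)) F) :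
    ∃ c : k, ∀ f ∈ flagSpan (Fin (n + 1)) F k, biSum ψ f g = c * biSum ψ f 1 := by
  choose d hd using fun g : GL (Fin (n + 1)) F => exists_leftSum_eq (k := k) hψ g
  have hU : (Fintype.card (lower n F) : k) ≠ 0 :=
    card_ne_zero_of_isPElement hp fun t => by
      obtain ⟨m, hm⟩ := isPElement_of_mem_unip (p := p) t.2
      exact ⟨m, Subtype.ext hm⟩
  set c : k := (Fintype.card (lower n F) : k)⁻¹ *
    ∑ y : lower n F, lowerChar ψ y * d (g * y) with hc
  refine ⟨c, fun f hf => ?_⟩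
  let T : (GL (Fin (n + 1)) F → k) →ₗ[k] k :=
    { toFun := fun f => biSum ψ f g - c * biSum ψ f 1
      map_add' := fun f f' => by
        simp only [biSum, leftSum, Pi.add_apply, mul_add, Finset.sum_add_distrib]
        ring
      map_smul' := fun s f => by
        simp only [biSum, leftSum, Pi.smul_apply, smul_eq_mul, mul_left_comm _ s,
          ← Finset.mul_sum, RingHom.id_apply]
        ring }
  suffices flagSpan (Fin (n + 1)) F k ≤ LinearMap.ker T from sub_eq_zero.1 (this hf)
  refine Submodule.span_le.2 fun φ hφ => ?_
  obtain ⟨u, hu, σ, hσ, h⟩ := IsFlagInvariant.exists_unip hφ (rev_injective (n := n))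
  set φ' : GL (Fin (n + 1)) F → k := fun g => φ (g * u⁻¹) with hφ'
  have hφ'b : ∀ g, ∀ b ∈ borel F σ, φ' (g * b) = φ' g := by
    intro g b hb
    simp only [hφ']
    rw [← h (g * u⁻¹) b hb]
    congr 1
    group
  have hbi : ∀ g, biSum ψ φ g = lowerChar ψ (⟨u, hu⟩ : lower n F)⁻¹ * biSum ψ φ' g := by
    intro g
    unfold biSum
    rw [Finset.mul_sum, ← Equiv.sum_comp (Equiv.mulRight (⟨u, hu⟩ : lower n F)⁻¹)]
    refine Finset.sum_congr rfl fun y _ => ?_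
    rw [Equiv.coe_mulRight, map_mul, mul_comm (lowerChar ψ y), mul_assoc]
    congr 2
    unfold leftSum
    refine Finset.sum_congr rfl fun y' _ => ?_
    simp only [hφ', Subgroup.coe_mul, Subgroup.coe_inv, mul_assoc]
  change biSum ψ φ g - c * biSum ψ φ 1 = 0
  suffices biSum ψ φ' g = c * biSum ψ φ' 1 by
    rw [hbi, hbi, this]
    ring
  by_cases hmono : ∀ i : Fin n, σ i.castSucc < σ i.succ
  · have hmono' : StrictMono σ := Fin.strictMono_iff_lt_succ.2 hmono
    have hφ'v : ∀ g, ∀ b ∈ borel F (Fin.val : Fin (n + 1) → ℕ), φ' (g * b) = φ' g := by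
      intro g b hb
      refine hφ'b g b fun i j hij => ?_
      exact hb (hmono'.lt_iff_lt.1 hij)
    have h1 : biSum ψ φ' 1 = Fintype.card (lower n F) * leftSum ψ φ' 1 := by
      unfold biSum
      have : ∀ y : lower n F, lowerChar ψ y * leftSum ψ φ' (1 * y) = leftSum ψ φ' 1 := by
        intro y
        rw [one_mul, ← mul_one (y : GL (Fin (n + 1)) F), leftSum_mul, ← mul_assoc, map_mul_map_inv,
          one_mul]
      simp only [this, Finset.sum_const, Finset.card_univ, nsmul_eq_mul]
    rw [h1, hc]
    unfold biSum
    rw [mul_comm _ (∑ y : lower n F, lowerChar ψ y * d (g * y)), mul_assoc,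
      inv_mul_cancel_left₀ hU, Finset.sum_mul]
    exact Finset.sum_congr rfl fun y _ => by rw [hd _ φ' hφ'v, mul_assoc]
  · push Not at hmono
    obtain ⟨i, hi⟩ := hmono
    have hi' : σ i.succ < σ i.castSucc :=
      lt_of_le_of_ne hi fun h => by simpa [Fin.ext_iff] using hσ h
    have h0 : ∀ g, biSum ψ φ' g = 0 := by
      intro g
      refine char_sum_eq_zero (lowerChar ψ) (x := ⟨rootElt i a, rootElt_mem_lower i a⟩)
        (by rwa [lowerChar_rootElt]) (h := fun y : lower n F => leftSum ψ φ' (g * y)) fun y => ?_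
      refine Finset.sum_congr rfl fun y' _ => ?_
      rw [← hφ'b (y' * (g * y)) (rootElt i a) (rootElt_mem_borel hi'), Subgroup.coe_mul]
      simp only [mul_assoc]
    rw [h0, h0, mul_zero]

theorem lowerSum_eq_zero {p : ℕ} [Fact p.Prime] [CharP F p] (hp : (p : k) ≠ 0) {a : F}
    (hψ : ψ a ≠ 1) {f : GL (Fin (n + 1)) F → k} (hf : IsGood p f) (g : GL (Fin (n + 1)) F) :
    ∑ y : lower n F, lowerChar ψ y * f (y * g) = 0 := by
  have hU : (Fintype.card (lower n F) : k) ≠ 0 :=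
    card_ne_zero_of_isPElement hp fun t => by
      obtain ⟨m, hm⟩ := isPElement_of_mem_unip (p := p) t.2
      exact ⟨m, Subtype.ext hm⟩
  obtain ⟨c, hc⟩ := exists_biSum_eq hp hψ g
  have h1 : biSum ψ f 1 = 0 := by
    refine Finset.sum_eq_zero fun y _ => ?_
    rw [leftSum, Finset.sum_eq_zero, mul_zero]
    intro y' _
    rw [hf.vanish _ (isPElement_of_mem_unip (σ := rev n) (mul_mem y'.2 (by simp))),
      mul_zero]
  have h2 := hc f hf.mem
  rw [h1, mul_zero] at h2
  have h3 : biSum ψ f g = Fintype.card (lower n F) * leftSum ψ f g := by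
    unfold biSum
    have : ∀ y : lower n F, lowerChar ψ y * leftSum ψ f (g * y) = leftSum ψ f g := by
      intro y
      unfold leftSum
      rw [Finset.mul_sum, ← Equiv.sum_comp (Equiv.mulLeft y) fun y' : lower n F =>
        lowerChar ψ y' * f (y' * g)]
      refine Finset.sum_congr rfl fun y' _ => ?_
      rw [Equiv.coe_mulLeft, map_mul, ← mul_assoc (y' : GL (Fin (n + 1)) F), hf.comm,
        Subgroup.coe_mul]
      simp only [mul_assoc]
    simp only [this, Finset.sum_const, Finset.card_univ, nsmul_eq_mul]
  rw [h3] at h2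
  exact (mul_eq_zero.1 h2).resolve_left hU

end Whittaker

section CyclicLower

variable {n : ℕ} {F k : Type} [Field F] [Field k]

theorem lower_mulVec_sub {y : GL (Fin (n + 1)) F} (hy : y ∈ lower n F) {x : Fin (n + 1) → F}
    {i : Fin (n + 1)} (hx : ∀ j < i, x j = 0) {a : Fin (n + 1)} (ha : a ≤ i) :
    ((y : Matrix (Fin (n + 1)) (Fin (n + 1)) F) *ᵥ x - x) a = 0 := by
  rw [mem_lower] at hy
  rw [Pi.sub_apply, mulVec, dotProduct, Finset.sum_eq_single a]
  · rw [hy _ _ le_rfl, Matrix.one_apply_eq, one_mul, sub_self]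
  · intro j _ hj
    rcases lt_or_gt_of_ne hj with h | h
    · rw [hx j (h.trans_le ha), mul_zero]
    · rw [hy _ _ h.le, Matrix.one_apply_ne hj.symm, zero_mul]
  · simp

theorem lower_mulVec_sub_succ {y : GL (Fin (n + 1)) F} (hy : y ∈ lower n F) {x : Fin (n + 1) → F}
    {i : Fin n} (hx : ∀ j < i.castSucc, x j = 0) :
    ((y : Matrix (Fin (n + 1)) (Fin (n + 1)) F) *ᵥ x - x) i.succ =
      (y : Matrix (Fin (n + 1)) (Fin (n + 1)) F) i.succ i.castSucc * x i.castSucc := by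
  rw [mem_lower] at hy
  rw [Pi.sub_apply, mulVec, dotProduct, Finset.sum_eq_add_of_mem i.castSucc i.succ
    (Finset.mem_univ _) (Finset.mem_univ _) (by simp [Fin.ext_iff])]
  · rw [hy _ _ le_rfl, Matrix.one_apply_eq, one_mul, add_sub_cancel_right]
  · rintro j - ⟨h1, h2⟩
    rcases lt_or_gt_of_ne h1 with h | h
    · rw [hx j h, mul_zero]
    · have h3 : i.succ < j := by
        simp only [Ne, Fin.ext_iff, Fin.lt_def, Fin.val_succ, Fin.val_castSucc] at h h2 ⊢
        omega
      rw [hy _ _ h3.le, Matrix.one_apply_ne h2.symm, zero_mul]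

theorem isCyclic_lower_iff {y : GL (Fin (n + 1)) F} (hy : y ∈ lower n F) :
    IsCyclic (Pi.single (Fin.last n) 1) y ↔
      ∀ i : Fin n, (y : Matrix (Fin (n + 1)) (Fin (n + 1)) F) i.succ i.castSucc ≠ 0 := by
  constructor
  · intro hc i hi
    let T : (Fin (n + 1) → F) →ₗ[F] (Fin n → F) :=
      { toFun := fun x j => if j < i then x j.castSucc else if j = i then x (Fin.last n) else
          ((y : Matrix (Fin (n + 1)) (Fin (n + 1)) F) *ᵥ x - x) j.succ
        map_add' := fun x x' => by
          ext j
          simp only [Pi.add_apply, mulVec_add, Pi.sub_apply]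
          split_ifs <;> ring
        map_smul' := fun a x => by
          ext j
          simp only [Pi.smul_apply, mulVec_smul, Pi.sub_apply, RingHom.id_apply, smul_eq_mul]
          split_ifs <;> ring }
    have hker := LinearMap.ker_ne_bot_of_finrank_lt (f := T) (by simp)
    obtain ⟨x, hx, hx0⟩ := Submodule.exists_mem_ne_zero_of_ne_bot hker
    have hT : ∀ j, T x j = 0 := fun j => congrFun hx j
    have h1 : ∀ j < i.castSucc, x j = 0 := by
      intro j hj
      have hj' : (j : ℕ) < i := hj
      have := hT ⟨j, by omega⟩
      change (if _ then _ else _) = _ at this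
      rwa [if_pos (show (⟨(j : ℕ), _⟩ : Fin n) < i from hj)] at this
    have h2 : x (Fin.last n) = 0 := by
      have := hT i
      change (if _ then _ else if _ then _ else _) = _ at this
      rwa [if_neg (lt_irrefl _), if_pos rfl] at this
    have h3 : (y : Matrix (Fin (n + 1)) (Fin (n + 1)) F) *ᵥ x = x := by
      rw [← sub_eq_zero]
      ext a
      rcases lt_trichotomy a i.succ with h | rfl | h
      · exact lower_mulVec_sub hy h1 (Fin.le_castSucc_iff.2 h)
      · rw [lower_mulVec_sub_succ hy h1, hi, zero_mul, Pi.zero_apply]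
      · obtain ⟨j, rfl⟩ := Fin.exists_succ_eq.2 (Fin.ne_zero_of_lt h)
        have := hT j
        change (if _ then _ else if _ then _ else _) = _ at this
        have hij : i < j := Fin.succ_lt_succ_iff.1 h
        rwa [if_neg hij.not_gt, if_neg hij.ne'] at this
    refine hx0 (hc x fun j => ?_)
    have h4 : ((y ^ j : GL (Fin (n + 1)) F) : Matrix (Fin (n + 1)) (Fin (n + 1)) F) *ᵥ x = x := by
      induction j with
      | zero => simp
      | succ j ih => rw [pow_succ_mulVec, ih, h3]
    rw [h4]
    simpa using h2
  · intro hsub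
    have key : ∀ (i : Fin (n + 1)) (x : Fin (n + 1) → F),
        (∀ j : ℕ, Pi.single (Fin.last n) 1 ⬝ᵥ ((y ^ j : GL (Fin (n + 1)) F) :
          Matrix (Fin (n + 1)) (Fin (n + 1)) F) *ᵥ x = 0) → (∀ j < i, x j = 0) → x i = 0 := by
      intro i
      induction i using Fin.reverseInduction with
      | last =>
        intro x hx _
        simpa using hx 0
      | cast i ih =>
        intro x hx hxi
        have h1 := ih ((y : Matrix (Fin (n + 1)) (Fin (n + 1)) F) *ᵥ x - x) (fun j => by
          rw [mulVec_sub, dotProduct_sub, ← pow_succ_mulVec', hx, hx, sub_zero]) fun j hj =>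
            lower_mulVec_sub hy hxi (Fin.le_castSucc_iff.2 hj)
        rw [lower_mulVec_sub_succ hy hxi] at h1
        exact (mul_eq_zero.1 h1).resolve_left (hsub i)
    intro x hx
    have h1 : ∀ i : Fin (n + 1), x i = 0 := by
      intro i
      induction i using WellFoundedLT.induction with
      | _ i ih => exact key i x hx ih
    exact funext h1

theorem exists_lower_subdiag (s : Fin n → F) : ∃ y ∈ lower n F, ∀ i : Fin n,
    (y : Matrix (Fin (n + 1)) (Fin (n + 1)) F) i.succ i.castSucc = s i := by
  let S : AddSubmonoid (Fin n → F) :=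
    { carrier := {s | ∃ y ∈ lower n F, ∀ i : Fin n,
        (y : Matrix (Fin (n + 1)) (Fin (n + 1)) F) i.succ i.castSucc = s i}
      zero_mem' := ⟨1, one_mem _, fun i => by simp [Fin.ext_iff]⟩
      add_mem' := by
        rintro s s' ⟨y, hy, h⟩ ⟨y', hy', h'⟩
        exact ⟨y * y', mul_mem hy hy', fun i => by rw [lower_mul_subdiag hy hy', h, h',
          Pi.add_apply]⟩ }
  change s ∈ S
  rw [← Finset.univ_sum_single s]
  refine S.sum_mem fun i _ => ⟨rootElt i (s i), rootElt_mem_lower _ _, fun j => ?_⟩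
  rw [rootElt_apply]
  by_cases h : j = i
  · subst h
    simp [Fin.ext_iff]
  · rw [if_neg (fun h' => h (Fin.succ_injective _ h'.1)), Pi.single_eq_of_ne h, add_zero,
      Matrix.one_apply_ne (by simp [Fin.ext_iff])]

variable [Fintype F] [DecidableEq F]

open Classical in
theorem sum_lowerChar_ne_zero {p : ℕ} [Fact p.Prime] [CharP F p] (hp : (p : k) ≠ 0)
    {ψ : AddChar F k} {a : F} (hψ : ψ a ≠ 1) :
    ∑ y : lower n F, lowerChar ψ y *
      (if IsCyclic (Pi.single (Fin.last n) 1) (y : GL (Fin (n + 1)) F) then 1 else 0) ≠ 0 := by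
  let h : (Fin n → F) → k := fun s => ∏ i, ψ (s i) * (if s i ≠ 0 then 1 else 0)
  let sub : lower n F → Fin n → F := fun y i =>
    ((y : GL (Fin (n + 1)) F) : Matrix (Fin (n + 1)) (Fin (n + 1)) F) i.succ i.castSucc
  have h1 : ∀ y : lower n F, lowerChar ψ y * (if IsCyclic (Pi.single (Fin.last n) 1)
      (y : GL (Fin (n + 1)) F) then 1 else 0) = h (sub y) := by
    intro y
    simp only [h, Finset.prod_mul_distrib]
    congr 1
    · change ψ.toMonoidHom (Multiplicative.ofAdd (∑ i, sub y i)) = _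
      rw [ofAdd_sum, map_prod]
      rfl
    · rw [Finset.prod_ite_zero]
      simp only [isCyclic_lower_iff y.2, Finset.mem_univ, true_imp_iff, Finset.prod_const_one]
      rfl
  simp only [h1]
  have h2 : ∀ s, ∑ y, h (sub y + s) = ∑ y, h (sub y) := by
    intro s
    obtain ⟨y', hy', hs⟩ := exists_lower_subdiag s
    rw [← Equiv.sum_comp (Equiv.mulRight (⟨y', hy'⟩ : lower n F)) fun y => h (sub y)]
    refine Finset.sum_congr rfl fun y _ => ?_
    congr 1
    ext i
    rw [Pi.add_apply, ← hs]
    exact (lower_mul_subdiag y.2 hy' i).symm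
  have h3 : ∑ s : Fin n → F, ∑ y, h (sub y + s) = Fintype.card (Fin n → F) * ∑ y, h (sub y) := by
    simp only [h2, Finset.sum_const, Finset.card_univ, nsmul_eq_mul]
  have h4 : ∑ t : F, ψ t * (if t ≠ 0 then 1 else 0) = -1 := by
    have hψ1 : ψ ≠ 1 := by
      rintro rfl
      exact hψ rfl
    have h5 := AddChar.sum_eq_zero_of_ne_one hψ1
    rw [← Finset.add_sum_erase _ _ (Finset.mem_univ (0 : F)), AddChar.map_zero_eq_one] at h5
    rw [← Finset.add_sum_erase _ _ (Finset.mem_univ (0 : F))]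
    rw [if_neg (by simp), mul_zero, zero_add, Finset.sum_congr rfl fun t ht => by
      rw [if_pos (Finset.ne_of_mem_erase ht), mul_one]]
    exact eq_neg_of_add_eq_zero_right h5
  have h5 : ∑ s, h s = (-1) ^ n := by
    simp only [h]
    rw [← Fintype.prod_sum fun (_ : Fin n) (t : F) => ψ t * (if t ≠ 0 then 1 else 0)]
    simp only [h4]
    simp
  have hU : (Fintype.card (lower n F) : k) ≠ 0 :=
    card_ne_zero_of_isPElement hp fun t => by
      obtain ⟨m, hm⟩ := isPElement_of_mem_unip (p := p) t.2
      exact ⟨m, Subtype.ext hm⟩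
  have h6 : ∑ s : Fin n → F, ∑ y, h (sub y + s) = Fintype.card (lower n F) * (-1) ^ n := by
    rw [Finset.sum_comm]
    have : ∀ y, ∑ s, h (sub y + s) = (-1) ^ n := fun y => by
      rw [← h5]
      exact Equiv.sum_comp (Equiv.addLeft (sub y)) h
    simp only [this, Finset.sum_const, Finset.card_univ, nsmul_eq_mul]
  intro h7
  rw [h3, h7, mul_zero] at h6
  exact mul_ne_zero hU (pow_ne_zero _ (neg_ne_zero.2 one_ne_zero)) h6.symm

end CyclicLower

section Main

variable {F k : Type} [Field F] [Field k] [Fintype F] [DecidableEq F]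

theorem transvSum_single_eq_zero {p : ℕ} [Fact p.Prime] [CharP F p] (hp : (p : k) ≠ 0)
    {ψ : AddChar F k} {a : F} (hψ : ψ a ≠ 1) {n : ℕ}
    (ih : ∀ m < n + 1, ∀ f' : GL (Fin m) F → k, IsGood p f' → ∀ l' ≠ 0, ∀ g',
      IsCyclic l' g' → transvSum f' l' g' = 0)
    {f : GL (Fin (n + 1)) F → k} (hf : IsGood p f) {g : GL (Fin (n + 1)) F}
    (hg : IsCyclic (Pi.single (Fin.last n) 1) g) :
    transvSum f (Pi.single (Fin.last n) 1) g = 0 := by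
  classical
  have h1 : ∑ y : lower n F, lowerChar ψ y *
      transvSum f (Pi.single (Fin.last n) 1) (y : GL (Fin (n + 1)) F) = 0 := by
    unfold transvSum
    simp only [Finset.mul_sum]
    rw [Finset.sum_comm]
    exact Finset.sum_eq_zero fun v _ => lowerSum_eq_zero hp hψ hf v
  have h2 : ∀ y : lower n F, lowerChar ψ y *
      transvSum f (Pi.single (Fin.last n) 1) (y : GL (Fin (n + 1)) F) =
      lowerChar ψ y * (if IsCyclic (Pi.single (Fin.last n) 1) (y : GL (Fin (n + 1)) F)
        then 1 else 0) * transvSum f (Pi.single (Fin.last n) 1) g := by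
    intro y
    split_ifs with h
    · rw [transvSum_eq_of_isCyclic hf.toIsFlagClass h hg, mul_one]
    · rw [transvSum_eq_zero_of_not_isCyclic hp hf (by simp) (isPElement_of_mem_unip y.2) h
        (by simpa using ih)]
      simp
  simp only [h2] at h1
  rw [← Finset.sum_mul] at h1
  exact (mul_eq_zero.1 h1).resolve_left (sum_lowerChar_ne_zero hp hψ)

theorem transvSum_eq_zero_of_isCyclic {p : ℕ} [Fact p.Prime] [CharP F p] (hp : (p : k) ≠ 0)
    {ψ : AddChar F k} {a : F} (hψ : ψ a ≠ 1) {ι : Type} [Fintype ι] [DecidableEq ι]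
    {f : GL ι F → k} (hf : IsGood p f) {l : ι → F} (hl : l ≠ 0) {g : GL ι F}
    (hg : IsCyclic l g) : transvSum f l g = 0 := by
  obtain ⟨N, hN⟩ : ∃ N, Fintype.card ι = N := ⟨_, rfl⟩
  induction N using Nat.strong_induction_on generalizing ι with
  | _ N ih =>
    obtain ⟨i, -⟩ := Function.ne_iff.1 hl
    obtain ⟨n, rfl⟩ : ∃ n, N = n + 1 :=
      ⟨N - 1, by have := Fintype.card_pos_iff.2 ⟨i⟩; omega⟩
    obtain ⟨b, hb, -⟩ := hg.exists_basis hN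
    obtain ⟨c, hcg, hcf⟩ := exists_transport (k := k) b.equivFun
    obtain ⟨f', hf', hff'⟩ := hcf p f hf
    have hl' : ∀ x, Pi.single (Fin.last n) 1 ⬝ᵥ b.equivFun x = l ⬝ᵥ x := by
      intro x
      conv_rhs => rw [← b.sum_equivFun x, dotProduct_sum]
      simp [hb]
    rw [← hff' l _ hl' g]
    refine transvSum_single_eq_zero hp hψ (fun m hm f'' hf'' l'' hl'' g'' hg'' =>
      ih m hm hf'' hl'' hg'' (Fintype.card_fin m)) hf' ?_
    exact isCyclic_of_mulVec (hcg g) hl' hg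

end Main

section Hecke

variable {k R : Type} [Field k] [Ring R] [Algebra k R]

/-- The non-unital subalgebra generated by `e` and the `t i` with `i ∈ S`. -/
def heckeAdjoin (k : Type) {R : Type} [Field k] [Ring R] [Algebra k R] (e : R) (t : ℕ → R)
    (S : Set ℕ) : NonUnitalSubalgebra k R :=
  NonUnitalAlgebra.adjoin k (insert e (t '' S))

theorem e_mem_heckeAdjoin {e : R} {t : ℕ → R} {S : Set ℕ} : e ∈ heckeAdjoin k e t S :=
  NonUnitalAlgebra.subset_adjoin k (Set.mem_insert _ _)

theorem t_mem_heckeAdjoin {e : R} {t : ℕ → R} {S : Set ℕ} {i : ℕ} (hi : i ∈ S) :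
    t i ∈ heckeAdjoin k e t S :=
  NonUnitalAlgebra.subset_adjoin k (Set.mem_insert_of_mem _ ⟨i, hi, rfl⟩)

theorem heckeAdjoin_mono {e : R} {t : ℕ → R} {S T : Set ℕ} (h : S ⊆ T) :
    heckeAdjoin k e t S ≤ heckeAdjoin k e t T :=
  NonUnitalAlgebra.adjoin_mono (Set.insert_subset_insert (Set.image_mono h))

theorem heckeAdjoin_le {e : R} {t : ℕ → R} {S : Set ℕ} {p : NonUnitalSubalgebra k R} (he : e ∈ p)
    (ht : ∀ i ∈ S, t i ∈ p) : heckeAdjoin k e t S ≤ p := by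
  refine NonUnitalAlgebra.adjoin_le ?_
  rintro _ (rfl | ⟨i, hi, rfl⟩)
  · exact he
  · exact ht i hi

/-- The span of the elements involving `t m` at most once. -/
def twoStep (k : Type) {R : Type} [Field k] [Ring R] [Algebra k R] (e : R) (t : ℕ → R) (m : ℕ) :
    Submodule k R :=
  (heckeAdjoin k e t (Set.Iio m)).toSubmodule ⊔ Submodule.span k
    {x | ∃ a ∈ heckeAdjoin k e t (Set.Iio m), ∃ b ∈ heckeAdjoin k e t (Set.Iio m),
      x = a * t m * b}

theorem mem_twoStep_left {e : R} {t : ℕ → R} {m : ℕ} {a : R}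
    (ha : a ∈ heckeAdjoin k e t (Set.Iio m)) : a ∈ twoStep k e t m :=
  Submodule.mem_sup_left ha

theorem mem_twoStep_right {e : R} {t : ℕ → R} {m : ℕ} {a b : R}
    (ha : a ∈ heckeAdjoin k e t (Set.Iio m)) (hb : b ∈ heckeAdjoin k e t (Set.Iio m)) :
    a * t m * b ∈ twoStep k e t m :=
  Submodule.mem_sup_right (Submodule.subset_span ⟨a, ha, b, hb, rfl⟩)

theorem twoStep_induction {e : R} {t : ℕ → R} {m : ℕ} {p : R → Prop}
    (left : ∀ a ∈ heckeAdjoin k e t (Set.Iio m), p a)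
    (right : ∀ a ∈ heckeAdjoin k e t (Set.Iio m), ∀ b ∈ heckeAdjoin k e t (Set.Iio m),
      p (a * t m * b))
    (add : ∀ x y, p x → p y → p (x + y)) (smul : ∀ (c : k) x, p x → p (c • x))
    {x : R} (hx : x ∈ twoStep k e t m) : p x := by
  have h0 : p 0 := left 0 (zero_mem _)
  let P : Submodule k R :=
    { carrier := {x | p x}
      zero_mem' := h0
      add_mem' := fun {x y} hx hy => add x y hx hy
      smul_mem' := fun c x hx => smul c x hx }
  have h1 : twoStep k e t m ≤ P := by
    refine sup_le left (Submodule.span_le.2 ?_)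
    rintro _ ⟨a, ha, b, hb, rfl⟩
    exact right a ha b hb
  exact h1 hx

/-- A sequence of elements satisfying the relations of a Hecke algebra of type `A` with `N`
generators and identity element `e`. -/
structure HeckeRelations (k : Type) {R : Type} [Field k] [Ring R] [Algebra k R] (e : R)
    (t : ℕ → R) (N : ℕ) : Prop where
  idem : e * e = e
  left : ∀ i < N, e * t i = t i
  right : ∀ i < N, t i * e = t i
  sq : ∀ i < N, t i * t i ∈ Submodule.span k {e, t i}
  comm : ∀ i j, i + 1 < j → j < N → t i * t j = t j * t i
  braid : ∀ i, i + 1 < N → t i * t (i + 1) * t i = t (i + 1) * t i * t (i + 1)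

namespace HeckeRelations

variable {e : R} {t : ℕ → R} {N : ℕ} (H : HeckeRelations k e t N)
include H

theorem e_mul {m : ℕ} (hm : m ≤ N) {x : R} (hx : x ∈ heckeAdjoin k e t (Set.Iio m)) :
    e * x = x := by
  induction hx using NonUnitalAlgebra.adjoin_induction with
  | mem x hx =>
    obtain rfl | ⟨i, hi, rfl⟩ := hx
    · exact H.idem
    · exact H.left i (lt_of_lt_of_le hi hm)
  | add x y _ _ hx hy => rw [mul_add, hx, hy]
  | zero => rw [mul_zero]
  | mul x y _ _ hx hy => rw [← mul_assoc, hx]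
  | smul c x _ hx => rw [mul_smul_comm, hx]

theorem mul_e {m : ℕ} (hm : m ≤ N) {x : R} (hx : x ∈ heckeAdjoin k e t (Set.Iio m)) :
    x * e = x := by
  induction hx using NonUnitalAlgebra.adjoin_induction with
  | mem x hx =>
    obtain rfl | ⟨i, hi, rfl⟩ := hx
    · exact H.idem
    · exact H.right i (lt_of_lt_of_le hi hm)
  | add x y _ _ hx hy => rw [add_mul, hx, hy]
  | zero => rw [zero_mul]
  | mul x y _ _ hx hy => rw [mul_assoc, hy]
  | smul c x _ hx => rw [smul_mul_assoc, hx]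

theorem commute_t {m j : ℕ} (hmj : ∀ i < m, i + 1 < j) (hj : j < N) {x : R}
    (hx : x ∈ heckeAdjoin k e t (Set.Iio m)) : Commute x (t j) := by
  induction hx using NonUnitalAlgebra.adjoin_induction with
  | mem x hx =>
    obtain rfl | ⟨i, hi, rfl⟩ := hx
    · exact (H.left j hj).trans (H.right j hj).symm
    · exact H.comm i j (hmj i hi) hj
  | add x y _ _ hx hy => exact hx.add_left hy
  | zero => exact Commute.zero_left _
  | mul x y _ _ hx hy => exact hx.mul_left hy
  | smul c x _ hx => exact hx.smul_left c

theorem mem_twoStep_of_sandwich {m : ℕ} (hm : m < N)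
    (hs : ∀ h ∈ heckeAdjoin k e t (Set.Iio m), ∀ h' ∈ heckeAdjoin k e t (Set.Iio m),
      t m * h * t m * h' ∈ twoStep k e t m)
    {x : R} (hx : x ∈ heckeAdjoin k e t (Set.Iio (m + 1))) : x ∈ twoStep k e t m := by
  suffices h : ∀ y ∈ twoStep k e t m, x * y ∈ twoStep k e t m by
    rw [← H.mul_e hm hx]
    exact h e (mem_twoStep_left e_mem_heckeAdjoin)
  induction hx using NonUnitalAlgebra.adjoin_induction with
  | mem x hx =>
    intro y hy
    by_cases hxm : x = t m
    · subst hxm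
      refine twoStep_induction (p := fun y => t m * y ∈ twoStep k e t m) ?_ ?_ ?_ ?_ hy
      · intro a ha
        rw [← H.left m hm]
        exact mem_twoStep_right e_mem_heckeAdjoin ha
      · intro a ha b hb
        rw [← mul_assoc, ← mul_assoc]
        exact hs a ha b hb
      · intro x y hx hy
        rw [mul_add]
        exact add_mem hx hy
      · intro c x hx
        rw [mul_smul_comm]
        exact Submodule.smul_mem _ _ hx
    · have hx' : x ∈ heckeAdjoin k e t (Set.Iio m) := by
        obtain rfl | ⟨i, hi, rfl⟩ := hx
        · exact e_mem_heckeAdjoin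
        · refine t_mem_heckeAdjoin (lt_of_le_of_ne (Nat.lt_succ_iff.1 hi) ?_)
          rintro rfl
          exact hxm rfl
      refine twoStep_induction (p := fun y => x * y ∈ twoStep k e t m) ?_ ?_ ?_ ?_ hy
      · intro a ha
        exact mem_twoStep_left (mul_mem hx' ha)
      · intro a ha b hb
        rw [← mul_assoc, ← mul_assoc]
        exact mem_twoStep_right (mul_mem hx' ha) hb
      · intro x y hx hy
        rw [mul_add]
        exact add_mem hx hy
      · intro c x hx
        rw [mul_smul_comm]
        exact Submodule.smul_mem _ _ hx
  | add x y _ _ hx hy =>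
    intro z hz
    rw [add_mul]
    exact add_mem (hx z hz) (hy z hz)
  | zero =>
    intro z hz
    rw [zero_mul]
    exact zero_mem _
  | mul x y _ _ hx hy =>
    intro z hz
    rw [mul_assoc]
    exact hx _ (hy z hz)
  | smul c x _ hx =>
    intro z hz
    rw [smul_mul_assoc]
    exact Submodule.smul_mem _ _ (hx z hz)

theorem sq_sandwich {m : ℕ} (hm : m < N) {a b : R} (ha : a ∈ heckeAdjoin k e t (Set.Iio m))
    (hb : b ∈ heckeAdjoin k e t (Set.Iio m)) :
    a * (t m * t m) * b ∈ twoStep k e t m := by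
  obtain ⟨c, d, hcd⟩ := Submodule.mem_span_pair.1 (H.sq m hm)
  rw [← hcd, mul_add, add_mul, mul_smul_comm, mul_smul_comm, smul_mul_assoc, smul_mul_assoc,
    H.mul_e hm.le ha]
  exact add_mem (Submodule.smul_mem _ _ (mem_twoStep_left (mul_mem ha hb)))
    (Submodule.smul_mem _ _ (mem_twoStep_right ha hb))

/-- Every element of the algebra on `m + 1` generators is a combination of elements not involving
`t m` and elements involving `t m` exactly once. -/
theorem mem_twoStep {m : ℕ} (hm : m < N) {x : R}
    (hx : x ∈ heckeAdjoin k e t (Set.Iio (m + 1))) : x ∈ twoStep k e t m := by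
  induction m generalizing x with
  | zero =>
    refine H.mem_twoStep_of_sandwich hm (fun h hh h' hh' => ?_) hx
    rw [(H.commute_t (by simp) hm hh).symm.eq, mul_assoc h]
    exact H.sq_sandwich hm hh hh'
  | succ m ih =>
    refine H.mem_twoStep_of_sandwich hm (fun h hh => ?_) hx
    have hK : heckeAdjoin k e t (Set.Iio m) ≤ heckeAdjoin k e t (Set.Iio (m + 1)) :=
      heckeAdjoin_mono (Set.Iio_subset_Iio m.le_succ)
    have hcomm : ∀ i < m, i + 1 < m + 1 := fun i hi => Nat.succ_lt_succ hi
    have htm : t m ∈ heckeAdjoin k e t (Set.Iio (m + 1)) := t_mem_heckeAdjoin (Nat.lt_succ_self m)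
    have h1 := ih (Nat.lt_of_succ_lt hm) hh
    refine twoStep_induction (p := fun h => ∀ h' ∈ heckeAdjoin k e t (Set.Iio (m + 1)),
      t (m + 1) * h * t (m + 1) * h' ∈ twoStep k e t (m + 1)) ?_ ?_ ?_ ?_ h1
    · intro a ha h' hh'
      rw [(H.commute_t hcomm hm ha).symm.eq, mul_assoc a]
      exact H.sq_sandwich hm (hK ha) hh'
    · intro a ha b hb h' hh'
      have : t (m + 1) * (a * t m * b) * t (m + 1) * h' =
          (a * t m) * t (m + 1) * (t m * b * h') := by
        calc t (m + 1) * (a * t m * b) * t (m + 1) * h' =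
            (t (m + 1) * a) * t m * (b * t (m + 1)) * h' := by noncomm_ring
          _ = a * (t (m + 1) * t m * t (m + 1)) * b * h' := by
            rw [(H.commute_t hcomm hm ha).symm.eq, (H.commute_t hcomm hm hb).eq]
            noncomm_ring
          _ = _ := by
            rw [← H.braid m hm]
            noncomm_ring
      rw [this]
      exact mem_twoStep_right (mul_mem (hK ha) htm) (mul_mem (mul_mem htm (hK hb)) hh')
    · intro x y hx hy h' hh'
      rw [mul_add, add_mul, add_mul]
      exact add_mem (hx h' hh') (hy h' hh')
    · intro c x hx h' hh'
      rw [mul_smul_comm, smul_mul_assoc, smul_mul_assoc]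
      exact Submodule.smul_mem _ _ (hx h' hh')

theorem commute_descending {D : ℕ → R} (hDN : D N = e) (hD : ∀ m < N, D m = t m * D (m + 1))
    {m j : ℕ} (hmj : m < j) (hj : j ≤ N) {x : R} (hx : x ∈ heckeAdjoin k e t (Set.Iio m)) :
    Commute x (D j) := by
  induction hj using Nat.decreasingInduction with
  | self =>
    rw [hDN]
    exact (H.mul_e (by omega) hx).trans (H.e_mul (by omega) hx).symm
  | of_succ j hj ih =>
    rw [hD j hj]
    exact (H.commute_t (fun i hi => by omega) hj hx).mul_right (ih (by omega))

theorem descending_mem {D : ℕ → R} (hDN : D N = e) (hD : ∀ m < N, D m = t m * D (m + 1))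
    {m j : ℕ} (hmj : m < j) (hj : j ≤ N) :
    D j ∈ heckeAdjoin k e t {i | i < N ∧ i ≠ m} := by
  induction hj using Nat.decreasingInduction with
  | self =>
    rw [hDN]
    exact e_mem_heckeAdjoin
  | of_succ j hj ih =>
    rw [hD j hj]
    exact mul_mem (t_mem_heckeAdjoin ⟨hj, hmj.ne'⟩) (ih (by omega))

/-- A trace function on a Hecke algebra of type `A` vanishes as soon as it vanishes on the maximal
parabolic subalgebras and on the Coxeter element. -/
theorem trace_eq_zero {f : R →ₗ[k] k} (hf : ∀ x y, f (x * y) = f (y * x)) {D : ℕ → R}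
    (hDN : D N = e) (hD : ∀ m < N, D m = t m * D (m + 1)) (hD0 : f (D 0) = 0)
    (hpar : ∀ m < N, ∀ x ∈ heckeAdjoin k e t {i | i < N ∧ i ≠ m}, f x = 0)
    {x : R} (hx : x ∈ heckeAdjoin k e t (Set.Iio N)) : f x = 0 := by
  suffices h : ∀ m ≤ N, ∀ h ∈ heckeAdjoin k e t (Set.Iio m), f (h * D m) = 0 by
    have := h N le_rfl x hx
    rwa [hDN, H.mul_e le_rfl hx] at this
  intro m
  induction m with
  | zero =>
    intro hN h hh
    have : D 0 = e * D 0 := by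
      rcases Nat.eq_zero_or_pos N with rfl | hN
      · rw [hDN, H.idem]
      · rw [hD 0 hN, ← mul_assoc, H.left 0 hN]
    have hh' : ∃ c : k, h = c • e := by
      induction hh using NonUnitalAlgebra.adjoin_induction with
      | mem x hx =>
        obtain rfl | ⟨i, hi, rfl⟩ := hx
        · exact ⟨1, (one_smul _ _).symm⟩
        · exact absurd hi (Nat.not_lt_zero i)
      | add x y _ _ hx hy =>
        obtain ⟨c, rfl⟩ := hx
        obtain ⟨d, rfl⟩ := hy
        exact ⟨c + d, (add_smul _ _ _).symm⟩
      | zero => exact ⟨0, (zero_smul _ _).symm⟩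
      | mul x y _ _ hx hy =>
        obtain ⟨c, rfl⟩ := hx
        obtain ⟨d, rfl⟩ := hy
        exact ⟨c * d, by rw [smul_mul_smul_comm, H.idem]⟩
      | smul c x _ hx =>
        obtain ⟨d, rfl⟩ := hx
        exact ⟨c * d, smul_smul _ _ _⟩
    obtain ⟨c, rfl⟩ := hh'
    rw [smul_mul_assoc, ← this, map_smul, hD0, smul_zero]
  | succ m ih =>
    intro hm h hh
    refine twoStep_induction (p := fun h => f (h * D (m + 1)) = 0) ?_ ?_ ?_ ?_
      (H.mem_twoStep hm hh)
    · intro a ha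
      refine hpar m hm _ (mul_mem (heckeAdjoin_mono (fun i hi => ?_) ha) ?_)
      · exact ⟨(Set.mem_Iio.1 hi).trans hm, (Set.mem_Iio.1 hi).ne⟩
      · exact H.descending_mem hDN hD m.lt_succ_self hm
    · intro a ha b hb
      rw [mul_assoc, (H.commute_descending hDN hD m.lt_succ_self hm hb).eq, ← mul_assoc, hf,
        mul_assoc a, ← hD m hm, ← mul_assoc]
      exact ih (Nat.le_of_lt hm) _ (mul_mem hb ha)
    · intro x y hx hy
      rw [add_mul, map_add, hx, hy, add_zero]
    · intro c x hx
      rw [smul_mul_assoc, map_smul, hx, smul_zero]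

end HeckeRelations
end Hecke

section GroupAlgebra

variable {G k : Type} [Group G] [Field k]

/-- The linear extension of a function on a group to the group algebra. -/
def linExt (f : G → k) : MonoidAlgebra k G →ₗ[k] k := (MonoidAlgebra.basis G k).constr k f

theorem linExt_of (f : G → k) (g : G) : linExt f (MonoidAlgebra.of k G g) = f g :=
  (MonoidAlgebra.basis G k).constr_basis k f g

theorem linExt_comm {f : G → k} (hf : ∀ g h, f (g * h) = f (h * g)) (x y : MonoidAlgebra k G) :
    linExt f (x * y) = linExt f (y * x) := by
  induction x using MonoidAlgebra.induction_on with
  | of g =>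
    induction y using MonoidAlgebra.induction_on with
    | of h => rw [← map_mul, ← map_mul, linExt_of, linExt_of, hf]
    | add x y hx hy => rw [mul_add, add_mul, map_add, map_add, hx, hy]
    | smul c x hx => rw [mul_smul_comm, smul_mul_assoc, map_smul, map_smul, hx]
  | add x y hx hy => rw [mul_add, add_mul, map_add, map_add, hx, hy]
  | smul c x hx => rw [mul_smul_comm, smul_mul_assoc, map_smul, map_smul, hx]

variable (k) in
/-- The average of the elements of a subgroup, in the group algebra. -/
def idem (B : Subgroup G) [Fintype B] : MonoidAlgebra k G :=
  (Fintype.card B : k)⁻¹ • ∑ b : B, MonoidAlgebra.of k G b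

variable {B : Subgroup G} [Fintype B]

theorem idem_mul_of {b : G} (hb : b ∈ B) : idem k B * MonoidAlgebra.of k G b = idem k B := by
  rw [idem, smul_mul_assoc, Finset.sum_mul]
  simp only [← map_mul]
  rw [← Equiv.sum_comp (Equiv.mulRight (⟨b, hb⟩ : B)) fun b => MonoidAlgebra.of k G (b : G)]
  rfl

theorem of_mul_idem {b : G} (hb : b ∈ B) : MonoidAlgebra.of k G b * idem k B = idem k B := by
  rw [idem, mul_smul_comm, Finset.mul_sum]
  simp only [← map_mul]
  rw [← Equiv.sum_comp (Equiv.mulLeft (⟨b, hb⟩ : B)) fun b => MonoidAlgebra.of k G (b : G)]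
  rfl

theorem mul_idem_mul_mem (V : Submodule k (MonoidAlgebra k G)) {x y : MonoidAlgebra k G}
    (h : ∀ b ∈ B, x * MonoidAlgebra.of k G b * y ∈ V) : x * idem k B * y ∈ V := by
  rw [idem, mul_smul_comm, smul_mul_assoc, Finset.mul_sum, Finset.sum_mul]
  exact V.smul_mem _ (sum_mem fun b _ => h b b.2)

theorem mul_idem_mul_eq (hB : (Fintype.card B : k) ≠ 0) {x y z : MonoidAlgebra k G}
    (h : ∀ b ∈ B, x * MonoidAlgebra.of k G b * y = z) : x * idem k B * y = z := by
  have h' : ∀ b : B, x * MonoidAlgebra.of k G b * y = z := fun b => h b b.2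
  rw [idem, mul_smul_comm, smul_mul_assoc, Finset.mul_sum, Finset.sum_mul,
    Finset.sum_congr rfl fun b _ => h' b, Finset.sum_const, Finset.card_univ,
    ← Nat.cast_smul_eq_nsmul k, smul_smul, inv_mul_cancel₀ hB, one_smul]

theorem idem_mul_idem (hB : (Fintype.card B : k) ≠ 0) : idem k B * idem k B = idem k B := by
  have := mul_idem_mul_eq hB (x := (1 : MonoidAlgebra k G)) (y := idem k B) (z := idem k B)
    fun b hb => by rw [one_mul, of_mul_idem hb]
  rwa [one_mul] at this

theorem linExt_of_mul_idem (f : G → k) (g : G) :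
    linExt f (MonoidAlgebra.of k G g * idem k B) =
      (Fintype.card B : k)⁻¹ * ∑ b : B, f (g * b) := by
  rw [idem, mul_smul_comm, map_smul, Finset.mul_sum, map_sum, smul_eq_mul]
  simp only [← map_mul, linExt_of]

variable (k B) in
/-- The element of the Hecke algebra attached to the double coset of `g`. -/
def dbl (g : G) : MonoidAlgebra k G := idem k B * MonoidAlgebra.of k G g * idem k B

theorem dbl_mul_mul {b b' : G} (g : G) (hb : b ∈ B) (hb' : b' ∈ B) :
    dbl k B (b * g * b') = dbl k B g := by
  rw [dbl, map_mul, map_mul, ← mul_assoc, ← mul_assoc, idem_mul_of hb, mul_assoc, of_mul_idem hb',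
    dbl]

theorem dbl_mul_right {b : G} (g : G) (hb : b ∈ B) : dbl k B (g * b) = dbl k B g := by
  rw [← dbl_mul_mul g (one_mem B) hb, one_mul]

theorem dbl_one (hB : (Fintype.card B : k) ≠ 0) : dbl k B (1 : G) = idem k B := by
  rw [dbl, map_one, mul_one, idem_mul_idem hB]

theorem dbl_of_mem (hB : (Fintype.card B : k) ≠ 0) {b : G} (hb : b ∈ B) :
    dbl k B b = idem k B := by
  rw [← dbl_one hB, ← dbl_mul_right 1 hb, one_mul]

theorem idem_mul_dbl (hB : (Fintype.card B : k) ≠ 0) (g : G) :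
    idem k B * dbl k B g = dbl k B g := by
  rw [dbl, ← mul_assoc, ← mul_assoc, idem_mul_idem hB]

theorem dbl_mul_idem (hB : (Fintype.card B : k) ≠ 0) (g : G) :
    dbl k B g * idem k B = dbl k B g := by
  rw [dbl, mul_assoc, idem_mul_idem hB]

theorem dbl_mul_dbl (hB : (Fintype.card B : k) ≠ 0) (g h : G) :
    dbl k B g * dbl k B h =
      (idem k B * MonoidAlgebra.of k G g) * idem k B * (MonoidAlgebra.of k G h * idem k B) := by
  simp only [dbl, mul_assoc]
  rw [← mul_assoc (idem k B) (idem k B), idem_mul_idem hB]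

theorem dbl_mul_dbl_mem (hB : (Fintype.card B : k) ≠ 0) (V : Submodule k (MonoidAlgebra k G))
    {g h : G} (H : ∀ b ∈ B, dbl k B (g * b * h) ∈ V) : dbl k B g * dbl k B h ∈ V := by
  rw [dbl_mul_dbl hB]
  refine mul_idem_mul_mem V fun b hb => ?_
  have := H b hb
  simpa only [dbl, map_mul, mul_assoc] using this

theorem dbl_mul_dbl_eq (hB : (Fintype.card B : k) ≠ 0) {g h x : G}
    (H : ∀ b ∈ B, dbl k B (g * b * h) = dbl k B x) :
    dbl k B g * dbl k B h = dbl k B x := by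
  rw [dbl_mul_dbl hB]
  refine mul_idem_mul_eq hB fun b hb => ?_
  have := H b hb
  simpa only [dbl, map_mul, mul_assoc] using this

theorem linExt_dbl (hB : (Fintype.card B : k) ≠ 0) {f : G → k}
    (hf : ∀ g h, f (g * h) = f (h * g)) (g : G) :
    linExt f (dbl k B g) = (Fintype.card B : k)⁻¹ * ∑ b : B, f (g * b) := by
  rw [dbl, linExt_comm hf, ← mul_assoc, idem_mul_idem hB, linExt_comm hf, linExt_of_mul_idem]

end GroupAlgebra

section Elementary

variable {ι F : Type} [Fintype ι] [DecidableEq ι] [Field F]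

theorem borel_apply_self_ne_zero {σ : ι → ℕ} (hσ : Function.Injective σ) {b : GL ι F}
    (hb : b ∈ borel F σ) (i : ι) : (b : Matrix ι ι F) i i ≠ 0 := by
  have h1 : ((b * b⁻¹ : GL ι F) : Matrix ι ι F) i i = 1 := by simp
  rw [Units.val_mul, Matrix.mul_apply, Finset.sum_eq_single i] at h1
  · exact left_ne_zero_of_mul_eq_one h1
  · intro j _ hj
    rcases lt_or_gt_of_ne (hσ.ne hj) with h | h
    · rw [mem_borel.1 hb _ _ h, zero_mul]
    · rw [mem_borel.1 (inv_mem hb) _ _ h, mul_zero]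
  · simp

/-- An elementary matrix, as an invertible matrix. -/
def elemGL {i j : ι} (h : i ≠ j) (v : F) : GL ι F :=
  transv (Pi.single i v) (Pi.single j 1) (by simp [h])

theorem elemGL_apply {i j : ι} (h : i ≠ j) (v : F) (a c : ι) :
    (elemGL h v : Matrix ι ι F) a c =
      (1 : Matrix ι ι F) a c + if a = i ∧ c = j then v else 0 := by
  rw [elemGL, transv_val, Matrix.add_apply, vecMulVec_apply]
  congr 1
  by_cases h1 : a = i <;> by_cases h2 : c = j <;> simp [h1, h2]

theorem elemGL_mem_borel {i j : ι} (h : i ≠ j) (v : F) {σ : ι → ℕ} (hσ : σ i < σ j) :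
    elemGL h v ∈ borel F σ := by
  rw [mem_borel]
  intro a c hac
  rw [elemGL_apply, if_neg, add_zero, Matrix.one_apply_ne]
  · rintro rfl
    exact lt_irrefl _ hac
  · rintro ⟨rfl, rfl⟩
    exact lt_asymm hac hσ

theorem elemGL_mul_apply {i j : ι} (h : i ≠ j) (v : F) (x : Matrix ι ι F) (a c : ι) :
    ((elemGL h v : Matrix ι ι F) * x) a c = x a c + if a = i then v * x j c else 0 := by
  rw [elemGL, transv_mul_apply]
  by_cases h1 : a = i <;> simp [h1]

theorem mul_elemGL_apply {i j : ι} (h : i ≠ j) (v : F) (x : Matrix ι ι F) (a c : ι) :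
    (x * (elemGL h v : Matrix ι ι F)) a c = x a c + if c = j then x a i * v else 0 := by
  rw [elemGL, mul_transv_apply]
  by_cases h1 : c = j <;> simp [h1]

end Elementary

section Products

variable {N : ℕ} {F k : Type} [Field F] [Field k] [Fintype F] [DecidableEq F]

/-- The order of the indices of square matrices of size `N + 1`. -/
abbrev stdOrder (N : ℕ) : Fin (N + 1) → ℕ := Fin.val

variable (k F) in
/-- The Hecke algebra element of a permutation. -/
def heckePerm (w : Equiv.Perm (Fin (N + 1))) : MonoidAlgebra k (GL (Fin (N + 1)) F) :=
  dbl k (borel F (stdOrder N)) (permGL F w)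

theorem heckePerm_swap_mul (hB : (Fintype.card (borel F (stdOrder N)) : k) ≠ 0)
    {i j : Fin (N + 1)} (hij : (j : ℕ) = i + 1) {w : Equiv.Perm (Fin (N + 1))}
    (hw : w⁻¹ i < w⁻¹ j) :
    heckePerm F k (Equiv.swap i j) * heckePerm F k w = heckePerm F k (Equiv.swap i j * w) := by
  have hne : i ≠ j := by
    rintro rfl
    omega
  refine dbl_mul_dbl_eq hB fun b hb => ?_
  set v : F := (b : Matrix (Fin (N + 1)) (Fin (N + 1)) F) i j /
    (b : Matrix (Fin (N + 1)) (Fin (N + 1)) F) i i with hv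
  have hu : (elemGL hne (-v))⁻¹ ∈ borel F (stdOrder N ∘ ⇑w⁻¹) :=
    inv_mem (elemGL_mem_borel hne _ hw)
  have hu' : permGL F w⁻¹ * (elemGL hne (-v))⁻¹ * (permGL F w⁻¹)⁻¹ ∈ borel F (stdOrder N) :=
    (permGL_conj_mem_borel _).2 hu
  have hb' : b * elemGL hne (-v) ∈ borel F (stdOrder N ∘ Equiv.swap i j) := by
    rw [mem_borel]
    intro a c hac
    rw [Units.val_mul, mul_elemGL_apply]
    have hb0 := mem_borel.1 hb a c
    by_cases h1 : a = i ∧ c = j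
    · obtain ⟨rfl, rfl⟩ := h1
      rw [if_pos rfl, hv]
      field_simp [borel_apply_self_ne_zero Fin.val_injective hb a]
      ring
    · have hca : (c : ℕ) < a := by
        simp only [Function.comp, stdOrder, Equiv.swap_apply_def] at hac
        simp only [Fin.ext_iff] at h1 hac hne
        split_ifs at hac <;> omega
      rw [hb0 hca, zero_add, ite_eq_right_iff]
      rintro rfl
      rw [mem_borel.1 hb a i (by simp only [stdOrder]; omega), zero_mul]
  have hb'' := (permGL_conj_mem_borel (σ := stdOrder N) (Equiv.swap i j)).2 hb'
  rw [permGL_mul, ← dbl_mul_mul (permGL F (Equiv.swap i j) * permGL F w) hb'' hu']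
  congr 1
  rw [permGL_inv]
  group

theorem dbl_swap_conj (hB : (Fintype.card (borel F (stdOrder N)) : k) ≠ 0)
    {i j : Fin (N + 1)} (hij : (j : ℕ) = i + 1) {g : GL (Fin (N + 1)) F}
    (hg : ∀ a c, c < a → ¬ (a = j ∧ c = i) →
      (g : Matrix (Fin (N + 1)) (Fin (N + 1)) F) a c = 0) :
    dbl k (borel F (stdOrder N)) g ∈
      Submodule.span k {idem k (borel F (stdOrder N)), heckePerm F k (Equiv.swap i j)} := by
  have hne : i ≠ j := by
    rintro rfl
    omega
  by_cases h0 : (g : Matrix (Fin (N + 1)) (Fin (N + 1)) F) j i = 0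
  · rw [dbl_of_mem hB]
    · exact Submodule.subset_span (Set.mem_insert _ _)
    · rw [mem_borel]
      intro a c hac
      by_cases h1 : a = j ∧ c = i
      · obtain ⟨rfl, rfl⟩ := h1
        exact h0
      · exact hg a c hac h1
  · set v : F := (g : Matrix (Fin (N + 1)) (Fin (N + 1)) F) i i /
      (g : Matrix (Fin (N + 1)) (Fin (N + 1)) F) j i with hv
    have hu : elemGL hne (-v) ∈ borel F (stdOrder N) :=
      elemGL_mem_borel hne _ (by simp only [stdOrder]; omega)
    have hb : permGL F (Equiv.swap i j) * (elemGL hne (-v) * g) ∈ borel F (stdOrder N) := by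
      rw [mem_borel]
      intro a c hac
      rw [Units.val_mul, permGL_mul_apply, Units.val_mul, elemGL_mul_apply, Equiv.symm_swap]
      rcases eq_or_ne a i with rfl | hai
      · rw [Equiv.swap_apply_left, if_neg hne.symm, add_zero]
        refine hg _ _ (Fin.lt_def.2 (by simp only [stdOrder] at hac; omega)) ?_
        rintro ⟨-, rfl⟩
        exact lt_irrefl _ hac
      · rcases eq_or_ne a j with rfl | haj
        · rw [Equiv.swap_apply_right, if_pos rfl]
          rcases eq_or_ne c i with rfl | hci
          · rw [hv]
            field_simp
            ring
          · have hci' : c < i := by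
              simp only [stdOrder, Ne, Fin.ext_iff, Fin.lt_def] at *
              omega
            rw [hg _ _ hci' (fun h => hci h.2), hg _ _ hac (fun h => hci h.2), mul_zero, add_zero]
        · rw [Equiv.swap_apply_of_ne_of_ne hai haj, if_neg hai, add_zero]
          exact hg _ _ hac fun h => haj h.1
    have hgeq : g = (elemGL hne (-v))⁻¹ * permGL F (Equiv.swap i j) *
        (permGL F (Equiv.swap i j) * (elemGL hne (-v) * g)) := by
      have : permGL F (Equiv.swap i j) * permGL F (Equiv.swap i j) = 1 := by
        rw [← permGL_mul, Equiv.swap_mul_self, permGL_one]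
      rw [mul_assoc, ← mul_assoc (permGL F (Equiv.swap i j)), this]
      group
    rw [hgeq, dbl_mul_mul _ (inv_mem hu) hb]
    exact Submodule.subset_span (Set.mem_insert_of_mem _ rfl)

theorem heckePerm_swap_sq (hB : (Fintype.card (borel F (stdOrder N)) : k) ≠ 0)
    {i j : Fin (N + 1)} (hij : (j : ℕ) = i + 1) :
    heckePerm F k (Equiv.swap i j) * heckePerm F k (Equiv.swap i j) ∈
      Submodule.span k {idem k (borel F (stdOrder N)), heckePerm F k (Equiv.swap i j)} := by
  refine dbl_mul_dbl_mem hB _ fun b hb => dbl_swap_conj hB hij fun a c hac h => ?_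
  rw [Units.val_mul, mul_permGL_apply, Units.val_mul, permGL_mul_apply, Equiv.symm_swap]
  refine mem_borel.1 hb _ _ ?_
  simp only [stdOrder, Fin.lt_def, Fin.ext_iff, Equiv.swap_apply_def] at *
  split_ifs <;> omega

end Products

section Coxeter

/-- The simple transpositions, indexed by natural numbers. -/
def simpleSwap (N i : ℕ) : Equiv.Perm (Fin (N + 1)) :=
  Equiv.swap (Fin.ofNat (N + 1) i) (Fin.ofNat (N + 1) (i + 1))

theorem val_ofNat_of_le {N i : ℕ} (hi : i ≤ N) : (Fin.ofNat (N + 1) i : ℕ) = i :=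
  Nat.mod_eq_of_lt (Nat.lt_succ_of_le hi)

theorem simpleSwap_val {N i : ℕ} (hi : i < N) (x : Fin (N + 1)) :
    (simpleSwap N i x : ℕ) = if (x : ℕ) = i then i + 1 else if (x : ℕ) = i + 1 then i else x := by
  have h1 := val_ofNat_of_le hi.le
  have h2 := val_ofNat_of_le (Nat.succ_le_of_lt hi)
  simp only [simpleSwap, Equiv.swap_apply_def, Fin.ext_iff, h1, h2]
  split_ifs <;> simp_all

theorem simpleSwap_inv (N i : ℕ) : (simpleSwap N i)⁻¹ = simpleSwap N i := Equiv.swap_inv _ _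

theorem simpleSwap_comm {N i j : ℕ} (hij : i + 1 < j) (hj : j < N) :
    simpleSwap N i * simpleSwap N j = simpleSwap N j * simpleSwap N i := by
  ext x
  simp only [Equiv.Perm.mul_apply, simpleSwap_val hj, simpleSwap_val (show i < N by omega)]
  split_ifs <;> omega

theorem simpleSwap_braid {N i : ℕ} (hi : i + 1 < N) :
    simpleSwap N i * (simpleSwap N (i + 1) * simpleSwap N i) =
      simpleSwap N (i + 1) * (simpleSwap N i * simpleSwap N (i + 1)) := by
  ext x
  simp only [Equiv.Perm.mul_apply, simpleSwap_val hi, simpleSwap_val (show i < N by omega)]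
  split_ifs <;> omega

/-- The product of the last `j` simple transpositions, in increasing order. -/
def coxeterTail (N : ℕ) : ℕ → Equiv.Perm (Fin (N + 1))
  | 0 => 1
  | j + 1 => simpleSwap N (N - 1 - j) * coxeterTail N j

theorem coxeterTail_val {N j : ℕ} (hj : j ≤ N) {x : Fin (N + 1)} (hx : (x : ℕ) < N) :
    (coxeterTail N j x : ℕ) = if (x : ℕ) < N - j then (x : ℕ) else x + 1 := by
  induction j with
  | zero => simp [coxeterTail, hx]
  | succ j ih =>
    rw [coxeterTail, Equiv.Perm.mul_apply, simpleSwap_val (by omega), ih (by omega)]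
    split_ifs <;> omega

theorem coxeterTail_inv_of_lt {N j : ℕ} (hj : j ≤ N) {x : Fin (N + 1)} (hx : (x : ℕ) < N - j) :
    (coxeterTail N j)⁻¹ x = x := by
  rw [Equiv.Perm.inv_eq_iff_eq]
  ext
  rw [coxeterTail_val hj (by omega), if_pos hx]

end Coxeter

section HeckeGL

variable {N : ℕ} {F k : Type} [Field F] [Field k] [Fintype F] [DecidableEq F]

theorem heckePerm_simpleSwap_mul (hB : (Fintype.card (borel F (stdOrder N)) : k) ≠ 0)
    {i : ℕ} (hi : i < N) {w : Equiv.Perm (Fin (N + 1))}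
    (hw : w⁻¹ (Fin.ofNat (N + 1) i) < w⁻¹ (Fin.ofNat (N + 1) (i + 1))) :
    heckePerm F k (simpleSwap N i) * heckePerm F k w = heckePerm F k (simpleSwap N i * w) :=
  heckePerm_swap_mul hB (by rw [val_ofNat_of_le hi.le, val_ofNat_of_le (Nat.succ_le_of_lt hi)]) hw

theorem heckePerm_one (hB : (Fintype.card (borel F (stdOrder N)) : k) ≠ 0) :
    heckePerm F k (1 : Equiv.Perm (Fin (N + 1))) = idem k (borel F (stdOrder N)) := by
  rw [heckePerm, permGL_one, dbl_one hB]

theorem heckeRelations (hB : (Fintype.card (borel F (stdOrder N)) : k) ≠ 0) :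
    HeckeRelations k (idem k (borel F (stdOrder N)))
      (fun i => heckePerm F k (simpleSwap N i)) N where
  idem := idem_mul_idem hB
  left _ _ := idem_mul_dbl hB _
  right _ _ := dbl_mul_idem hB _
  sq i hi := heckePerm_swap_sq hB
    (by rw [val_ofNat_of_le hi.le, val_ofNat_of_le (Nat.succ_le_of_lt hi)])
  comm i j hij hj := by
    have hi : i < N := by omega
    have h1 := val_ofNat_of_le hi.le
    have h2 := val_ofNat_of_le (Nat.succ_le_of_lt hi)
    have h3 := val_ofNat_of_le hj.le
    have h4 := val_ofNat_of_le (Nat.succ_le_of_lt hj)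
    change heckePerm F k (simpleSwap N i) * heckePerm F k (simpleSwap N j) =
      heckePerm F k (simpleSwap N j) * heckePerm F k (simpleSwap N i)
    rw [heckePerm_simpleSwap_mul hB hi, heckePerm_simpleSwap_mul hB hj, simpleSwap_comm hij hj]
    · rw [simpleSwap_inv, Fin.lt_def, simpleSwap_val hi, simpleSwap_val hi, h3, h4]
      split_ifs <;> omega
    · rw [simpleSwap_inv, Fin.lt_def, simpleSwap_val hj, simpleSwap_val hj, h1, h2]
      split_ifs <;> omega
  braid i hi := by
    have hi' : i < N := by omega
    have h1 := val_ofNat_of_le hi'.le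
    have h2 := val_ofNat_of_le hi.le
    have h3 := val_ofNat_of_le (Nat.succ_le_of_lt hi)
    change heckePerm F k (simpleSwap N i) * heckePerm F k (simpleSwap N (i + 1)) *
      heckePerm F k (simpleSwap N i) = heckePerm F k (simpleSwap N (i + 1)) *
      heckePerm F k (simpleSwap N i) * heckePerm F k (simpleSwap N (i + 1))
    rw [mul_assoc, mul_assoc, heckePerm_simpleSwap_mul hB hi, heckePerm_simpleSwap_mul hB hi',
      heckePerm_simpleSwap_mul hB hi', heckePerm_simpleSwap_mul hB hi, simpleSwap_braid hi]
    all_goals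
      simp only [_root_.mul_inv_rev, Equiv.Perm.mul_apply, simpleSwap_inv, Fin.lt_def, simpleSwap_val hi,
        simpleSwap_val hi', h1, h2, h3]
      split_ifs <;> omega

theorem heckePerm_mem (hB : (Fintype.card (borel F (stdOrder N)) : k) ≠ 0)
    (w : Equiv.Perm (Fin (N + 1))) :
    heckePerm F k w ∈ heckeAdjoin k (idem k (borel F (stdOrder N)))
      (fun i => heckePerm F k (simpleSwap N i)) (Set.Iio N) := by
  classical
  by_contra hw
  let pot : Equiv.Perm (Fin (N + 1)) → ℕ := fun w => ∑ j : Fin (N + 1), (j : ℕ) * (w⁻¹ j : ℕ)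
  obtain ⟨w, hw, hmax⟩ := Finset.exists_max_image (Finset.univ.filter fun w => heckePerm F k w ∉
    heckeAdjoin k (idem k (borel F (stdOrder N)))
      (fun i => heckePerm F k (simpleSwap N i)) (Set.Iio N)) pot
    ⟨w, Finset.mem_filter.2 ⟨Finset.mem_univ _, hw⟩⟩
  rw [Finset.mem_filter] at hw
  replace hw := hw.2
  by_cases h1 : ∀ i : Fin N, w⁻¹ i.castSucc < w⁻¹ i.succ
  · have : w = 1 := inv_eq_one.1 (perm_eq_one_of_lt_succ h1)
    rw [this, heckePerm_one hB] at hw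
    exact hw e_mem_heckeAdjoin
  · push Not at h1
    obtain ⟨i, hi⟩ := h1
    have e1 : Fin.ofNat (N + 1) i = i.castSucc := Fin.ext (val_ofNat_of_le i.2.le)
    have e2 : Fin.ofNat (N + 1) (i + 1) = i.succ := Fin.ext (val_ofNat_of_le i.2)
    have hi' : w⁻¹ i.succ < w⁻¹ i.castSucc := lt_of_le_of_ne hi fun h => by
      have := w⁻¹.injective h
      simp [Fin.ext_iff] at this
    have h2 : simpleSwap N i * (simpleSwap N i * w) = w := by
      rw [← mul_assoc, simpleSwap, Equiv.swap_mul_self, one_mul]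
    have hs1 : simpleSwap N i i.castSucc = i.succ := by
      rw [simpleSwap, e1, e2, Equiv.swap_apply_left]
    have hs2 : simpleSwap N i i.succ = i.castSucc := by
      rw [simpleSwap, e1, e2, Equiv.swap_apply_right]
    have h3 := heckePerm_simpleSwap_mul (F := F) hB i.2 (w := simpleSwap N i * w) (by
      rwa [e1, e2, _root_.mul_inv_rev, Equiv.Perm.mul_apply, Equiv.Perm.mul_apply, simpleSwap_inv, hs1,
        hs2])
    rw [h2] at h3
    have h4 : heckePerm F k (simpleSwap N i * w) ∈ heckeAdjoin k (idem k (borel F (stdOrder N)))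
        (fun i => heckePerm F k (simpleSwap N i)) (Set.Iio N) := by
      by_contra h4
      have h5 := hmax _ (Finset.mem_filter.2 ⟨Finset.mem_univ _, h4⟩)
      refine absurd h5 (not_le.2 ?_)
      simp only [pot]
      have hne : i.castSucc ≠ i.succ := by simp [Fin.ext_iff]
      rw [← Finset.add_sum_erase _ _ (Finset.mem_univ i.castSucc),
        ← Finset.add_sum_erase _ _ (Finset.mem_univ i.castSucc),
        ← Finset.add_sum_erase _ _ (Finset.mem_erase.2 ⟨hne.symm, Finset.mem_univ i.succ⟩),
        ← Finset.add_sum_erase _ _ (Finset.mem_erase.2 ⟨hne.symm, Finset.mem_univ i.succ⟩)]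
      have h6 : ∀ j, (simpleSwap N i * w)⁻¹ j = w⁻¹ (simpleSwap N i j) := fun j => by
        rw [_root_.mul_inv_rev, Equiv.Perm.mul_apply, simpleSwap_inv]
      simp only [h6]
      rw [hs1, hs2, ← add_assoc, ← add_assoc]
      refine add_lt_add_of_lt_of_le ?_ (Finset.sum_le_sum fun j hj => ?_)
      · have h7 : (w⁻¹ i.succ : ℕ) < w⁻¹ i.castSucc := hi'
        simp only [Fin.val_castSucc, Fin.val_succ]
        nlinarith
      · rw [Finset.mem_erase, Finset.mem_erase] at hj
        rw [simpleSwap, e1, e2, Equiv.swap_apply_of_ne_of_ne hj.2.1 hj.1]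
    exact hw (h3 ▸ mul_mem (t_mem_heckeAdjoin i.2) h4)

theorem heckePerm_coxeterTail (hB : (Fintype.card (borel F (stdOrder N)) : k) ≠ 0) {m : ℕ}
    (hm : m < N) : heckePerm F k (coxeterTail N (N - m)) =
      heckePerm F k (simpleSwap N m) * heckePerm F k (coxeterTail N (N - (m + 1))) := by
  obtain ⟨j, hj⟩ : ∃ j, N - (m + 1) = j := ⟨_, rfl⟩
  have h1 : N - m = j + 1 := by omega
  have h2 : N - 1 - j = m := by omega
  rw [hj, h1, coxeterTail, h2, heckePerm_simpleSwap_mul hB hm]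
  have h3 := coxeterTail_inv_of_lt (N := N) (j := j) (by omega)
    (x := Fin.ofNat (N + 1) m) (by rw [val_ofNat_of_le hm.le]; omega)
  rw [h3]
  by_contra h4
  rw [not_lt] at h4
  have h5 := coxeterTail_inv_of_lt (N := N) (j := j) (by omega)
    (x := (coxeterTail N j)⁻¹ (Fin.ofNat (N + 1) (m + 1))) (by
      have := Fin.le_def.1 h4
      rw [val_ofNat_of_le hm.le] at this
      omega)
  have h6 := (coxeterTail N j)⁻¹.injective h5
  rw [h6, Fin.le_def, val_ofNat_of_le hm.le, val_ofNat_of_le (Nat.succ_le_of_lt hm)] at h4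
  omega

theorem isCyclic_of_hessenberg {g : GL (Fin (N + 1)) F}
    (h0 : ∀ (i : Fin N) (j : Fin (N + 1)), j < i.castSucc →
      (g : Matrix (Fin (N + 1)) (Fin (N + 1)) F) i.succ j = 0)
    (h1 : ∀ i : Fin N, (g : Matrix (Fin (N + 1)) (Fin (N + 1)) F) i.succ i.castSucc ≠ 0) :
    IsCyclic (Pi.single (Fin.last N) 1) g := by
  have key : ∀ (i : Fin (N + 1)) (x : Fin (N + 1) → F),
      (∀ j : ℕ, Pi.single (Fin.last N) 1 ⬝ᵥ ((g ^ j : GL (Fin (N + 1)) F) :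
        Matrix (Fin (N + 1)) (Fin (N + 1)) F) *ᵥ x = 0) → ∀ j, i ≤ j → x j = 0 := by
    intro i
    induction i using Fin.reverseInduction with
    | last =>
      intro x hx j hj
      rw [Fin.last_le_iff.1 hj]
      simpa using hx 0
    | cast i ih =>
      intro x hx j hj
      rcases eq_or_lt_of_le hj with rfl | hj
      · have h2 := ih ((g : Matrix (Fin (N + 1)) (Fin (N + 1)) F) *ᵥ x) (fun j => by
          rw [← pow_succ_mulVec', hx]) i.succ le_rfl
        rw [mulVec, dotProduct, Finset.sum_eq_single i.castSucc] at h2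
        · exact (mul_eq_zero.1 h2).resolve_left (h1 i)
        · intro j _ hj
          rcases lt_or_gt_of_ne hj with h | h
          · rw [h0 i j h, zero_mul]
          · rw [ih x hx j (Fin.castSucc_lt_iff_succ_le.1 h), mul_zero]
        · simp
      · exact ih x hx j (Fin.castSucc_lt_iff_succ_le.1 hj)
  intro x hx
  ext j
  exact key 0 x hx j (Fin.zero_le j)

end HeckeGL

section Parabolic

variable {F k : Type} [Field F] [Field k] [Fintype F] [DecidableEq F]
  {ι κ α β : Type} [Fintype ι] [DecidableEq ι] [Fintype κ] [DecidableEq κ]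
  [Fintype α] [DecidableEq α] [Fintype β] [DecidableEq β]

theorem sum_borel_reindex (e : ι ≃ κ) (σ : κ → ℕ) (h : GL κ F → k) :
    ∑ b : borel F (σ ∘ e), h (reindexGL F e b) = ∑ b : borel F σ, h b := by
  refine Fintype.sum_equiv ((reindexGL F e).toEquiv.subtypeEquiv fun b => ?_) _ _ fun b => rfl
  exact reindexGL_mem_borel e (σ := σ) (g := b) |>.symm

theorem sum_borel_blk {p : ℕ} [CharP F p] {ρ : α ⊕ β → ℕ}
    (hρ : ∀ a b, ρ (Sum.inl a) < ρ (Sum.inr b)) {f : GL (α ⊕ β) F → k} (hf : IsGood p f)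
    (hα : ∀ f' : GL α F → k, IsGood p f' → ∀ g, ∑ b : borel F (ρ ∘ Sum.inl), f' (g * b) = 0)
    (hβ : ∀ f' : GL β F → k, IsGood p f' → ∀ g, ∑ b : borel F (ρ ∘ Sum.inr), f' (g * b) = 0)
    (l₁ : GL α F) (N : Matrix α β F) (l₂ : GL β F) :
    ∑ b : borel F ρ, f (blk l₁ N l₂ * b) = 0 := by
  let h : GL β F → k := fun l => ∑ b₁ : borel F (ρ ∘ Sum.inl), ∑ M, f (blk (l₁ * b₁) M l)
  have hh : IsGood p h :=
    { comm := fun x y => Finset.sum_congr rfl fun b₁ _ =>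
        (hf.toIsFlagClass.restrict_right (l₁ * b₁)).comm x y
      mem := by
        have : h = ∑ b₁ : borel F (ρ ∘ Sum.inl), fun l => ∑ M, f (blk (l₁ * b₁) M l) := by
          ext l
          rw [Finset.sum_apply]
        rw [this]
        exact sum_mem fun b₁ _ => (hf.toIsFlagClass.restrict_right (l₁ * b₁)).mem
      vanish := fun l hl => hα _ (hf.restrict_left hl) l₁ }
  have h1 := hβ h hh l₂
  rw [← h1]
  let φ : borel F (ρ ∘ Sum.inr) × borel F (ρ ∘ Sum.inl) × Matrix α β F → borel F ρ :=
    fun x => ⟨blk x.2.1 x.2.2 x.1, (blk_mem_borel hρ).2 ⟨x.2.1.2, x.1.2⟩⟩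
  have hφ : Function.Bijective φ := by
    constructor
    · rintro ⟨b₂, b₁, M⟩ ⟨b₂', b₁', M'⟩ h
      obtain ⟨h1, h2, h3⟩ := blk_injective (congrArg Subtype.val h)
      simp only [Prod.mk.injEq]
      exact ⟨Subtype.ext h3, Subtype.ext h1, h2⟩
    · rintro ⟨b, hb⟩
      obtain ⟨b₁, M, b₂, rfl⟩ := exists_eq_blk_of_mem_borel hρ hb
      obtain ⟨h1, h2⟩ := (blk_mem_borel hρ).1 hb
      exact ⟨⟨⟨b₂, h2⟩, ⟨b₁, h1⟩, M⟩, rfl⟩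
  rw [← Function.Bijective.sum_comp hφ fun b => f (blk l₁ N l₂ * b), Fintype.sum_prod_type]
  refine Finset.sum_congr rfl fun b₂ _ => ?_
  rw [Fintype.sum_prod_type]
  refine Finset.sum_congr rfl fun b₁ _ => ?_
  rw [← sum_affine (fun M => f (blk (l₁ * b₁) M (l₂ * b₂))) l₁ 1 (N * ((b₂ : GL β F) : Matrix β β F))]
  refine Finset.sum_congr rfl fun M _ => ?_
  simp only [φ, blk_mul]
  simp

end Parabolic

section Span

variable {G k : Type} [Group G] [Field k] {B : Subgroup G} [Fintype B]

theorem heckeAdjoin_le_span (hB : (Fintype.card B : k) ≠ 0) {Q : Subgroup G} (hBQ : B ≤ Q)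
    {w : ℕ → G} {S : Set ℕ} (hw : ∀ i ∈ S, w i ∈ Q) {x : MonoidAlgebra k G}
    (hx : x ∈ heckeAdjoin k (idem k B) (fun i => dbl k B (w i)) S) :
    x ∈ Submodule.span k (dbl k B '' Q) := by
  let P : NonUnitalSubalgebra k (MonoidAlgebra k G) :=
    { Submodule.span k (dbl k B '' Q) with
      mul_mem' := by
        intro x y hx hy
        change x ∈ Submodule.span k (dbl k B '' Q) at hx
        change y ∈ Submodule.span k (dbl k B '' Q) at hy
        change x * y ∈ Submodule.span k (dbl k B '' Q)
        induction hx using Submodule.span_induction with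
        | mem x hx =>
          induction hy using Submodule.span_induction with
          | mem y hy =>
            obtain ⟨g, hg, rfl⟩ := hx
            obtain ⟨h, hh, rfl⟩ := hy
            exact dbl_mul_dbl_mem hB _ fun b hb => Submodule.subset_span
              ⟨_, mul_mem (mul_mem hg (hBQ hb)) hh, rfl⟩
          | zero => rw [mul_zero]; exact zero_mem _
          | add y z _ _ hy hz => rw [mul_add]; exact add_mem hy hz
          | smul c y _ hy => rw [mul_smul_comm]; exact Submodule.smul_mem _ _ hy
        | zero => rw [zero_mul]; exact zero_mem _
        | add y z _ _ hy hz => rw [add_mul]; exact add_mem hy hz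
        | smul c y _ hy => rw [smul_mul_assoc]; exact Submodule.smul_mem _ _ hy }
  have h1 : heckeAdjoin k (idem k B) (fun i => dbl k B (w i)) S ≤ P := by
    refine heckeAdjoin_le ?_ fun i hi => ?_
    · rw [← dbl_one hB]
      exact Submodule.subset_span ⟨1, one_mem Q, rfl⟩
    · exact Submodule.subset_span ⟨w i, hw i hi, rfl⟩
  exact h1 hx

end Span

section Borel

variable {F k : Type} [Field F] [Field k] [Fintype F] [DecidableEq F]

theorem sum_borel_parabolic {p : ℕ} [CharP F p] {N m : ℕ}
    (ih : ∀ (ι : Type) [Fintype ι] [DecidableEq ι], Fintype.card ι < N + 1 → ∀ σ : ι → ℕ,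
      Function.Injective σ → ∀ f' : GL ι F → k, IsGood p f' → ∀ g,
        ∑ b : borel F σ, f' (g * b) = 0) (hm : m < N)
    {f : GL (Fin (N + 1)) F → k} (hf : IsGood p f) {g : GL (Fin (N + 1)) F}
    (hg : g ∈ borel F fun i : Fin (N + 1) => if (i : ℕ) ≤ m then 0 else 1) :
    ∑ b : borel F (stdOrder N), f (g * b) = 0 := by
  let e : Fin (N + 1) ≃ {i : Fin (N + 1) // (i : ℕ) ≤ m} ⊕ {i : Fin (N + 1) // ¬ (i : ℕ) ≤ m} :=
    (Equiv.sumCompl _).symm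
  let ρ : {i : Fin (N + 1) // (i : ℕ) ≤ m} ⊕ {i : Fin (N + 1) // ¬ (i : ℕ) ≤ m} → ℕ :=
    stdOrder N ∘ e.symm
  have hρe : stdOrder N = ρ ∘ e := by
    ext i
    simp [ρ]
  have hρi : Function.Injective ρ := Fin.val_injective.comp e.symm.injective
  have hρ : ∀ a b, ρ (Sum.inl a) < ρ (Sum.inr b) := by
    rintro ⟨a, ha⟩ ⟨b, hb⟩
    exact lt_of_le_of_lt ha (not_le.1 hb)
  have hf' := hf.reindex e.symm
  obtain ⟨l₁, M, l₂, hl⟩ := exists_eq_blk (reindexGL F e g) (fun i j => by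
    rw [reindexGL_apply]
    refine mem_borel.1 hg _ _ ?_
    have hi := i.2
    have hj := j.2
    have h1 : e.symm (Sum.inr i) = i.1 := rfl
    have h2 : e.symm (Sum.inl j) = j.1 := rfl
    rw [h1, h2, if_pos hj, if_neg hi]
    exact one_pos)
  have h1 := sum_borel_blk hρ hf'
    (fun f' hf' g => ih _ (by
      refine lt_of_lt_of_eq ?_ (Fintype.card_fin (N + 1))
      exact Fintype.card_subtype_lt (p := fun i : Fin (N + 1) => (i : ℕ) ≤ m) (x := Fin.last N)
        (by simpa using hm)) _
      (hρi.comp Sum.inl_injective) f' hf' g)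
    (fun f' hf' g => ih _ (by
      refine lt_of_lt_of_eq ?_ (Fintype.card_fin (N + 1))
      exact Fintype.card_subtype_lt (p := fun i : Fin (N + 1) => ¬ (i : ℕ) ≤ m) (x := 0)
        (by simp)) _
      (hρi.comp Sum.inr_injective) f' hf' g) l₁ M l₂
  rw [← sum_borel_reindex e ρ fun b => f (reindexGL F e.symm (blk l₁ M l₂ * b)), ← hρe] at h1
  have h2 : ∀ x, reindexGL F e.symm (reindexGL F e x) = x := fun x => by
    ext i j
    simp [reindexGL_apply]
  rw [← h1]
  refine Finset.sum_congr rfl fun b _ => ?_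
  rw [← hl, ← map_mul, h2]

theorem sum_coxeter_mul {p : ℕ} [Fact p.Prime] [CharP F p] (hp : (p : k) ≠ 0)
    {ψ : AddChar F k} {a : F} (hψ : ψ a ≠ 1) {N : ℕ} {f : GL (Fin (N + 1)) F → k}
    (hf : IsGood p f) :
    ∑ b : borel F (stdOrder N), f (permGL F (coxeterTail N N) * b) = 0 := by
  have hle : transvections (Pi.single (Fin.last N) (1 : F)) ≤ borel F (stdOrder N) := by
    rintro _ ⟨c, h, rfl⟩
    rw [mem_borel]
    intro i j hij
    rw [transv_val, Matrix.add_apply, vecMulVec_apply, Matrix.one_apply_ne (by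
      rintro rfl
      exact lt_irrefl _ hij), Pi.single_eq_of_ne (by
      rintro rfl
      exact absurd i.2 (by simp only [stdOrder, Fin.val_last] at hij; omega)), mul_zero, add_zero]
  refine sum_eq_zero_of_hom (Subgroup.inclusion hle) _
    (card_ne_zero_of_isPElement hp isPElement_transvections) fun b => ?_
  have hc : ∀ i : Fin N, coxeterTail N N i.castSucc = i.succ := fun i => by
    ext
    rw [coxeterTail_val le_rfl i.2]
    simp
  have hc' : ∀ i : Fin N, (coxeterTail N N).symm i.succ = i.castSucc := fun i => by
    rw [Equiv.symm_apply_eq, hc]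
  have h1 := transvSum_eq_zero_of_isCyclic hp hψ hf (l := Pi.single (Fin.last N) (1 : F))
    (by simp) (g := permGL F (coxeterTail N N) * b) (isCyclic_of_hessenberg
      (fun i j hij => by
        rw [Units.val_mul, permGL_mul_apply, hc']
        exact mem_borel.1 b.2 _ _ hij)
      (fun i => by
        rw [Units.val_mul, permGL_mul_apply, hc']
        exact borel_apply_self_ne_zero Fin.val_injective b.2 _))
  rw [← h1, transvSum]
  refine Finset.sum_congr rfl fun v _ => ?_
  rw [mul_assoc]
  rfl

theorem sum_borel_stdOrder {p : ℕ} [Fact p.Prime] [CharP F p] (hp : (p : k) ≠ 0)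
    {ψ : AddChar F k} {a : F} (hψ : ψ a ≠ 1) {N : ℕ}
    (hB : (Fintype.card (borel F (stdOrder N)) : k) ≠ 0)
    (ih : ∀ (ι : Type) [Fintype ι] [DecidableEq ι], Fintype.card ι < N + 1 → ∀ σ : ι → ℕ,
      Function.Injective σ → ∀ f' : GL ι F → k, IsGood p f' → ∀ g,
        ∑ b : borel F σ, f' (g * b) = 0)
    {f : GL (Fin (N + 1)) F → k} (hf : IsGood p f) (g : GL (Fin (N + 1)) F) :
    ∑ b : borel F (stdOrder N), f (g * b) = 0 := by
  suffices h : linExt f (dbl k (borel F (stdOrder N)) g) = 0 by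
    rw [linExt_dbl hB hf.comm] at h
    exact (mul_eq_zero.1 h).resolve_left (inv_ne_zero hB)
  obtain ⟨u, hu, π, b, hb, rfl⟩ := exists_bruhat (ρ := stdOrder N) (σ := stdOrder N)
    Fin.val_injective Fin.val_injective g
  rw [dbl_mul_mul _ (unip_le_borel _ hu) hb]
  refine (heckeRelations hB).trace_eq_zero (linExt_comm hf.comm)
    (D := fun m => heckePerm F k (coxeterTail N (N - m))) ?_ ?_ ?_ ?_ (heckePerm_mem hB π)
  · rw [Nat.sub_self, coxeterTail, heckePerm_one hB]
  · intro m hm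
    exact heckePerm_coxeterTail hB hm
  · rw [Nat.sub_zero, heckePerm, linExt_dbl hB hf.comm, sum_coxeter_mul hp hψ hf, mul_zero]
  · intro m hm x hx
    have h1 := heckeAdjoin_le_span hB
      (Q := borel F fun i : Fin (N + 1) => if (i : ℕ) ≤ m then 0 else 1) (by
        intro b hb
        rw [mem_borel]
        intro i j hij
        refine mem_borel.1 hb _ _ ?_
        simp only [stdOrder]
        split_ifs at hij <;> omega) (w := fun i => permGL F (simpleSwap N i)) (by
        rintro i ⟨hi, him⟩
        rw [mem_borel]
        intro a c hac
        rw [permGL_apply, if_neg]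
        rintro rfl
        rw [simpleSwap_val hi] at hac
        split_ifs at hac <;> omega) hx
    clear hx
    induction h1 using Submodule.span_induction with
    | mem x hx =>
      obtain ⟨g, hg, rfl⟩ := hx
      rw [linExt_dbl hB hf.comm, sum_borel_parabolic ih hm hf hg, mul_zero]
    | zero => exact map_zero _
    | add x y _ _ hx hy => rw [map_add, hx, hy, add_zero]
    | smul c x _ hx => rw [map_smul, hx, smul_zero]

end Borel

section Main

variable {F k : Type} [Field F] [Field k] [Fintype F] [DecidableEq F]

theorem sum_borel_eq_zero {p : ℕ} [Fact p.Prime] [CharP F p] (hp : (p : k) ≠ 0)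
    {ψ : AddChar F k} {a : F} (hψ : ψ a ≠ 1)
    (hB : ∀ N, (Fintype.card (borel F (stdOrder N)) : k) ≠ 0)
    (ι : Type) [Fintype ι] [DecidableEq ι] {σ : ι → ℕ} (hσ : Function.Injective σ)
    {f : GL ι F → k} (hf : IsGood p f) (g : GL ι F) : ∑ b : borel F σ, f (g * b) = 0 := by
  induction hm : Fintype.card ι using Nat.strong_induction_on generalizing ι with
  | _ m ih =>
    rcases m with _ | N
    · have h0 : IsEmpty ι := Fintype.card_eq_zero_iff.1 hm
      refine Finset.sum_eq_zero fun b _ => hf.vanish _ ⟨0, Units.ext (Matrix.ext fun i => ?_)⟩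
      exact h0.elim i
    · let _ : LinearOrder ι := LinearOrder.lift' σ hσ
      let e : ι ≃o Fin (N + 1) := (Fintype.orderIsoFinOfCardEq ι hm).symm
      have h1 : borel F σ = borel F (stdOrder N ∘ e.toEquiv) := by
        have he : ∀ i j, σ j < σ i ↔ stdOrder N (e j) < stdOrder N (e i) := fun i j =>
          (e.lt_iff_lt (x := j) (y := i)).symm
        ext x
        simp only [mem_borel, he]
        rfl
      have h2 := sum_borel_stdOrder hp hψ (hB N)
        (fun ι _ _ hι σ hσ f hf g => ih _ hι ι hσ hf g rfl) (hf.reindex e.toEquiv.symm)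
        (reindexGL F e.toEquiv g)
      have h3 : ∀ x, reindexGL F e.toEquiv.symm (reindexGL F e.toEquiv x) = x := fun x => by
        ext i j
        simp [reindexGL_apply]
      rw [← sum_borel_reindex e.toEquiv (stdOrder N)
        fun b => f (reindexGL F e.toEquiv.symm (reindexGL F e.toEquiv g * b)), ← h1] at h2
      rw [← h2]
      refine Finset.sum_congr rfl fun b _ => ?_
      rw [← map_mul, h3]

theorem borel_mul_apply_self {ι : Type} [Fintype ι] [DecidableEq ι] {σ : ι → ℕ}
    (hσ : Function.Injective σ) {a b : GL ι F} (ha : a ∈ borel F σ) (hb : b ∈ borel F σ) (i : ι) :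
    ((a * b : GL ι F) : Matrix ι ι F) i i = (a : Matrix ι ι F) i i * (b : Matrix ι ι F) i i := by
  rw [Units.val_mul, Matrix.mul_apply, Finset.sum_eq_single i _ (by simp)]
  intro j _ hj
  rcases lt_or_gt_of_ne (hσ.ne hj) with h | h
  · rw [mem_borel.1 ha _ _ h, zero_mul]
  · rw [mem_borel.1 hb _ _ h, mul_zero]

theorem card_borel_ne_zero {p : ℕ} [Fact p.Prime] [CharP F p] {r : ℕ} [Fact r.Prime] [CharP k r]
    (hr : ¬ r ∣ Fintype.card F * (Fintype.card F - 1)) {ι : Type} [Fintype ι] [DecidableEq ι]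
    {σ : ι → ℕ} (hσ : Function.Injective σ) : (Fintype.card (borel F σ) : k) ≠ 0 := by
  have hrp : r.Prime := Fact.out
  intro h
  obtain ⟨b, hb⟩ := exists_prime_orderOf_dvd_card r ((CharP.cast_eq_zero_iff k r _).1 h)
  have hbr : b ^ r = 1 := by rw [← hb]; exact pow_orderOf_eq_one b
  have hdiag : ∀ i, ((b : GL ι F) : Matrix ι ι F) i i = 1 := by
    intro i
    have hpow : ∀ m : ℕ, (((b ^ m : borel F σ) : GL ι F) : Matrix ι ι F) i i =
        ((b : GL ι F) : Matrix ι ι F) i i ^ m := by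
      intro m
      induction m with
      | zero => simp
      | succ m ih =>
        rw [pow_succ, pow_succ, ← ih]
        exact borel_mul_apply_self hσ (b ^ m).2 b.2 i
    have h1 : ((b : GL ι F) : Matrix ι ι F) i i ^ r = 1 := by
      rw [← hpow, hbr]
      simp
    have h2 := FiniteField.pow_card_sub_one_eq_one _ (borel_apply_self_ne_zero hσ b.2 i)
    have h3 := pow_gcd_eq_one.2 ⟨h1, h2⟩
    have h4 : Nat.gcd r (Fintype.card F - 1) = 1 :=
      (Nat.Prime.coprime_iff_not_dvd hrp).2 fun h => hr (h.mul_left _)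
    rwa [h4, pow_one] at h3
  have hu : (b : GL ι F) ∈ unip F σ := by
    rw [mem_unip]
    intro i j hij
    rcases hij.lt_or_eq with h | h
    · rw [mem_borel.1 b.2 _ _ h, Matrix.one_apply_ne]
      rintro rfl
      exact lt_irrefl _ h
    · obtain rfl := hσ h
      rw [hdiag, Matrix.one_apply_eq]
  obtain ⟨m, hm⟩ := isPElement_of_mem_unip (p := p) hu
  have h1 : b ^ p ^ m = 1 := Subtype.ext hm
  have h2 := orderOf_dvd_of_pow_eq_one h1
  rw [hb] at h2
  have h3 := (Nat.prime_dvd_prime_iff_eq hrp (Fact.out : p.Prime)).1 (hrp.dvd_of_dvd_pow h2)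
  refine hr (Dvd.dvd.mul_right ?_ _)
  obtain ⟨c, -, hc⟩ := FiniteField.card F p
  rw [hc, h3]
  exact dvd_pow_self _ c.ne_zero

theorem exists_addChar_ne_one [IsAlgClosed k] (h : ringChar k ≠ ringChar F) :
    ∃ (ψ : AddChar F k) (a : F), ψ a ≠ 1 := by
  let P := AddChar.FiniteField.primitiveChar F k h
  have : FiniteDimensional k (CyclotomicField P.n k) :=
    inferInstanceAs (FiniteDimensional k (Polynomial.cyclotomic P.n k).SplittingField)
  let j : CyclotomicField P.n k →ₐ[k] k := IsAlgClosed.lift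
  have h1 := P.prim (one_ne_zero (α := F))
  obtain ⟨a, ha⟩ := AddChar.ne_one_iff.1 h1
  refine ⟨⟨fun x => j (P.char x), by simp, fun x y => by simp [AddChar.map_add_eq_mul]⟩, 1 * a, ?_⟩
  intro h2
  refine ha ?_
  rw [AddChar.mulShift_apply]
  exact j.toRingHom.injective (h2.trans (map_one _).symm)

end Main

section Density

variable {k R Y : Type} [Field k] [IsAlgClosed k] [Ring R] [Algebra k R] [AddCommGroup Y]
  [Module R Y] [Module k Y] [IsScalarTower k R Y] [IsSimpleModule R Y] [Module.Finite k Y]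

theorem exists_forall_smul_eq (f : Y →ₗ[k] Y) : ∃ x : R, ∀ y : Y, x • y = f y := by
  obtain ⟨s, hs⟩ := Module.Finite.fg_top (R := k) (M := Y)
  have hE := (IsSimpleModule.algebraMap_end_bijective_of_isAlgClosed (A := R) (V := Y) k).2
  let f' : Module.End (Module.End R Y) Y :=
    { f with
      map_smul' := fun φ y => by
        obtain ⟨c, rfl⟩ := hE φ
        exact f.map_smul c y }
  obtain ⟨x, hx⟩ := jacobson_density f' s
  refine ⟨x, fun y => ?_⟩
  have hy : y ∈ Submodule.span k (s : Set Y) := hs ▸ Submodule.mem_top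
  induction hy using Submodule.span_induction with
  | mem y hy => exact (hx y hy).symm
  | zero => rw [smul_zero, map_zero]
  | add y z _ _ hy hz => rw [smul_add, map_add, hy, hz]
  | smul c y _ hy => rw [smul_comm, map_smul, hy]

theorem exists_smul_eq_smul_self {y₀ : Y} (hy₀ : y₀ ≠ 0) (y₁ : Y) :
    ∃ (ξ : Y →ₗ[k] k) (x : R), ξ y₀ = 1 ∧ ∀ y : Y, x • y = ξ y • y₁ := by
  obtain ⟨ξ, hξ⟩ := Module.Projective.exists_dual_ne_zero k hy₀
  let ξ' := (ξ y₀)⁻¹ • ξ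
  obtain ⟨x, hx⟩ := exists_forall_smul_eq (R := R) (ξ'.smulRight y₁)
  exact ⟨ξ', x, by simp [ξ', hξ], fun y => by rw [hx, LinearMap.smulRight_apply]⟩

end Density

section Cocycle

variable {k R Y E : Type} [Field k] [Ring R] [Algebra k R] [AddCommGroup Y]
  [Module R Y] [Module k Y] [IsScalarTower k R Y] [AddCommGroup E] [Module R E] [Module k E]
  [IsScalarTower k R E]

/-- A `k`-linear splitting of an extension of `R`-modules. -/
structure LinearSplitting (i : Y →ₗ[R] E) (π : E →ₗ[R] Y) where
  /-- the retraction -/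
  ret : E →ₗ[k] Y
  /-- the section -/
  sec : Y →ₗ[k] E
  ret_inj : ∀ y, ret (i y) = y
  proj_sec : ∀ y, π (sec y) = y
  ret_sec : ∀ y, ret (sec y) = 0
  add_eq : ∀ x, i (ret x) + sec (π x) = x

theorem exists_linearSplitting {i : Y →ₗ[R] E} {π : E →ₗ[R] Y} (hi : Function.Injective i)
    (hπ : Function.Surjective π) (h : Function.Exact i π) :
    Nonempty (LinearSplitting (k := k) i π) := by
  obtain ⟨s, hs⟩ := (π.restrictScalars k).exists_rightInverse_of_surjective
    (LinearMap.range_eq_top.2 hπ)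
  have hs' : ∀ y, π (s y) = y := fun y => LinearMap.congr_fun hs y
  obtain ⟨j, hj⟩ := (i.restrictScalars k).exists_leftInverse_of_injective
    (LinearMap.ker_eq_bot.2 hi)
  have hj' : ∀ y, j (i y) = y := fun y => LinearMap.congr_fun hj y
  have h0 : ∀ y, π (i y) = 0 := h.apply_apply_eq_zero
  let r : E →ₗ[k] Y := j ∘ₗ (LinearMap.id - s ∘ₗ π.restrictScalars k)
  have hr : ∀ x, r x = j (x - s (π x)) := fun x => rfl
  refine ⟨⟨r, s, fun y => ?_, hs', fun y => ?_, fun x => ?_⟩⟩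
  · rw [hr, h0, map_zero, sub_zero, hj']
  · rw [hr, hs', sub_self, map_zero]
  · obtain ⟨y, hy⟩ := (h (x - s (π x))).1 (by rw [map_sub, hs', sub_self])
    rw [hr, ← hy, hj', hy, sub_add_cancel]

variable {i : Y →ₗ[R] E} {π : E →ₗ[R] Y}

/-- The derivation of `R` into the endomorphisms of `Y` attached to a linear splitting. -/
def LinearSplitting.cocycle (S : LinearSplitting (k := k) i π) : R →ₗ[k] Module.End k Y where
  toFun c := S.ret ∘ₗ Algebra.lsmul k k E c ∘ₗ S.sec
  map_add' a b := by
    ext y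
    simp
  map_smul' a b := by
    ext y
    simp

theorem LinearSplitting.cocycle_apply (S : LinearSplitting (k := k) i π) (c : R) (y : Y) :
    S.cocycle c y = S.ret (c • S.sec y) := rfl

theorem LinearSplitting.cocycle_mul (S : LinearSplitting (k := k) i π) (a b : R) :
    S.cocycle (a * b) =
      Algebra.lsmul k k Y a * S.cocycle b + S.cocycle a * Algebra.lsmul k k Y b := by
  ext y
  have h1 : b • S.sec y = i (S.cocycle b y) + S.sec (b • y) := by
    rw [S.cocycle_apply]
    conv_lhs => rw [← S.add_eq (b • S.sec y), π.map_smul, S.proj_sec]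
  rw [S.cocycle_apply, mul_smul, h1, smul_add, map_add, ← map_smul, S.ret_inj]
  rfl

theorem LinearSplitting.cocycle_one (S : LinearSplitting (k := k) i π) : S.cocycle 1 = 0 := by
  ext y
  rw [S.cocycle_apply, one_smul, S.ret_sec]
  rfl

theorem LinearSplitting.trace_cocycle_comm (S : LinearSplitting (k := k) i π) (a b : R) :
    LinearMap.trace k Y (S.cocycle (a * b)) = LinearMap.trace k Y (S.cocycle (b * a)) := by
  rw [S.cocycle_mul, S.cocycle_mul, map_add, map_add, add_comm, LinearMap.trace_mul_comm,
    LinearMap.trace_mul_comm k (S.cocycle b)]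

theorem LinearSplitting.trace_cocycle_pow (S : LinearSplitting (k := k) i π) (a : R) (n j : ℕ) :
    LinearMap.trace k Y (S.cocycle (a ^ n) * Algebra.lsmul k k Y a ^ (j + 1)) =
      n * LinearMap.trace k Y (S.cocycle a * Algebra.lsmul k k Y a ^ (n + j)) := by
  induction n generalizing j with
  | zero => simp [S.cocycle_one]
  | succ n ih =>
    rw [pow_succ, S.cocycle_mul, add_mul, map_add, mul_assoc, mul_assoc, ← pow_succ', ih,
      LinearMap.trace_mul_comm, mul_assoc, map_pow, ← pow_add, Nat.cast_add, Nat.cast_one, add_mul,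
      one_mul, add_comm, add_right_comm n 1 j, add_comm (j + 1) n, add_assoc n j 1]

theorem LinearSplitting.trace_cocycle_eq_zero (S : LinearSplitting (k := k) i π) {a : R} {n : ℕ}
    (ha : a ^ n = 1) (hn : (n : k) ≠ 0) : LinearMap.trace k Y (S.cocycle a) = 0 := by
  have h1 := S.trace_cocycle_pow a n 0
  rw [ha, S.cocycle_one, zero_mul, map_zero, add_zero, ← map_pow, ha, map_one, mul_one] at h1
  exact (mul_eq_zero.1 h1.symm).resolve_left hn

/-- If the trace of the derivation vanishes on `R * e`, where `e` fixes a nonzero vector of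
the simple module `Y`, then the annihilator of `Y` annihilates the extension. -/
theorem LinearSplitting.smul_eq_zero [IsAlgClosed k] [IsSimpleModule R Y] [Module.Finite k Y]
    (S : LinearSplitting (k := k) i π) {e : R}
    (he : ∀ x, LinearMap.trace k Y (S.cocycle (x * e)) = 0) {y₀ : Y} (hy₀ : y₀ ≠ 0)
    (hey : e • y₀ = y₀) {c : R} (hc : ∀ y : Y, c • y = 0) (x : E) : c • x = 0 := by
  have hmul : ∀ {c : R}, (∀ y : Y, c • y = 0) → Algebra.lsmul k k Y c = 0 := fun hc =>
    LinearMap.ext hc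
  have h1 : S.cocycle c = 0 := by
    by_contra h
    obtain ⟨y₁, hy₁⟩ : ∃ y₁, S.cocycle c y₁ ≠ 0 := by
      by_contra! h'
      exact h (LinearMap.ext h')
    obtain ⟨a, ha⟩ := IsSimpleModule.toSpanSingleton_surjective R hy₁ y₀
    rw [LinearMap.toSpanSingleton_apply] at ha
    obtain ⟨ξ, b, hξ, hb⟩ := exists_smul_eq_smul_self (k := k) (R := R) hy₀ y₁
    have h2 := he (a * (c * b))
    have h3 : S.cocycle (a * (c * b) * e) = ξ.smulRight y₀ * Algebra.lsmul k k Y e := by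
      rw [S.cocycle_mul, S.cocycle_mul, S.cocycle_mul]
      simp only [map_mul, hmul hc, zero_mul, mul_zero, zero_add, add_zero]
      congr 1
      ext y
      simp only [Module.End.mul_apply, Algebra.lsmul_coe, hb, map_smul, LinearMap.smulRight_apply]
      rw [ha]
    have h4 : ξ.smulRight y₀ * Algebra.lsmul k k Y e =
        (ξ ∘ₗ Algebra.lsmul k k Y e).smulRight y₀ := by
      ext y
      rfl
    rw [h3, h4, LinearMap.trace_smulRight] at h2
    simp [hey, hξ] at h2
  have h2 : ∀ y, c • S.sec y = 0 := fun y => by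
    rw [← S.add_eq (c • S.sec y), ← S.cocycle_apply, h1, map_smul, S.proj_sec, hc]
    simp
  rw [← S.add_eq x, smul_add, ← map_smul, hc, h2]
  simp

theorem exists_section_of_smul_eq_zero [IsSimpleModule R Y] {y₀ : Y} (hy₀ : y₀ ≠ 0) {v : E}
    (hv : π v = y₀) (h : ∀ a : R, a • y₀ = 0 → a • v = 0) :
    ∃ s : Y →ₗ[R] E, ∀ y, π (s y) = y := by
  have h1 := IsSimpleModule.toSpanSingleton_surjective R hy₀
  let q := (LinearMap.toSpanSingleton R Y y₀).quotKerEquivOfSurjective h1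
  let t := (LinearMap.ker (LinearMap.toSpanSingleton R Y y₀)).liftQ
    (LinearMap.toSpanSingleton R E v) fun a ha => h a ha
  refine ⟨t ∘ₗ q.symm.toLinearMap, fun y => ?_⟩
  obtain ⟨a, rfl⟩ := h1 y
  have h2 : q.symm (LinearMap.toSpanSingleton R Y y₀ a) = Submodule.Quotient.mk a := by
    rw [LinearEquiv.symm_apply_eq]
    rfl
  rw [LinearMap.comp_apply, LinearEquiv.coe_coe, h2]
  change π (a • v) = a • y₀
  rw [map_smul, hv]

/-- An extension of a simple module by itself splits if the traces of the attached derivations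
vanish on `R * e` as soon as the extension is generated by an `e`-fixed vector. -/
theorem exists_section [IsAlgClosed k] [IsSimpleModule R Y] [Module.Finite k Y]
    (hi : Function.Injective i) (hπ : Function.Surjective π) (hex : Function.Exact i π) {e : R}
    (hee : e * e = e) {y₀ : Y} (hy₀ : y₀ ≠ 0) (hey : e • y₀ = y₀)
    (he : ∀ v : E, e • v = v → Submodule.span R {v} = ⊤ → ∀ S : LinearSplitting (k := k) i π,
      ∀ x, LinearMap.trace k Y (S.cocycle (x * e)) = 0) :
    ∃ s : Y →ₗ[R] E, ∀ y, π (s y) = y := by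
  obtain ⟨v₀, hv₀⟩ := hπ y₀
  have hv : π (e • v₀) = y₀ := by rw [map_smul, hv₀, hey]
  set v := e • v₀ with hv_def
  by_cases h : ∀ a : R, a • y₀ = 0 → a • v = 0
  · exact exists_section_of_smul_eq_zero hy₀ hv h
  push Not at h
  obtain ⟨a, ha, hav⟩ := h
  have hev : e • v = v := by rw [hv_def, smul_smul, hee]
  have htop : Submodule.span R {v} = ⊤ := by
    have h1 : ∀ y, i y ∈ Submodule.span R {v} := by
      obtain ⟨y₁, hy₁⟩ := (hex (a • v)).1 (by rw [map_smul, hv, ha])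
      have hy₁' : y₁ ≠ 0 := by
        rintro rfl
        rw [map_zero] at hy₁
        exact hav hy₁.symm
      intro y
      obtain ⟨b, rfl⟩ := IsSimpleModule.toSpanSingleton_surjective R hy₁' y
      rw [LinearMap.toSpanSingleton_apply, map_smul, hy₁, smul_smul]
      exact Submodule.smul_mem _ _ (Submodule.mem_span_singleton_self v)
    rw [eq_top_iff]
    rintro x -
    obtain ⟨b, hb⟩ := IsSimpleModule.toSpanSingleton_surjective R hy₀ (π x)
    rw [LinearMap.toSpanSingleton_apply] at hb
    obtain ⟨y, hy⟩ := (hex (x - b • v)).1 (by rw [map_sub, map_smul, hv, hb, sub_self])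
    rw [← sub_add_cancel x (b • v), ← hy]
    exact add_mem (h1 y) (Submodule.smul_mem _ _ (Submodule.mem_span_singleton_self v))
  obtain ⟨S⟩ := exists_linearSplitting (k := k) hi hπ hex
  obtain ⟨ξ, b, hξ, hb⟩ := exists_smul_eq_smul_self (k := k) (R := R) hy₀ y₀
  refine exists_section_of_smul_eq_zero hy₀ (v := b • v) ?_ fun a ha => ?_
  · rw [map_smul, hv, hb, hξ, one_smul]
  · rw [smul_smul]
    refine S.smul_eq_zero (he v hev htop S) hy₀ hey (fun y => ?_) v
    rw [mul_smul, hb, smul_comm, ha, smul_zero]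

end Cocycle

section Good

variable {F k : Type} [Field F] [Field k] [Fintype F] [DecidableEq F]
  {ι : Type} [Fintype ι] [DecidableEq ι] {σ : ι → ℕ}
  {E Y : Type} [AddCommGroup E] [Module (MonoidAlgebra k (GL ι F)) E] [Module k E]
  [IsScalarTower k (MonoidAlgebra k (GL ι F)) E]
  [AddCommGroup Y] [Module (MonoidAlgebra k (GL ι F)) Y] [Module k Y]
  [IsScalarTower k (MonoidAlgebra k (GL ι F)) Y]

theorem of_smul_of_idem_smul {v : E} (hv : idem k (borel F σ) • v = v) {b : GL ι F}
    (hb : b ∈ borel F σ) : MonoidAlgebra.of k (GL ι F) b • v = v := by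
  conv_lhs => rw [← hv]
  rw [smul_smul, of_mul_idem hb, hv]

theorem matrixCoeff_mem_flagSpan (hσ : Function.Injective σ) {v : E}
    (hv : idem k (borel F σ) • v = v)
    (htop : Submodule.span (MonoidAlgebra k (GL ι F)) {v} = ⊤) (l : E →ₗ[k] k) (w : E) :
    (fun g => l (MonoidAlgebra.of k (GL ι F) g • w)) ∈ flagSpan ι F k := by
  obtain ⟨x, rfl⟩ := Submodule.mem_span_singleton.1 (htop.ge (Submodule.mem_top (x := w)))
  induction x using MonoidAlgebra.induction_on with
  | of x =>
    refine Submodule.subset_span ⟨x, σ, hσ, fun g b hb => ?_⟩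
    have h1 : g * (x * b * x⁻¹) * x = g * x * b := by group
    simp only [smul_smul, ← map_mul, h1]
    rw [map_mul, mul_smul, of_smul_of_idem_smul hv hb]
  | add x y hx hy =>
    convert add_mem hx hy using 1
    ext g
    simp [add_smul]
  | smul c x hx =>
    convert Submodule.smul_mem _ c hx using 1
    ext g
    simp [smul_comm _ c]

theorem isGood_trace_cocycle {p : ℕ} (hp : (p : k) ≠ 0) (hσ : Function.Injective σ) [Module.Finite k Y]
    {i : Y →ₗ[MonoidAlgebra k (GL ι F)] E} {π : E →ₗ[MonoidAlgebra k (GL ι F)] Y} {v : E}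
    (hv : idem k (borel F σ) • v = v)
    (htop : Submodule.span (MonoidAlgebra k (GL ι F)) {v} = ⊤)
    (S : LinearSplitting (k := k) i π) :
    IsGood p fun g => LinearMap.trace k Y (S.cocycle (MonoidAlgebra.of k (GL ι F) g)) where
  comm g h := by simp only [map_mul, S.trace_cocycle_comm]
  mem := by
    let b := Module.finBasis k Y
    have h1 : (fun g => LinearMap.trace k Y (S.cocycle (MonoidAlgebra.of k (GL ι F) g))) =
        ∑ j, fun g => (b.coord j ∘ₗ S.ret) (MonoidAlgebra.of k (GL ι F) g • S.sec (b j)) := by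
      ext g
      rw [LinearMap.trace_eq_matrix_trace k b, Matrix.trace, Finset.sum_apply]
      refine Finset.sum_congr rfl fun j _ => ?_
      rw [Matrix.diag_apply, LinearMap.toMatrix_apply]
      rfl
    rw [h1]
    exact sum_mem fun j _ => matrixCoeff_mem_flagSpan hσ hv htop _ _
  vanish g hg := by
    obtain ⟨m, hm⟩ := hg
    refine S.trace_cocycle_eq_zero (n := p ^ m) (by rw [← map_pow, hm, map_one]) ?_
    rw [Nat.cast_pow]
    exact pow_ne_zero _ hp

theorem trace_cocycle_mul_idem {p : ℕ} [Fact p.Prime] [CharP F p] (hp : (p : k) ≠ 0)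
    {ψ : AddChar F k} {a : F} (hψ : ψ a ≠ 1)
    (hB : ∀ N, (Fintype.card (borel F (stdOrder N)) : k) ≠ 0) (hσ : Function.Injective σ)
    [Module.Finite k Y]
    {i : Y →ₗ[MonoidAlgebra k (GL ι F)] E} {π : E →ₗ[MonoidAlgebra k (GL ι F)] Y} {v : E}
    (hv : idem k (borel F σ) • v = v)
    (htop : Submodule.span (MonoidAlgebra k (GL ι F)) {v} = ⊤)
    (S : LinearSplitting (k := k) i π) (x : MonoidAlgebra k (GL ι F)) :
    LinearMap.trace k Y (S.cocycle (x * idem k (borel F σ))) = 0 := by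
  set f : GL ι F → k := fun g => LinearMap.trace k Y (S.cocycle (MonoidAlgebra.of k (GL ι F) g))
    with hf
  have h1 : ∀ x, LinearMap.trace k Y (S.cocycle x) = linExt f x := by
    intro x
    induction x using MonoidAlgebra.induction_on with
    | of g => rw [linExt_of]
    | add x y hx hy => rw [map_add, map_add, map_add, hx, hy]
    | smul c x hx => rw [map_smul, map_smul, map_smul, hx]
  rw [h1]
  induction x using MonoidAlgebra.induction_on with
  | of g =>
    rw [linExt_of_mul_idem, sum_borel_eq_zero hp hψ hB ι hσ (isGood_trace_cocycle hp hσ hv htop S),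
      mul_zero]
  | add x y hx hy => rw [add_mul, map_add, hx, hy, add_zero]
  | smul c x hx => rw [smul_mul_assoc, map_smul, hx, smul_zero]

end Good

section Extension

variable {R Y : Type} [Ring R] [AddCommGroup Y] [Module R Y]

theorem exists_extension_of_cocycle {P₀ P₁ P₂ : Type} [AddCommGroup P₀] [Module R P₀]
    [AddCommGroup P₁] [Module R P₁] [AddCommGroup P₂] [Module R P₂]
    (hsplit : ∀ (E : Type) [AddCommGroup E] [Module R E] (i : Y →ₗ[R] E) (π : E →ₗ[R] Y),
      Function.Injective i → Function.Surjective π → Function.Exact i π →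
        ∃ s : Y →ₗ[R] E, ∀ y, π (s y) = y)
    {d₂ : P₂ →ₗ[R] P₁} {d₁ : P₁ →ₗ[R] P₀} {ε : P₀ →ₗ[R] Y} (h₁ : Function.Exact d₂ d₁)
    (h₀ : Function.Exact d₁ ε) (hε : Function.Surjective ε) {f : P₁ →ₗ[R] Y}
    (hf : ∀ x, f (d₂ x) = 0) : ∃ h : P₀ →ₗ[R] Y, ∀ x, h (d₁ x) = f x := by
  let N : Submodule R (P₀ × Y) := LinearMap.range (d₁.prod f)
  let i : Y →ₗ[R] (P₀ × Y) ⧸ N := N.mkQ ∘ₗ LinearMap.inr R P₀ Y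
  let π : (P₀ × Y) ⧸ N →ₗ[R] Y := N.liftQ (ε ∘ₗ LinearMap.fst R P₀ Y) (by
    rintro _ ⟨x, rfl⟩
    exact h₀.apply_apply_eq_zero x)
  have hN : ∀ x, N.mkQ (d₁ x, f x) = 0 := fun x => (Submodule.Quotient.mk_eq_zero N).2 ⟨x, rfl⟩
  have hi : Function.Injective i := by
    rw [injective_iff_map_eq_zero]
    intro y hy
    obtain ⟨x, hx⟩ := (Submodule.Quotient.mk_eq_zero N).1 hy
    obtain ⟨hx1, hx2⟩ := Prod.ext_iff.1 hx
    obtain ⟨z, rfl⟩ := (h₁ x).1 hx1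
    rw [← show f (d₂ z) = y from hx2, hf]
  have hπ : Function.Surjective π := fun y => by
    obtain ⟨z, rfl⟩ := hε y
    exact ⟨N.mkQ (z, 0), rfl⟩
  have hex : Function.Exact i π := by
    intro x
    obtain ⟨⟨z, y⟩, rfl⟩ := N.mkQ_surjective x
    constructor
    · intro h
      obtain ⟨w, rfl⟩ := (h₀ z).1 h
      refine ⟨y - f w, ?_⟩
      rw [← sub_eq_zero, ← neg_eq_zero, ← hN w]
      change -(N.mkQ (0, y - f w) - N.mkQ (d₁ w, y)) = _
      rw [← map_sub, ← map_neg]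
      simp
    · rintro ⟨y', hy'⟩
      rw [← hy']
      exact map_zero ε
  obtain ⟨s, hs⟩ := hsplit _ i π hi hπ hex
  let j := LinearEquiv.ofInjective i hi
  have hker : ∀ x, x - s (π x) ∈ LinearMap.range i := fun x =>
    (hex _).1 (by rw [map_sub, hs, sub_self])
  let ret : (P₀ × Y) ⧸ N →ₗ[R] Y :=
    j.symm.toLinearMap ∘ₗ (LinearMap.id - s ∘ₗ π).codRestrict (LinearMap.range i) hker
  have hret : ∀ y, ret (i y) = y := fun y => by
    change j.symm ⟨i y - s (π (i y)), _⟩ = y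
    rw [LinearEquiv.symm_apply_eq]
    refine Subtype.ext ?_
    change i y - s (π (i y)) = i y
    rw [hex.apply_apply_eq_zero, map_zero, sub_zero]
  refine ⟨-(ret ∘ₗ N.mkQ ∘ₗ LinearMap.inl R P₀ Y), fun x => ?_⟩
  change - ret (N.mkQ (d₁ x, 0)) = f x
  have h3 : N.mkQ (d₁ x, 0) = - i (f x) := by
    rw [← sub_eq_zero, ← hN x]
    change N.mkQ (d₁ x, 0) - - N.mkQ (0, f x) = _
    rw [← map_neg, ← map_sub]
    simp
  rw [h3, map_neg, hret, neg_neg]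

theorem subsingleton_ext_one
    (hsplit : ∀ (E : Type) [AddCommGroup E] [Module R E] (i : Y →ₗ[R] E) (π : E →ₗ[R] Y),
      Function.Injective i → Function.Surjective π → Function.Exact i π →
        ∃ s : Y →ₗ[R] E, ∀ y, π (s y) = y) :
    Subsingleton (((Ext ℤ (ModuleCat R) 1).obj (Opposite.op (ModuleCat.of R Y))).obj
      (ModuleCat.of R Y)) := by
  let P := projectiveResolution (ModuleCat.of R Y)
  rw [← ModuleCat.isZero_iff_subsingleton]
  refine Limits.IsZero.of_iso ?_ (P.isoExt 1 (ModuleCat.of R Y))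
  rw [← HomologicalComplex.exactAt_iff_isZero_homology,
    HomologicalComplex.exactAt_iff' _ 0 1 2 (by simp) (by simp), ShortComplex.moduleCat_exact_iff]
  intro f hf
  change P.complex.X 1 ⟶ ModuleCat.of R Y at f
  have hf' : P.complex.d 2 1 ≫ f = 0 := hf
  have h1 := (ShortComplex.ShortExact.moduleCat_exact_iff_function_exact _).1 (P.exact_succ 0)
  have h0 := (ShortComplex.ShortExact.moduleCat_exact_iff_function_exact _).1 P.exact₀
  have hε := (ModuleCat.epi_iff_surjective (P.π.f 0)).1 inferInstance
  obtain ⟨h, hh⟩ := exists_extension_of_cocycle hsplit (d₂ := (P.complex.d 2 1).hom)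
    (d₁ := (P.complex.d 1 0).hom) (ε := (P.π.f 0).hom) h1 h0 hε (f := f.hom) fun x =>
      LinearMap.congr_fun (congrArg ModuleCat.Hom.hom hf') x
  refine ⟨(ModuleCat.ofHom h : P.complex.X 0 ⟶ ModuleCat.of R Y), ?_⟩
  change P.complex.d 1 0 ≫ ModuleCat.ofHom h = f
  ext x
  exact hh x

end Extension

section Head

variable {k G : Type} [Field k] [Group G] {B : Subgroup G} {Y : Type} [AddCommGroup Y]
  [Module (MonoidAlgebra k G) Y]

variable (k B) in
/-- The basis vector of the permutation module attached to the trivial coset. -/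
def baseCoset : permutationModule k B :=
  (Representation.ofMulAction k G (G ⧸ B)).asModuleEquiv.symm (MonoidAlgebra.single ((1 : G) : G ⧸ B) 1)

theorem of_smul_baseCoset (g : G) : MonoidAlgebra.of k G g • baseCoset k B =
    (Representation.ofMulAction k G (G ⧸ B)).asModuleEquiv.symm
      (MonoidAlgebra.single (g : G ⧸ B) 1) := by
  rw [baseCoset, ← Representation.asModuleEquiv_symm_map_rho, Representation.ofMulAction_single]
  rw [← QuotientGroup.mk_mul_of_mem g (one_mem B)]
  rfl

theorem exists_smul_baseCoset (x : permutationModule k B) :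
    ∃ a : MonoidAlgebra k G, a • baseCoset k B = x := by
  obtain ⟨x, rfl⟩ := (Representation.ofMulAction k G (G ⧸ B)).asModuleEquiv.symm.surjective x
  induction x using MonoidAlgebra.induction_linear with
  | zero => exact ⟨0, by rw [zero_smul, map_zero]⟩
  | add x y hx hy =>
    obtain ⟨a, ha⟩ := hx
    obtain ⟨b, hb⟩ := hy
    exact ⟨a + b, by rw [add_smul, ha, hb, map_add]⟩
  | single x c =>
    obtain ⟨g, rfl⟩ := QuotientGroup.mk_surjective x
    refine ⟨c • MonoidAlgebra.of k G g, ?_⟩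
    rw [smul_assoc, of_smul_baseCoset, ← map_smul]
    simp

theorem idem_smul_of_forall [Fintype B] [Module k Y] [IsScalarTower k (MonoidAlgebra k G) Y]
    (hB : (Fintype.card B : k) ≠ 0) {y : Y} (h : ∀ b ∈ B, MonoidAlgebra.of k G b • y = y) :
    idem k B • y = y := by
  rw [idem, smul_assoc, Finset.sum_smul, Finset.sum_congr rfl fun (b : B) _ => h b b.2,
    Finset.sum_const, Finset.card_univ, ← Nat.cast_smul_eq_nsmul k, smul_smul,
    inv_mul_cancel₀ hB, one_smul]

end Head

theorem upperTriangularSubgroup_eq (n : ℕ) (F : Type) [Field F] :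
    upperTriangularSubgroup n F = borel F (Fin.val : Fin n → ℕ) := by
  ext g
  rw [mem_borel]
  rfl

end UnipotentSeries

open UnipotentSeries

/-- if `Y` is a simple `kG`-module lying in the head of `k[G/B]`
(i.e. there is a surjective `kG`-homomorphism `k[G/B] → Y`), then
`Ext¹_{kG}(Y, Y) = 0`. -/
theorem ext_one_self_eq_zero_of_unipotent_principal_series
    (n : ℕ) (hn : 0 < n) (q : ℕ) (hq : IsPrimePow q)
    (F : Type) [Field F] [Fintype F] (hF : Fintype.card F = q)
    (k : Type) [Field k] [IsAlgClosed k]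
    (r : ℕ) (hr : ringChar k = r) (hr0 : 0 < r) (hrq : ¬ r ∣ q * (q - 1))
    (Y : Type) [AddCommGroup Y] [Module (MonoidAlgebra k (GL (Fin n) F)) Y]
    [IsSimpleModule (MonoidAlgebra k (GL (Fin n) F)) Y]
    (φ : permutationModule k (upperTriangularSubgroup n F)
        →ₗ[MonoidAlgebra k (GL (Fin n) F)] Y)
    (hφ : Function.Surjective φ) :
    Subsingleton
      (((Ext ℤ (ModuleCat (MonoidAlgebra k (GL (Fin n) F))) 1).obj
          (Opposite.op (ModuleCat.of (MonoidAlgebra k (GL (Fin n) F)) Y))).obj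
        (ModuleCat.of (MonoidAlgebra k (GL (Fin n) F)) Y)) := by
  classical
  subst hF hr
  have hp : Fact (ringChar F).Prime := ⟨CharP.char_is_prime F _⟩
  have hr : Fact (ringChar k).Prime :=
    ⟨(CharP.char_is_prime_or_zero k _).resolve_right hr0.ne'⟩
  have hpk : ((ringChar F : ℕ) : k) ≠ 0 := fun h => by
    refine hrq (Dvd.dvd.mul_right (((CharP.cast_eq_zero_iff k (ringChar k) _).1 h).trans ?_) _)
    exact (CharP.cast_eq_zero_iff F (ringChar F) _).1 (FiniteField.cast_card_eq_zero F)
  obtain ⟨ψ, a, hψ⟩ := exists_addChar_ne_one (F := F) (k := k) fun h => hpk (by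
    rw [← h]
    exact CharP.cast_eq_zero k _)
  have hB : ∀ N, (Fintype.card (borel F (stdOrder N)) : k) ≠ 0 := fun N =>
    card_borel_ne_zero (p := ringChar F) hrq Fin.val_injective
  have hBn : (Fintype.card (borel F (Fin.val : Fin n → ℕ)) : k) ≠ 0 :=
    card_borel_ne_zero (p := ringChar F) hrq Fin.val_injective
  let R := MonoidAlgebra k (GL (Fin n) F)
  let _ : Module k Y := Module.compHom Y (algebraMap k R)
  have _ : IsScalarTower k R Y := IsScalarTower.of_algebraMap_smul fun _ _ => rfl
  set y₀ : Y := φ (baseCoset k (upperTriangularSubgroup n F)) with hy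
  have hgen : ∀ y : Y, ∃ x : R, x • y₀ = y := fun y => by
    obtain ⟨w, rfl⟩ := hφ y
    obtain ⟨x, rfl⟩ := exists_smul_baseCoset w
    exact ⟨x, (map_smul φ x _).symm⟩
  have hy₀ : y₀ ≠ 0 := fun h => by
    obtain ⟨y, hy⟩ := @exists_ne Y (IsSimpleModule.nontrivial R Y) 0
    obtain ⟨x, rfl⟩ := hgen y
    exact hy (by rw [h, smul_zero])
  have _ : Module.Finite k R := Module.Finite.of_basis (MonoidAlgebra.basis (GL (Fin n) F) k)
  have _ : Module.Finite k Y :=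
    Module.Finite.of_surjective ((LinearMap.toSpanSingleton R Y y₀).restrictScalars k) hgen
  have hey : idem k (borel F (Fin.val : Fin n → ℕ)) • y₀ = y₀ := by
    refine idem_smul_of_forall hBn fun b hb => ?_
    rw [← upperTriangularSubgroup_eq] at hb
    rw [hy, ← map_smul, of_smul_baseCoset, QuotientGroup.eq.2 (mul_mem (inv_mem hb) (one_mem _))]
    rfl
  refine subsingleton_ext_one fun E _ _ i π hi hπ hex => ?_
  let _ : Module k E := Module.compHom E (algebraMap k R)
  have _ : IsScalarTower k R E := IsScalarTower.of_algebraMap_smul fun _ _ => rfl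
  exact exists_section hi hπ hex (idem_mul_idem hBn) hy₀ hey fun v hv htop S x =>
    trace_cocycle_mul_idem hpk hψ hB Fin.val_injective hv htop S x
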